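/- (Theorem 3: two encoders and three decoders with lossless/lossy constraints and side information.) In the setting where node 3 sends no messages (R3=0) and the constraints are: node 1 reconstructs X_2^n with distortion target D12, node 2 reconstructs X_1^n losslessly, and node 3 (which observes X_3^n) reconstructs X_1^n losslessly and X_2^n with distortion target D32: a rate pair (R1,R2) is achievable if and only if there exist finite sets 𝒰1,𝒰2 with |𝒰1| ≤ |𝒳1||𝒳2|+2 and |𝒰2| ≤ |𝒳1||𝒳2||𝒰1|+1, a joint pmf p_{X1X2X3U1U2} whose (X1,X2,X3)-marginal equals the source pmf and which satisfies the Markov chain (U1,U2) −∘− (X1,X2) −∘− X3, and maps g32: 𝒳1×𝒳3×𝒰1×𝒰2 → X̂2 and g12: 𝒳1×𝒰1 → X̂2 with E[d2(X2, g32(X1,X3,U1,U2))] ≤ D32 and E[d2(X2, g12(X1,U1))] ≤ D12, such that R1 ≥ H(X1|X2), R2 ≥ I(U1;X2|X1) + I(U2;X2|U1,X1,X3), and R1+R2 ≥ H(X1|X3) + I(U1,U2;X2|X1,X3). -/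

import Mathlib

noncomputable section

namespace IT

variable {Ω : Type*} [Fintype Ω]

open Classical in
/-- Probability of an event under a weight function on a finite sample space. -/
def pr (w : Ω → ℝ) (E : Ω → Prop) : ℝ := ∑ ω, if E ω then w ω else 0

open Classical in
/-- The distribution (pmf) of a random variable. -/
def dist (w : Ω → ℝ) {α : Type*} [Fintype α] (X : Ω → α) (a : α) : ℝ :=
  ∑ ω, if X ω = a then w ω else 0

/-- Shannon entropy (base 2). -/
def H (w : Ω → ℝ) {α : Type*} [Fintype α] (X : Ω → α) : ℝ :=
  -∑ a, dist w X a * Real.logb 2 (dist w X a)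

/-- Conditional entropy H(X|Y). -/
def condH (w : Ω → ℝ) {α β : Type*} [Fintype α] [Fintype β] (X : Ω → α) (Y : Ω → β) : ℝ :=
  H w (fun ω => (X ω, Y ω)) - H w Y

/-- Mutual information I(X;Y). -/
def mutInfo (w : Ω → ℝ) {α β : Type*} [Fintype α] [Fintype β] (X : Ω → α) (Y : Ω → β) : ℝ :=
  H w X + H w Y - H w (fun ω => (X ω, Y ω))

/-- Conditional mutual information I(X;Y|Z). -/
def condMutInfo (w : Ω → ℝ) {α β γ : Type*} [Fintype α] [Fintype β] [Fintype γ]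
    (X : Ω → α) (Y : Ω → β) (Z : Ω → γ) : ℝ :=
  condH w X Z - condH w X (fun ω => (Y ω, Z ω))

/-- Expectation of a real random variable. -/
def expect (w : Ω → ℝ) (f : Ω → ℝ) : ℝ := ∑ ω, w ω * f ω

end IT

/-- `p` is a probability mass function on a finite type. -/
def IsPMF {α : Type*} [Fintype α] (p : α → ℝ) : Prop := (∀ a, 0 ≤ p a) ∧ ∑ a, p a = 1

/-- The i.i.d. (product) weight on `n`-sequences induced by a single-letter pmf. -/
def iidW {α : Type*} (p : α → ℝ) (n : ℕ) : (Fin n → α) → ℝ := fun x => ∏ t, p (x t)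

/-- The first `l` components of a dependent tuple (the rest masked). -/
def trunc {K : ℕ} {γ : Fin K → Type*} (l : ℕ) (f : (k : Fin K) → γ k) :
    (k : Fin K) → Option (γ k) :=
  fun k => if k.val < l then some (f k) else none

/-- Coordinates with (0-based) index `< t`. -/
def below {n : ℕ} {α : Type*} (t : ℕ) (x : Fin n → α) : Fin n → Option α :=
  fun s => if s.val < t then some (x s) else none

/-- Coordinates with (0-based) index `> t`. -/
def above {n : ℕ} {α : Type*} (t : ℕ) (x : Fin n → α) : Fin n → Option α :=
  fun s => if t < s.val then some (x s) else none

/-- Coordinates with (0-based) index `≥ t`. -/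
def fromIdx {n : ℕ} {α : Type*} (t : ℕ) (x : Fin n → α) : Fin n → Option α :=
  fun s => if t ≤ s.val then some (x s) else none

open Classical in
/-- Number of occurrences of `a` in the sequence `x`. -/
def Nocc {n : ℕ} {α : Type*} (a : α) (x : Fin n → α) : ℕ :=
  (Finset.univ.filter fun t => x t = a).card

/-- Strongly typical set. -/
def typical {α : Type*} [Fintype α] (Q : α → ℝ) (δ : ℝ) (n : ℕ) : Set (Fin n → α) :=
  {x | ∀ a, Q a ≠ 0 → |(Nocc a x : ℝ) / n - Q a| ≤ δ / Fintype.card α}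

open IT

namespace TE

section basic
variable {Ω : Type*} [Fintype Ω] {α β γ δ : Type*} [Fintype α] [Fintype β] [Fintype γ] [Fintype δ]

lemma dist_nonneg {w : Ω → ℝ} (hw : ∀ ω, 0 ≤ w ω) (X : Ω → α) (a : α) : 0 ≤ IT.dist w X a := by
  unfold IT.dist
  refine Finset.sum_nonneg fun ω _ => ?_
  split_ifs
  · exact hw ω
  · exact le_rfl

lemma sum_dist_mul (w : Ω → ℝ) (X : Ω → α) (f : α → ℝ) :
    ∑ a, IT.dist w X a * f a = ∑ ω, w ω * f (X ω) := by
  unfold IT.dist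
  simp_rw [Finset.sum_mul]
  rw [Finset.sum_comm]
  refine Finset.sum_congr rfl fun ω _ => ?_
  rw [Finset.sum_eq_single (X ω)]
  · simp
  · intro b _ hb
    simp [Ne.symm hb]
  · simp

lemma sum_dist (w : Ω → ℝ) (X : Ω → α) : ∑ a, IT.dist w X a = ∑ ω, w ω := by
  have := sum_dist_mul w X (fun _ => 1)
  simpa using this

lemma isPMF_dist {w : Ω → ℝ} (hw : IsPMF w) (X : Ω → α) : IsPMF (IT.dist w X) :=
  ⟨dist_nonneg hw.1 X, by rw [sum_dist]; exact hw.2⟩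

lemma dist_comp (w : Ω → ℝ) (X : Ω → α) (f : α → β) (b : β) :
    IT.dist (IT.dist w X) f b = IT.dist w (fun ω => f (X ω)) b := by
  classical
  have := sum_dist_mul w X (fun a => if f a = b then 1 else 0)
  unfold IT.dist at *
  simp only [mul_ite, mul_one, mul_zero] at this
  convert this using 1

lemma H_eq (w : Ω → ℝ) (X : Ω → α) :
    H w X = -∑ ω, w ω * Real.logb 2 (IT.dist w X (X ω)) := by
  unfold H
  rw [sum_dist_mul w X (fun a => Real.logb 2 (IT.dist w X a))]

lemma H_map (w : Ω → ℝ) (X : Ω → α) (f : α → β) :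
    H (IT.dist w X) f = H w (fun ω => f (X ω)) := by
  unfold H
  simp_rw [dist_comp]

lemma condH_map (w : Ω → ℝ) (X : Ω → α) (f : α → β) (g : α → γ) :
    condH (IT.dist w X) f g = condH w (fun ω => f (X ω)) (fun ω => g (X ω)) := by
  unfold condH
  rw [H_map, H_map]

lemma condMutInfo_map (w : Ω → ℝ) (X : Ω → α) (f : α → β) (g : α → γ) (h : α → δ) :
    condMutInfo (IT.dist w X) f g h
      = condMutInfo w (fun ω => f (X ω)) (fun ω => g (X ω)) (fun ω => h (X ω)) := by
  unfold condMutInfo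
  rw [condH_map, condH_map]

lemma expect_map (w : Ω → ℝ) (X : Ω → α) (f : α → ℝ) :
    expect (IT.dist w X) f = expect w (fun ω => f (X ω)) := by
  unfold expect
  rw [sum_dist_mul]

lemma le_dist {w : Ω → ℝ} (hw : ∀ ω, 0 ≤ w ω) (X : Ω → α) (ω : Ω) : w ω ≤ IT.dist w X (X ω) := by
  classical
  unfold IT.dist
  have := Finset.single_le_sum (f := fun ω' => if X ω' = X ω then w ω' else 0) (s := Finset.univ)
    (fun i _ => by
      show 0 ≤ if X i = X ω then w i else 0
      split_ifs
      · exact hw i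
      · exact le_rfl) (Finset.mem_univ ω)
  simp only [if_true] at this
  convert this using 1

lemma dist_le_one {w : Ω → ℝ} (hw : IsPMF w) (X : Ω → α) (a : α) : IT.dist w X a ≤ 1 := by
  rw [← hw.2, ← sum_dist w X]
  exact Finset.single_le_sum (fun i _ => dist_nonneg hw.1 X i) (Finset.mem_univ a)

lemma H_mono {w : Ω → ℝ} (hw : ∀ ω, 0 ≤ w ω) (X : Ω → α) (Y : Ω → β)
    (h : ∀ ω ω', w ω ≠ 0 → w ω' ≠ 0 → Y ω = Y ω' → X ω = X ω') : H w X ≤ H w Y := by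
  rw [H_eq, H_eq, neg_le_neg_iff]
  refine Finset.sum_le_sum fun ω _ => ?_
  by_cases h0 : w ω = 0
  · simp [h0]
  have hp : 0 < w ω := lt_of_le_of_ne (hw ω) (Ne.symm h0)
  refine mul_le_mul_of_nonneg_left ?_ hp.le
  refine Real.logb_le_logb_of_le (by norm_num) (lt_of_lt_of_le hp (le_dist hw Y ω)) ?_
  unfold IT.dist
  refine Finset.sum_le_sum fun ω' _ => ?_
  by_cases h1 : w ω' = 0
  · simp [h1]
  by_cases h2 : Y ω' = Y ω
  · rw [if_pos h2, if_pos (h ω' ω h1 h0 h2)]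
  · rw [if_neg h2]
    split_ifs
    · exact hw ω'
    · exact le_rfl

lemma H_congr {w : Ω → ℝ} (hw : ∀ ω, 0 ≤ w ω) (X : Ω → α) (Y : Ω → β)
    (h : ∀ ω ω', w ω ≠ 0 → w ω' ≠ 0 → (X ω = X ω' ↔ Y ω = Y ω')) : H w X = H w Y :=
  le_antisymm (H_mono hw X Y fun a b c d => (h a b c d).2) (H_mono hw Y X fun a b c d => (h a b c d).1)

lemma H_const {w : Ω → ℝ} (hw : IsPMF w) (X : Ω → α) (h : ∀ ω ω', w ω ≠ 0 → w ω' ≠ 0 → X ω = X ω') :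
    H w X = 0 := by
  rw [H_congr hw.1 X (fun _ => ()) (fun a b c d => by simp [h a b c d])]
  unfold H
  have : IT.dist w (fun _ : Ω => ()) () = 1 := by
    unfold IT.dist
    simpa using hw.2
  simp [this]

lemma H_nonneg {w : Ω → ℝ} (hw : IsPMF w) (X : Ω → α) : 0 ≤ H w X := by
  rw [← H_const hw (fun _ => ()) (fun _ _ _ _ => rfl)]
  exact H_mono hw.1 _ _ (fun _ _ _ _ _ => rfl)

end basic

section gibbs

lemma gibbs_term {a b : ℝ} (ha : 0 ≤ a) (hb : 0 ≤ b) (hab : b = 0 → a = 0) :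
    a * Real.log b ≤ a * Real.log a - a + b := by
  rcases ha.eq_or_lt with rfl | ha
  · simpa using hb
  rcases hb.eq_or_lt with hb | hb
  · exact absurd (hab hb.symm) ha.ne'
  have := Real.log_le_sub_one_of_pos (div_pos hb ha)
  rw [Real.log_div hb.ne' ha.ne'] at this
  have h2 := mul_le_mul_of_nonneg_left this ha.le
  have : a * (b / a - 1) = b - a := by field_simp
  nlinarith

lemma gibbs_term_eq {a b : ℝ} (ha : 0 ≤ a) (hb : 0 ≤ b) (hab : b = 0 → a = 0)
    (h : a * Real.log b = a * Real.log a - a + b) : a = b := by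
  rcases ha.eq_or_lt with rfl | ha
  · simpa using h
  rcases hb.eq_or_lt with hb | hb
  · exact absurd (hab hb.symm) ha.ne'
  by_contra hne
  have := Real.log_lt_sub_one_of_pos (div_pos hb ha) (by
    rw [ne_eq, div_eq_one_iff_eq ha.ne']; exact fun h => hne h.symm)
  rw [Real.log_div hb.ne' ha.ne'] at this
  have h2 := mul_lt_mul_of_pos_left this ha
  have : a * (b / a - 1) = b - a := by field_simp
  nlinarith

variable {ι : Type*} [Fintype ι]

lemma gibbs (a b : ι → ℝ) (ha : ∀ i, 0 ≤ a i) (hb : ∀ i, 0 ≤ b i) (hab : ∀ i, b i = 0 → a i = 0)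
    (hs : ∑ i, b i ≤ ∑ i, a i) :
    ∑ i, a i * Real.logb 2 (b i) ≤ ∑ i, a i * Real.logb 2 (a i) := by
  have h1 : ∑ i, a i * Real.log (b i) ≤ ∑ i, (a i * Real.log (a i) - a i + b i) :=
    Finset.sum_le_sum fun i _ => gibbs_term (ha i) (hb i) (hab i)
  rw [Finset.sum_add_distrib, Finset.sum_sub_distrib] at h1
  simp only [Real.logb, ← mul_div_assoc, ← Finset.sum_div]
  have : 0 < Real.log 2 := Real.log_pos (by norm_num)
  refine div_le_div_of_nonneg_right ?_ this.le
  linarith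

lemma gibbs_eq (a b : ι → ℝ) (ha : ∀ i, 0 ≤ a i) (hb : ∀ i, 0 ≤ b i) (hab : ∀ i, b i = 0 → a i = 0)
    (hs : ∑ i, b i ≤ ∑ i, a i)
    (h : ∑ i, a i * Real.logb 2 (a i) ≤ ∑ i, a i * Real.logb 2 (b i)) : ∀ i, a i = b i := by
  have h0 : 0 < Real.log 2 := Real.log_pos (by norm_num)
  have h2 : ∑ i, a i * Real.log (a i) ≤ ∑ i, a i * Real.log (b i) := by
    simp only [Real.logb, ← mul_div_assoc, ← Finset.sum_div] at h
    exact (div_le_div_iff_of_pos_right h0).1 h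
  have h3 : ∑ i, ((a i * Real.log (a i) - a i + b i) - a i * Real.log (b i)) = 0 := by
    refine le_antisymm ?_ (Finset.sum_nonneg fun i _ => sub_nonneg.2 (gibbs_term (ha i) (hb i) (hab i)))
    rw [Finset.sum_sub_distrib, Finset.sum_add_distrib, Finset.sum_sub_distrib]
    linarith
  rw [Finset.sum_eq_zero_iff_of_nonneg
    (fun i _ => sub_nonneg.2 (gibbs_term (ha i) (hb i) (hab i)))] at h3
  intro i
  exact gibbs_term_eq (ha i) (hb i) (hab i) (by linarith [h3 i (Finset.mem_univ i)])

end gibbs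

section submod
variable {Ω : Type*} [Fintype Ω] {α β γ : Type*} [Fintype α] [Fintype β] [Fintype γ]

/-- marginalising a joint distribution -/
lemma sum_dist_left (w : Ω → ℝ) (X : Ω → α) (Y : Ω → β) (b : β) :
    ∑ a, IT.dist w (fun ω => (X ω, Y ω)) (a, b) = IT.dist w Y b := by
  classical
  unfold IT.dist
  rw [Finset.sum_comm]
  refine Finset.sum_congr rfl fun ω _ => ?_
  by_cases h : Y ω = b
  · simp [h]
  · simp [h]

lemma sum_dist_right (w : Ω → ℝ) (X : Ω → α) (Y : Ω → β) (a : α) :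
    ∑ b, IT.dist w (fun ω => (X ω, Y ω)) (a, b) = IT.dist w X a := by
  classical
  unfold IT.dist
  rw [Finset.sum_comm]
  refine Finset.sum_congr rfl fun ω _ => ?_
  by_cases h : X ω = a
  · simp [h]
  · simp [h]

lemma dist_mono_zero {w : Ω → ℝ} (hw : ∀ ω, 0 ≤ w ω) (X : Ω → α) (f : α → β) (a : α)
    (h : IT.dist w (fun ω => f (X ω)) (f a) = 0) : IT.dist w X a = 0 := by
  have h1 := le_dist (dist_nonneg hw X) f a
  rw [dist_comp, h] at h1
  exact le_antisymm h1 (dist_nonneg hw X a)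

variable (w : Ω → ℝ) (X : Ω → α) (Y : Ω → β) (Z : Ω → γ)

/-- the product-form comparison measure for conditional independence -/
def ciB (i : α × β × γ) : ℝ :=
  IT.dist w (fun ω => (X ω, Z ω)) (i.1, i.2.2) * IT.dist w (fun ω => (Y ω, Z ω)) (i.2.1, i.2.2)
    / IT.dist w Z i.2.2

variable {w}

lemma ciB_facts (hw : IsPMF w) :
    (∀ i, 0 ≤ ciB w X Y Z i) ∧
    (∀ i, ciB w X Y Z i = 0 → IT.dist w (fun ω => (X ω, Y ω, Z ω)) i = 0) ∧
    (∑ i, ciB w X Y Z i ≤ ∑ i, IT.dist w (fun ω => (X ω, Y ω, Z ω)) i) ∧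
    (∑ i, IT.dist w (fun ω => (X ω, Y ω, Z ω)) i *
        Real.logb 2 (IT.dist w (fun ω => (X ω, Y ω, Z ω)) i)
      = - H w (fun ω => (X ω, Y ω, Z ω))) ∧
    (∑ i, IT.dist w (fun ω => (X ω, Y ω, Z ω)) i * Real.logb 2 (ciB w X Y Z i)
      = - H w (fun ω => (X ω, Z ω)) - H w (fun ω => (Y ω, Z ω)) + H w Z) := by
  refine ⟨?_, ?_, ?_, ?_, ?_⟩
  · intro i
    unfold ciB
    exact div_nonneg (mul_nonneg (dist_nonneg hw.1 _ _) (dist_nonneg hw.1 _ _)) (dist_nonneg hw.1 _ _)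
  · rintro ⟨x, y, z⟩ h
    unfold ciB at h
    simp only [div_eq_zero_iff, mul_eq_zero] at h
    rcases h with (h | h) | h
    · exact dist_mono_zero hw.1 (fun ω => (X ω, Y ω, Z ω)) (fun i => (i.1, i.2.2)) (x, y, z) h
    · exact dist_mono_zero hw.1 (fun ω => (X ω, Y ω, Z ω)) (fun i => (i.2.1, i.2.2)) (x, y, z) h
    · exact dist_mono_zero hw.1 (fun ω => (X ω, Y ω, Z ω)) (fun i => (i.2.2)) (x, y, z) h
  · rw [sum_dist, hw.2, ← hw.2, ← sum_dist w Z]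
    have : ∑ i, ciB w X Y Z i = ∑ z, ∑ x, ∑ y, ciB w X Y Z (x, y, z) := by
      rw [Fintype.sum_prod_type]
      simp_rw [Fintype.sum_prod_type]
      rw [Finset.sum_comm' (t' := Finset.univ) (s' := fun _ => Finset.univ) (by simp)]
      simp_rw [fun y : β => Finset.sum_comm (s := (Finset.univ : Finset α)) (t := (Finset.univ : Finset γ))
        (f := fun x z => ciB w X Y Z (x, y, z))]
      rw [Finset.sum_comm]
      refine Finset.sum_congr rfl fun z _ => ?_
      rw [Finset.sum_comm]
    rw [this]
    refine Finset.sum_le_sum fun z _ => ?_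
    simp only [ciB, ← Finset.sum_div, ← Finset.mul_sum, ← Finset.sum_mul]
    rw [sum_dist_left, sum_dist_left]
    by_cases h : IT.dist w Z z = 0
    · simp [h]
    · rw [mul_div_assoc, div_self h, mul_one]
  · unfold H
    rw [neg_neg]
  · rw [sum_dist_mul, H_eq, H_eq, H_eq, neg_neg, sub_neg_eq_add, ← Finset.sum_add_distrib,
      ← sub_eq_add_neg, ← Finset.sum_sub_distrib]
    refine Finset.sum_congr rfl fun ω _ => ?_
    by_cases h0 : w ω = 0
    · simp [h0]
    have hp : 0 < w ω := lt_of_le_of_ne (hw.1 ω) (Ne.symm h0)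
    have h1 := (lt_of_lt_of_le hp (le_dist hw.1 (fun ω => (X ω, Z ω)) ω)).ne'
    have h2 := (lt_of_lt_of_le hp (le_dist hw.1 (fun ω => (Y ω, Z ω)) ω)).ne'
    have h3 := (lt_of_lt_of_le hp (le_dist hw.1 Z ω)).ne'
    unfold ciB
    rw [Real.logb_div (mul_ne_zero h1 h2) h3, Real.logb_mul h1 h2]
    ring

lemma H_submod (hw : IsPMF w) :
    H w (fun ω => (X ω, Y ω, Z ω)) + H w Z ≤ H w (fun ω => (X ω, Z ω)) + H w (fun ω => (Y ω, Z ω)) := by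
  obtain ⟨h1, h2, h3, h4, h5⟩ := ciB_facts X Y Z hw
  have := gibbs _ _ (dist_nonneg hw.1 _) h1 h2 h3
  rw [h4, h5] at this
  linarith

lemma condMutInfo_def (X : Ω → α) (Y : Ω → β) (Z : Ω → γ) : condMutInfo w X Y Z
    = H w (fun ω => (X ω, Z ω)) + H w (fun ω => (Y ω, Z ω)) - H w (fun ω => (X ω, Y ω, Z ω)) - H w Z := by
  unfold condMutInfo condH
  ring

lemma condMutInfo_nonneg (hw : IsPMF w) : 0 ≤ condMutInfo w X Y Z := by
  rw [condMutInfo_def]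
  linarith [H_submod X Y Z hw]

lemma condMutInfo_eq_zero_iff (hw : IsPMF w) : condMutInfo w X Y Z = 0 ↔
    ∀ x y z, IT.dist w (fun ω => (X ω, Y ω, Z ω)) (x, y, z) * IT.dist w Z z
      = IT.dist w (fun ω => (X ω, Z ω)) (x, z) * IT.dist w (fun ω => (Y ω, Z ω)) (y, z) := by
  obtain ⟨h1, h2, h3, h4, h5⟩ := ciB_facts X Y Z hw
  rw [condMutInfo_def]
  constructor
  · intro h x y z
    have := gibbs_eq _ _ (dist_nonneg hw.1 _) h1 h2 h3 (by rw [h4, h5]; linarith) (x, y, z)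
    by_cases h0 : IT.dist w Z z = 0
    · rw [h0, mul_zero,
        dist_mono_zero hw.1 (fun ω => (X ω, Z ω)) (fun i => i.2) (x, z) h0, zero_mul]
    · rw [this]
      unfold ciB
      field_simp
  · intro h
    have : ∀ i, ciB w X Y Z i = IT.dist w (fun ω => (X ω, Y ω, Z ω)) i := by
      rintro ⟨x, y, z⟩
      unfold ciB
      by_cases h0 : IT.dist w Z z = 0
      · simp only [h0, div_zero]
        exact (dist_mono_zero hw.1 (fun ω => (X ω, Y ω, Z ω)) (fun i => (i.2.2)) (x, y, z) h0).symm
      · simp only [← h]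
        field_simp
    simp_rw [this] at h5
    linarith

/-- subadditivity -/
lemma H_subadd (hw : IsPMF w) (X : Ω → α) (Y : Ω → β) :
    H w (fun ω => (X ω, Y ω)) ≤ H w X + H w Y := by
  have h := H_submod X Y (fun _ => ()) hw
  rw [H_const hw (fun _ => ()) (fun _ _ _ _ => rfl),
    H_congr hw.1 (fun ω => (X ω, Y ω, ())) (fun ω => (X ω, Y ω)) (by simp),
    H_congr hw.1 (fun ω => (X ω, ())) X (by simp),
    H_congr hw.1 (fun ω => (Y ω, ())) Y (by simp)] at h
  linarith

lemma H_le_card (hw : IsPMF w) [Nonempty α] (X : Ω → α) : H w X ≤ Real.logb 2 (Fintype.card α) := by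
  have hc : (0 : ℝ) < Fintype.card α := by exact_mod_cast Fintype.card_pos
  have := gibbs (IT.dist w X) (fun _ => 1 / (Fintype.card α : ℝ)) (dist_nonneg hw.1 _)
    (fun _ => by positivity) (fun i h => absurd h (by positivity))
    (by rw [sum_dist, hw.2]; simp [hc.ne'])
  rw [← Finset.sum_mul, sum_dist, hw.2, one_mul, one_div, Real.logb_inv] at this
  unfold H
  linarith

end submod
end TE

namespace TE

section iid
variable {α β : Type*} [Fintype α] [Fintype β]

lemma sum_prod_fun {n : ℕ} (g : Fin n → α → ℝ) :
    ∑ x : Fin n → α, ∏ t, g t (x t) = ∏ t, ∑ a, g t a := by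
  classical
  rw [Finset.prod_univ_sum, Fintype.piFinset_univ]

lemma isPMF_iidW {p : α → ℝ} (hp : IsPMF p) (n : ℕ) : IsPMF (iidW p n) := by
  refine ⟨fun x => Finset.prod_nonneg fun t _ => hp.1 _, ?_⟩
  unfold iidW
  rw [sum_prod_fun (fun _ => p)]
  simp [hp.2]

lemma iid_marg1 {p : α → ℝ} (hp : IsPMF p) {n : ℕ} (s : Fin n) (f : α → ℝ) :
    ∑ x, iidW p n x * f (x s) = ∑ a, p a * f a := by
  have h : ∀ x : Fin n → α, iidW p n x * f (x s) = ∏ t, (p (x t) * if t = s then f (x t) else 1) := by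
    intro x
    rw [Finset.prod_mul_distrib, Finset.prod_ite_eq' Finset.univ s (fun t => f (x t))]
    simp [iidW]
  simp_rw [h]
  rw [sum_prod_fun (fun t a => p a * if t = s then f a else 1), Finset.prod_eq_single s]
  · simp
  · intro b _ hb
    simp [hb, hp.2]
  · simp

lemma iid_marg2 {p : α → ℝ} (hp : IsPMF p) {n : ℕ} (s r : Fin n) (hsr : s ≠ r) (f g : α → ℝ) :
    ∑ x, iidW p n x * (f (x s) * g (x r)) = (∑ a, p a * f a) * ∑ a, p a * g a := by
  have h : ∀ x : Fin n → α, iidW p n x * (f (x s) * g (x r)) =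
      ∏ t, (p (x t) * ((if t = s then f (x t) else 1) * (if t = r then g (x t) else 1))) := by
    intro x
    rw [Finset.prod_mul_distrib, Finset.prod_mul_distrib,
      Finset.prod_ite_eq' Finset.univ s (fun t => f (x t)),
      Finset.prod_ite_eq' Finset.univ r (fun t => g (x t))]
    simp [iidW]
  simp_rw [h]
  rw [sum_prod_fun (fun t a => p a * ((if t = s then f a else 1) * (if t = r then g a else 1))),
    ← Finset.mul_prod_erase Finset.univ _ (Finset.mem_univ s),
    ← Finset.mul_prod_erase (Finset.univ.erase s) _ (Finset.mem_erase.2 ⟨hsr.symm, Finset.mem_univ r⟩),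
    Finset.prod_eq_one]
  · simp [hsr, hsr.symm]
  · intro b hb
    simp only [Finset.mem_erase, Finset.mem_univ, and_true] at hb
    simp [hb.1, hb.2, hp.2]

lemma dist_iid (p : α → ℝ) (n : ℕ) (f : α → β) (b : Fin n → β) :
    IT.dist (iidW p n) (fun ω t => f (ω t)) b = iidW (IT.dist p f) n b := by
  classical
  unfold IT.dist iidW
  rw [← sum_prod_fun (fun t a => if f a = b t then p a else 0)]
  refine Finset.sum_congr rfl fun x _ => ?_
  by_cases h : (fun t => f (x t)) = b
  · rw [if_pos h]
    refine Finset.prod_congr rfl fun t _ => ?_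
    rw [if_pos (congrFun h t)]
  · rw [if_neg h]
    obtain ⟨t, ht⟩ := Function.ne_iff.1 h
    rw [Finset.prod_eq_zero (Finset.mem_univ t)]
    rw [if_neg ht]

lemma logb_iid (p : α → ℝ) {n : ℕ} (x : Fin n → α) :
    iidW p n x * Real.logb 2 (iidW p n x) = ∑ t, iidW p n x * Real.logb 2 (p (x t)) := by
  by_cases h : iidW p n x = 0
  · simp [h]
  · rw [← Finset.mul_sum]
    congr 1
    unfold iidW at *
    rw [Real.logb_prod]
    intro t _ h0
    exact h (Finset.prod_eq_zero (Finset.mem_univ t) h0)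

lemma H_iid {p : α → ℝ} (hp : IsPMF p) (n : ℕ) (f : α → β) :
    H (iidW p n) (fun ω t => f (ω t)) = n * H p f := by
  unfold H
  simp_rw [dist_iid, logb_iid]
  rw [Finset.sum_comm]
  simp_rw [iid_marg1 (isPMF_dist hp f) _ (fun a => Real.logb 2 (IT.dist p f a))]
  simp

/-- one-sided Chebyshev bound for i.i.d. sums -/
lemma wlln_bound {p : α → ℝ} (hp : IsPMF p) (f : α → ℝ) {δ : ℝ} (hδ : 0 < δ) {n : ℕ} (hn : 0 < n) :
    IT.pr (iidW p n) (fun x => n * ((∑ a, p a * f a) + δ) < ∑ t, f (x t))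
      ≤ (∑ a, p a * (f a - ∑ a, p a * f a) ^ 2) / (n * δ ^ 2) := by
  set m := ∑ a, p a * f a with hm
  have hn' : (0 : ℝ) < n := by exact_mod_cast hn
  have h0 : ∑ a, p a * (f a - m) = 0 := by
    simp_rw [mul_sub]
    rw [Finset.sum_sub_distrib, ← Finset.sum_mul, hp.2, ← hm]
    ring
  have hv : ∑ x, iidW p n x * (∑ t, (f (x t) - m)) ^ 2 = n * ∑ a, p a * (f a - m) ^ 2 := by
    simp_rw [sq (∑ t, _), Finset.sum_mul_sum, Finset.mul_sum]
    rw [Finset.sum_comm]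
    have : ∀ s : Fin n, ∑ x, ∑ r : Fin n, iidW p n x * ((f (x s) - m) * (f (x r) - m))
        = ∑ a, p a * (f a - m) ^ 2 := by
      intro s
      rw [Finset.sum_comm, Finset.sum_eq_single s]
      · rw [← iid_marg1 hp s (fun a => (f a - m) ^ 2)]
        simp_rw [sq]
      · intro r _ hr
        rw [iid_marg2 hp s r hr.symm (fun a => f a - m) (fun a => f a - m), h0, zero_mul]
      · simp
    simp_rw [this]
    simp [Finset.mul_sum]
  have hle : IT.pr (iidW p n) (fun x => n * (m + δ) < ∑ t, f (x t))
      ≤ ∑ x, (iidW p n x * (∑ t, (f (x t) - m)) ^ 2) / (n * δ) ^ 2 := by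
    unfold IT.pr
    refine Finset.sum_le_sum fun x _ => ?_
    have hx := (isPMF_iidW hp n).1 x
    split_ifs with h
    · rw [le_div_iff₀ (by positivity)]
      refine mul_le_mul_of_nonneg_left ?_ hx
      refine pow_le_pow_left₀ (by positivity) ?_ 2
      rw [Finset.sum_sub_distrib]
      simp only [Finset.sum_const, Finset.card_univ, Fintype.card_fin, nsmul_eq_mul]
      linarith
    · positivity
  rw [← Finset.sum_div, hv] at hle
  refine hle.trans (le_of_eq ?_)
  field_simp

lemma pr_union {Ω ι : Type*} [Fintype Ω] [Fintype ι] {w : Ω → ℝ} (hw : ∀ ω, 0 ≤ w ω)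
    (E : Ω → Prop) (F : ι → Ω → Prop) (h : ∀ ω, w ω ≠ 0 → E ω → ∃ i, F i ω) :
    IT.pr w E ≤ ∑ i, IT.pr w (F i) := by
  classical
  unfold IT.pr
  rw [Finset.sum_comm]
  refine Finset.sum_le_sum fun ω _ => ?_
  have hn : ∀ i, 0 ≤ (if F i ω then w ω else 0) := fun i => by
    split_ifs
    · exact hw ω
    · exact le_rfl
  by_cases h0 : w ω = 0
  · simp [h0]
  by_cases hE : E ω
  · obtain ⟨i, hi⟩ := h ω h0 hE
    have := Finset.single_le_sum (f := fun i => if F i ω then w ω else 0) (s := Finset.univ)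
      (fun i _ => hn i) (Finset.mem_univ i)
    simp only [if_pos hi] at this
    rw [if_pos hE]
    convert this using 1
  · rw [if_neg hE]
    refine Finset.sum_nonneg fun i _ => ?_
    convert hn i using 1

lemma wlln {ι : Type*} [Fintype ι] {p : α → ℝ} (hp : IsPMF p) (f : ι → α → ℝ) {δ η : ℝ} (hδ : 0 < δ)
    (hη : 0 < η) : ∃ N : ℕ, ∀ n ≥ N, 0 < n → 
    IT.pr (iidW p n) (fun x => ¬ ((∀ t, 0 < p (x t)) ∧
      ∀ i, ∑ t, f i (x t) ≤ n * ((∑ a, p a * f i a) + δ))) ≤ η := by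
  set V := ∑ i, ∑ a, p a * (f i a - ∑ a, p a * f i a) ^ 2 with hV
  have hV0 : 0 ≤ V := Finset.sum_nonneg fun i _ => Finset.sum_nonneg fun a _ =>
    mul_nonneg (hp.1 a) (sq_nonneg _)
  obtain ⟨N, hN⟩ := exists_nat_gt (V / (η * δ ^ 2))
  refine ⟨N, fun n hn hn0 => ?_⟩
  have hn' : (0 : ℝ) < n := by exact_mod_cast hn0
  refine (pr_union (isPMF_iidW hp n).1 _
    (fun i x => n * ((∑ a, p a * f i a) + δ) < ∑ t, f i (x t)) ?_).trans ?_
  · intro x hx h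
    by_contra hcon
    push Not at hcon
    refine h ⟨fun t => lt_of_le_of_ne (hp.1 _) fun h0 => hx ?_, hcon⟩
    exact Finset.prod_eq_zero (Finset.mem_univ t) h0.symm
  · refine (Finset.sum_le_sum fun i _ => wlln_bound hp (f i) hδ hn0).trans ?_
    rw [← Finset.sum_div, ← hV, div_le_iff₀ (by positivity)]
    rw [div_lt_iff₀ (by positivity)] at hN
    have : (N : ℝ) ≤ n := by exact_mod_cast hn
    have h2 : (N : ℝ) * (η * δ ^ 2) ≤ n * (η * δ ^ 2) := by gcongr
    nlinarith
end iid
end TE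

namespace TE

section ind
open Classical in
/-- real-valued indicator -/
def ind (P : Prop) : ℝ := if P then 1 else 0

lemma ind_true {P : Prop} (h : P) : ind P = 1 := by simp [ind, h]
lemma ind_false {P : Prop} (h : ¬ P) : ind P = 0 := by simp [ind, h]
lemma ind_nonneg (P : Prop) : 0 ≤ ind P := by unfold ind; split_ifs <;> norm_num
lemma ind_le_one (P : Prop) : ind P ≤ 1 := by unfold ind; split_ifs <;> norm_num
lemma ind_mono {P Q : Prop} (h : P → Q) : ind P ≤ ind Q := by
  by_cases hP : P
  · rw [ind_true hP, ind_true (h hP)]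
  · rw [ind_false hP]; exact ind_nonneg Q
lemma ind_and (P Q : Prop) : ind (P ∧ Q) = ind P * ind Q := by
  by_cases hP : P <;> by_cases hQ : Q <;> simp [ind, hP, hQ]
lemma ind_or_le (P Q : Prop) : ind (P ∨ Q) ≤ ind P + ind Q := by
  by_cases hP : P <;> by_cases hQ : Q <;> simp [ind, hP, hQ]
lemma ind_exists_le {ι : Type*} [Fintype ι] (P : ι → Prop) : ind (∃ i, P i) ≤ ∑ i, ind (P i) := by
  by_cases h : ∃ i, P i
  · obtain ⟨i, hi⟩ := h
    have := Finset.single_le_sum (f := fun i => ind (P i)) (s := Finset.univ)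
      (fun i _ => ind_nonneg _) (Finset.mem_univ i)
    exact (ind_le_one _).trans ((ind_true hi).symm.le.trans this)
  · rw [ind_false h]
    exact Finset.sum_nonneg fun i _ => ind_nonneg _
lemma pr_eq_ind {Ω : Type*} [Fintype Ω] (w : Ω → ℝ) (E : Ω → Prop) :
    IT.pr w E = ∑ ω, w ω * ind (E ω) := by
  unfold IT.pr ind
  simp
end ind

section avg

/-- uniform average over a finite type -/
def avg {T : Type*} [Fintype T] (f : T → ℝ) : ℝ := (∑ t, f t) / Fintype.card T

variable {T T' S : Type*} [Fintype T] [Fintype T'] [Fintype S]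

lemma avg_mono {f g : T → ℝ} (h : ∀ t, f t ≤ g t) : avg f ≤ avg g := by
  unfold avg
  exact div_le_div_of_nonneg_right (Finset.sum_le_sum fun t _ => h t) (Nat.cast_nonneg _)

lemma avg_add (f g : T → ℝ) : avg (fun t => f t + g t) = avg f + avg g := by
  unfold avg
  rw [Finset.sum_add_distrib, add_div]

lemma avg_mul_left (c : ℝ) (f : T → ℝ) : avg (fun t => c * f t) = c * avg f := by
  unfold avg
  rw [← Finset.mul_sum, mul_div_assoc]

lemma avg_sum (f : S → T → ℝ) : avg (fun t => ∑ s, f s t) = ∑ s, avg (f s) := by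
  unfold avg
  rw [Finset.sum_comm, Finset.sum_div]

lemma avg_const [Nonempty T] (c : ℝ) : avg (fun _ : T => c) = c := by
  unfold avg
  have : (Fintype.card T : ℝ) ≠ 0 := by exact_mod_cast Fintype.card_ne_zero
  simp [this]

lemma avg_prod (f : T → ℝ) (g : T' → ℝ) : avg (fun t : T × T' => f t.1 * g t.2) = avg f * avg g := by
  unfold avg
  rw [Fintype.sum_prod_type, Fintype.card_prod, div_mul_div_comm, Finset.sum_mul_sum]
  push_cast
  rfl

lemma exists_le_avg [Nonempty T] (f : T → ℝ) : ∃ t, f t ≤ avg f := by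
  by_contra h
  push Not at h
  have hc : (0 : ℝ) < Fintype.card T := by exact_mod_cast Fintype.card_pos
  have : ∑ t : T, avg f < ∑ t, f t := Finset.sum_lt_sum_of_nonempty Finset.univ_nonempty fun t _ => h t
  rw [Finset.sum_const, Finset.card_univ, nsmul_eq_mul] at this
  unfold avg at this
  rw [mul_div_cancel₀ _ hc.ne'] at this
  exact lt_irrefl _ this

variable {A C : Type*} [Fintype A] [Fintype C] [DecidableEq A]

lemma avg_fun_prod [Nonempty C] (g : A → C → ℝ) :
    avg (fun Φ : A → C => ∏ a, g a (Φ a)) = ∏ a, avg (g a) := by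
  classical
  unfold avg
  rw [Finset.prod_div_distrib, Finset.prod_univ_sum, Fintype.piFinset_univ]
  simp

lemma avg_fun1 [Nonempty C] (a : A) (f : C → ℝ) : avg (fun Φ : A → C => f (Φ a)) = avg f := by
  have h : ∀ Φ : A → C, f (Φ a) = ∏ b, if b = a then f (Φ b) else 1 := by
    intro Φ
    rw [Finset.prod_ite_eq' Finset.univ a (fun t => f (Φ t))]
    simp
  simp_rw [h]
  rw [avg_fun_prod (fun b c => if b = a then f c else 1), Finset.prod_eq_single a]
  · simp
  · intro b _ hb
    simp [hb, avg_const]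
  · simp

lemma avg_fun2 [Nonempty C] (a a' : A) (ha : a ≠ a') (f g : C → ℝ) :
    avg (fun Φ : A → C => f (Φ a) * g (Φ a')) = avg f * avg g := by
  have h : ∀ Φ : A → C, f (Φ a) * g (Φ a') =
      ∏ b, ((if b = a then f (Φ b) else 1) * (if b = a' then g (Φ b) else 1)) := by
    intro Φ
    rw [Finset.prod_mul_distrib, Finset.prod_ite_eq' Finset.univ a (fun t => f (Φ t)),
      Finset.prod_ite_eq' Finset.univ a' (fun t => g (Φ t))]
    simp
  simp_rw [h]
  rw [avg_fun_prod (fun b c => (if b = a then f c else 1) * (if b = a' then g c else 1)),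
    ← Finset.mul_prod_erase Finset.univ _ (Finset.mem_univ a),
    ← Finset.mul_prod_erase (Finset.univ.erase a) _ (Finset.mem_erase.2 ⟨ha.symm, Finset.mem_univ a'⟩),
    Finset.prod_eq_one]
  · simp [ha, ha.symm]
  · intro b hb
    simp only [Finset.mem_erase, Finset.mem_univ, and_true] at hb
    simp [hb.1, hb.2, avg_const]

lemma avg_ind_eq (m : ℕ) (c : Fin (m + 1)) : avg (fun x : Fin (m + 1) => ind (x = c)) = 1 / (m + 1) := by
  unfold avg
  rw [Finset.sum_eq_single c]
  · simp [ind_true]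
  · intro b _ hb
    exact ind_false hb
  · simp

/-- collision probability of a random hash -/
lemma avg_coll (m : ℕ) (a a' : A) (ha : a ≠ a') :
    avg (fun h : A → Fin (m + 1) => ind (h a' = h a)) = 1 / (m + 1) := by
  have : ∀ h : A → Fin (m + 1), ind (h a' = h a) = ∑ c, ind (h a' = c) * ind (h a = c) := by
    intro h
    rw [Finset.sum_eq_single (h a)]
    · simp [ind_true]
    · intro b _ hb
      rw [ind_false hb.symm, mul_zero]
    · simp
  simp_rw [this]
  rw [avg_sum]
  simp_rw [fun c => avg_fun2 a' a ha.symm (fun x : Fin (m + 1) => ind (x = c)) (fun x => ind (x = c)), avg_ind_eq]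
  have : (m : ℝ) + 1 ≠ 0 := by positivity
  simp only [Finset.sum_const, Finset.card_univ, Fintype.card_fin, nsmul_eq_mul, Nat.cast_add, Nat.cast_one]
  field_simp

lemma avg_zero_mem (l m : ℕ) : avg (fun x : Fin (l + 1) × Fin (m + 1) => ind (x.1 = 0)) = 1 / (l + 1) := by
  have := avg_prod (fun x : Fin (l + 1) => ind (x = 0)) (fun _ : Fin (m + 1) => 1)
  simp only [mul_one, avg_ind_eq, avg_const] at this
  exact this

lemma avg_inc (l m : ℕ) (a : A) :
    avg (fun Φ : A → Fin (l + 1) × Fin (m + 1) => ind ((Φ a).1 = 0)) = 1 / (l + 1) := by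
  rw [avg_fun1 a (fun x : Fin (l + 1) × Fin (m + 1) => ind (x.1 = 0)), avg_zero_mem]

lemma avg_inc2 (l m : ℕ) (a a' : A) (ha : a ≠ a') :
    avg (fun Φ : A → Fin (l + 1) × Fin (m + 1) => ind ((Φ a).1 = 0) * ind ((Φ a').1 = 0))
      = 1 / (l + 1) * (1 / (l + 1)) := by
  rw [avg_fun2 a a' ha (fun x : Fin (l + 1) × Fin (m + 1) => ind (x.1 = 0))
    (fun x : Fin (l + 1) × Fin (m + 1) => ind (x.1 = 0)), avg_zero_mem]

/-- both keys included, and the messages match -/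
def mtch {l m : ℕ} (Φ : A → Fin (l + 1) × Fin (m + 1)) (a a' : A) : Prop :=
  (Φ a).1 = 0 ∧ (Φ a').1 = 0 ∧ (Φ a').2 = (Φ a).2

lemma avg_mtch (l m : ℕ) (a a' : A) (ha : a ≠ a') :
    avg (fun Φ : A → Fin (l + 1) × Fin (m + 1) => ind (mtch Φ a a'))
      = 1 / (l + 1) * (1 / (l + 1)) * (1 / (m + 1)) := by
  have : ∀ Φ : A → Fin (l + 1) × Fin (m + 1), ind (mtch Φ a a') =
      ∑ c, (ind ((Φ a).1 = 0) * ind ((Φ a).2 = c)) * (ind ((Φ a').1 = 0) * ind ((Φ a').2 = c)) := by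
    intro Φ
    unfold mtch
    rw [ind_and, ind_and, Finset.sum_eq_single (Φ a).2]
    · rw [ind_true (rfl : (Φ a).2 = (Φ a).2)]; ring
    · intro b _ hb
      rw [ind_false hb.symm]; ring
    · simp
  simp_rw [this]
  rw [avg_sum]
  have h1 : ∀ c, avg (fun x : Fin (l + 1) × Fin (m + 1) => ind (x.1 = 0) * ind (x.2 = c))
      = 1 / (l + 1) * (1 / (m + 1)) := by
    intro c
    rw [avg_prod (fun x : Fin (l + 1) => ind (x = 0)) (fun x : Fin (m + 1) => ind (x = c)), avg_ind_eq,
      avg_ind_eq]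
  simp_rw [fun c => avg_fun2 a a' ha
    (fun x : Fin (l + 1) × Fin (m + 1) => ind (x.1 = 0) * ind (x.2 = c))
    (fun x : Fin (l + 1) × Fin (m + 1) => ind (x.1 = 0) * ind (x.2 = c)), h1]
  have : (m : ℝ) + 1 ≠ 0 := by positivity
  simp only [Finset.sum_const, Finset.card_univ, Fintype.card_fin, nsmul_eq_mul, Nat.cast_add, Nat.cast_one]
  field_simp

end avg
end TE

namespace TE

lemma avg_snd {T T' : Type*} [Fintype T] [Fintype T'] [Nonempty T] (g : T' → ℝ) :
    avg (fun t : T × T' => g t.2) = avg g := by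
  have := avg_prod (fun _ : T => 1) g
  simpa [avg_const] using this

section cover
variable {A1 V1 V2 : Type*} [Fintype A1] [Fintype V1] [Fintype V2]
  [DecidableEq A1] [DecidableEq V1] [DecidableEq V2]

/-- the key hash functions -/
abbrev Ph1 (A1 V1 : Type*) (l1 m21 : ℕ) := A1 × V1 → Fin (l1 + 1) × Fin (m21 + 1)
abbrev Ph2 (A1 V1 V2 : Type*) (l2 m22 : ℕ) := A1 × V1 × V2 → Fin (l2 + 1) × Fin (m22 + 1)

/-- codebook membership -/
def inC {l1 m21 l2 m22 : ℕ} (Φ : Ph1 A1 V1 l1 m21 × Ph2 A1 V1 V2 l2 m22) (a : A1) (v : V1 × V2) : Prop :=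
  (Φ.1 (a, v.1)).1 = 0 ∧ (Φ.2 (a, v.1, v.2)).1 = 0

variable (l1 m21 l2 m22 : ℕ)

lemma avg_inC (a : A1) (v : V1 × V2) :
    avg (fun Φ : Ph1 A1 V1 l1 m21 × Ph2 A1 V1 V2 l2 m22 => ind (inC Φ a v))
      = 1 / (l1 + 1) * (1 / (l2 + 1)) := by
  unfold inC
  simp_rw [ind_and]
  rw [avg_prod (fun Φ : Ph1 A1 V1 l1 m21 => ind ((Φ (a, v.1)).1 = 0))
    (fun Φ : Ph2 A1 V1 V2 l2 m22 => ind ((Φ (a, v.1, v.2)).1 = 0)), avg_inc, avg_inc]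

lemma avg_inC2 (a : A1) (v v' : V1 × V2) :
    (((l1 + 1 : ℝ) * (l2 + 1)) ^ 2) *
    avg (fun Φ : Ph1 A1 V1 l1 m21 × Ph2 A1 V1 V2 l2 m22 => ind (inC Φ a v) * ind (inC Φ a v'))
      = 1 + l1 * ind (v.1 = v'.1) + (l1 + 1) * l2 * ind (v = v') := by
  have hl1 : (l1 : ℝ) + 1 ≠ 0 := by positivity
  have hl2 : (l2 : ℝ) + 1 ≠ 0 := by positivity
  unfold inC
  simp_rw [ind_and]
  have : ∀ Φ : Ph1 A1 V1 l1 m21 × Ph2 A1 V1 V2 l2 m22,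
      ind ((Φ.1 (a, v.1)).1 = 0) * ind ((Φ.2 (a, v.1, v.2)).1 = 0) *
        (ind ((Φ.1 (a, v'.1)).1 = 0) * ind ((Φ.2 (a, v'.1, v'.2)).1 = 0)) =
      (ind ((Φ.1 (a, v.1)).1 = 0) * ind ((Φ.1 (a, v'.1)).1 = 0)) *
        (ind ((Φ.2 (a, v.1, v.2)).1 = 0) * ind ((Φ.2 (a, v'.1, v'.2)).1 = 0)) := fun Φ => by ring
  simp_rw [this]
  rw [avg_prod (fun Φ : Ph1 A1 V1 l1 m21 => ind ((Φ (a, v.1)).1 = 0) * ind ((Φ (a, v'.1)).1 = 0))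
    (fun Φ : Ph2 A1 V1 V2 l2 m22 => ind ((Φ (a, v.1, v.2)).1 = 0) * ind ((Φ (a, v'.1, v'.2)).1 = 0))]
  have idem : ∀ P : Prop, ind P * ind P = ind P := fun P => by
    rw [← ind_and, and_self]
  by_cases h1 : v.1 = v'.1
  · by_cases h2 : v = v'
    · subst h2
      simp_rw [idem]
      rw [avg_inc, avg_inc, ind_true trivial]
      field_simp
      ring
    · have hne : (a, v.1, v.2) ≠ (a, v'.1, v'.2) := by
        intro h
        simp only [Prod.mk.injEq, true_and] at h
        exact h2 (Prod.ext h.1 h.2)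
      rw [ind_true h1, ind_false h2, avg_inc2 _ _ _ _ hne, ← h1]
      simp_rw [idem]
      rw [avg_inc]
      field_simp
      ring
  · have h2 : v ≠ v' := fun h => h1 (by rw [h])
    have hne : (a, v.1, v.2) ≠ (a, v'.1, v'.2) := by
      intro h
      simp only [Prod.mk.injEq, true_and] at h
      exact h1 h.1
    have hne1 : (a, v.1) ≠ (a, v'.1) := by
      intro h
      simp only [Prod.mk.injEq, true_and] at h
      exact h1 h
    rw [ind_false h1, ind_false h2, avg_inc2 _ _ _ _ hne, avg_inc2 _ _ _ _ hne1]
    field_simp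
    ring

lemma cover_bound (a : A1) (kt : V1 × V2 → ℝ) (h0 : ∀ v, 0 ≤ kt v) (h1 : ∑ v, kt v ≤ 1)
    {κ1 κ2 : ℝ} (hκ1 : ∀ v1, ∑ v2, kt (v1, v2) ≤ κ1) (hκ2 : ∀ v, kt v ≤ κ2) 
    (hκ1' : 0 ≤ κ1) (hκ2' : 0 ≤ κ2) :
    avg (fun Φ : Ph1 A1 V1 l1 m21 × Ph2 A1 V1 V2 l2 m22 =>
      ind (((l1 + 1 : ℝ) * (l2 + 1)) * ∑ v, kt v * ind (inC Φ a v) < 1 / 2))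
    ≤ 4 * ((1 - ∑ v, kt v) + l1 * κ1 + (l1 + 1) * l2 * κ2) := by
  set L : ℝ := (l1 + 1 : ℝ) * (l2 + 1) with hL
  set μ := ∑ v, kt v with hμ
  have hl1 : (l1 : ℝ) + 1 ≠ 0 := by positivity
  have hl2 : (l2 : ℝ) + 1 ≠ 0 := by positivity
  have hμ0 : 0 ≤ μ := Finset.sum_nonneg fun v _ => h0 v
  set Z := fun Φ : Ph1 A1 V1 l1 m21 × Ph2 A1 V1 V2 l2 m22 => L * ∑ v, kt v * ind (inC Φ a v) with hZ
  have hE1 : avg Z = μ := by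
    rw [hZ, avg_mul_left, avg_sum]
    simp_rw [avg_mul_left, avg_inC]
    rw [← Finset.sum_mul, ← hμ, hL]
    field_simp
  have hE2 : avg (fun Φ => Z Φ ^ 2) = 
      ∑ v, kt v * ∑ v', kt v' * (1 + l1 * ind (v.1 = v'.1) + (l1 + 1) * l2 * ind (v = v')) := by
    have : ∀ Φ, Z Φ ^ 2 = ∑ v, kt v * ∑ v', kt v' * (L ^ 2 * (ind (inC Φ a v) * ind (inC Φ a v'))) := by
      intro Φ
      simp only [hZ]
      rw [mul_pow, sq (∑ v, _), Finset.sum_mul_sum, Finset.mul_sum]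
      refine Finset.sum_congr rfl fun v _ => ?_
      rw [Finset.mul_sum, Finset.mul_sum]
      refine Finset.sum_congr rfl fun v' _ => ?_
      ring
    simp_rw [this]
    rw [avg_sum]
    refine Finset.sum_congr rfl fun v _ => ?_
    rw [avg_mul_left, avg_sum]
    congr 1
    refine Finset.sum_congr rfl fun v' _ => ?_
    rw [avg_mul_left, avg_mul_left, ← avg_inC2 l1 m21 l2 m22 a v v']
  have hE2' : avg (fun Φ => Z Φ ^ 2) ≤ μ ^ 2 + l1 * κ1 + (l1 + 1) * l2 * κ2 := by
    rw [hE2]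
    have hin : ∀ v, ∑ v', kt v' * (1 + l1 * ind (v.1 = v'.1) + (l1 + 1) * l2 * ind (v = v'))
        ≤ μ + l1 * κ1 + (l1 + 1) * l2 * κ2 := by
      intro v
      have e1 : ∑ v', kt v' * ind (v.1 = v'.1) ≤ κ1 := by
        refine le_trans (le_of_eq ?_) (hκ1 v.1)
        rw [Fintype.sum_prod_type, Finset.sum_eq_single v.1]
        · simp [ind_true]
        · intro b _ hb
          simp [ind_false hb.symm]
        · simp
      have e2 : ∑ v', kt v' * ind (v = v') ≤ κ2 := by
        refine le_trans (le_of_eq ?_) (hκ2 v)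
        rw [Finset.sum_eq_single v]
        · simp [ind_true]
        · intro b _ hb
          simp [ind_false hb.symm]
        · simp
      have : ∑ v', kt v' * (1 + l1 * ind (v.1 = v'.1) + (l1 + 1) * l2 * ind (v = v'))
          = μ + l1 * (∑ v', kt v' * ind (v.1 = v'.1)) + (l1 + 1) * l2 * ∑ v', kt v' * ind (v = v') := by
        rw [hμ, Finset.mul_sum, Finset.mul_sum, ← Finset.sum_add_distrib, ← Finset.sum_add_distrib]
        refine Finset.sum_congr rfl fun v' _ => ?_
        ring
      rw [this]
      gcongr
    calc _ ≤ ∑ v, kt v * (μ + l1 * κ1 + (l1 + 1) * l2 * κ2) :=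
          Finset.sum_le_sum fun v _ => mul_le_mul_of_nonneg_left (hin v) (h0 v)
      _ = μ * (μ + l1 * κ1 + (l1 + 1) * l2 * κ2) := by rw [← Finset.sum_mul]
      _ ≤ _ := by
        have : 0 ≤ l1 * κ1 + (l1 + 1) * l2 * κ2 := by positivity
        nlinarith
  have hle : avg (fun Φ => ind (Z Φ < 1 / 2)) ≤ avg (fun Φ => 4 * (Z Φ ^ 2 + ((-2) * Z Φ + 1))) := by
    refine avg_mono fun Φ => ?_
    by_cases h : Z Φ < 1 / 2
    · rw [ind_true h]
      nlinarith
    · rw [ind_false h]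
      nlinarith [sq_nonneg (Z Φ - 1)]
  rw [avg_mul_left, avg_add, avg_add, avg_mul_left, avg_const, hE1] at hle
  refine hle.trans ?_
  nlinarith

end cover

section oneshot
variable {A1 A2 A3 V1 V2 : Type*} [Fintype A1] [Fintype A2] [Fintype A3] [Fintype V1] [Fintype V2]
  [DecidableEq A1] [DecidableEq V1] [DecidableEq V2]
  (S2 : A1 → A2 → Prop) (S1 : A1 → V1 → Prop) (S3 : A3 → A1 → V1 → V2 → Prop)
  {m1 l1 m21 l2 m22 : ℕ}

abbrev Th (A1 V1 V2 : Type*) (m1 l1 m21 l2 m22 : ℕ) :=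
  (A1 → Fin (m1 + 1)) × Ph1 A1 V1 l1 m21 × Ph2 A1 V1 V2 l2 m22

def conf2 (θ : Th A1 V1 V2 m1 l1 m21 l2 m22) (a1 : A1) (a2 : A2) : Prop :=
  ∃ a', a' ≠ a1 ∧ S2 a' a2 ∧ θ.1 a' = θ.1 a1

def conf1 (θ : Th A1 V1 V2 m1 l1 m21 l2 m22) (a1 : A1) (v1 : V1) : Prop :=
  ∃ v', v' ≠ v1 ∧ S1 a1 v' ∧ (θ.2.1 (a1, v')).1 = 0 ∧ (θ.2.1 (a1, v')).2 = (θ.2.1 (a1, v1)).2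

def conf3 (θ : Th A1 V1 V2 m1 l1 m21 l2 m22) (a3 : A3) (a1 : A1) (v : V1 × V2) : Prop :=
  ∃ i : A1 × V1 × V2, i ≠ (a1, v.1, v.2) ∧ S3 a3 i.1 i.2.1 i.2.2 ∧ θ.1 i.1 = θ.1 a1 ∧
    (θ.2.1 (i.1, i.2.1)).1 = 0 ∧ (θ.2.2 i).1 = 0 ∧
    (θ.2.1 (i.1, i.2.1)).2 = (θ.2.1 (a1, v.1)).2 ∧ (θ.2.2 i).2 = (θ.2.2 (a1, v.1, v.2)).2

lemma avg_prod3 {T T' T'' : Type*} [Fintype T] [Fintype T'] [Fintype T''] (f : T → ℝ) (g : T' → ℝ)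
    (k : T'' → ℝ) : avg (fun t : T × T' × T'' => f t.1 * (g t.2.1 * k t.2.2)) = avg f * (avg g * avg k) := by
  rw [avg_prod f (fun t : T' × T'' => g t.1 * k t.2), avg_prod]

lemma avg_conf2 (a1 : A1) (a2 : A2) {N2 : ℝ} (hN : ∑ a, ind (S2 a a2) ≤ N2) :
    avg (fun θ : Th A1 V1 V2 m1 l1 m21 l2 m22 => ind (conf2 S2 θ a1 a2)) ≤ N2 / (m1 + 1) := by
  calc _ ≤ avg (fun θ : Th A1 V1 V2 m1 l1 m21 l2 m22 =>
        ∑ a', (ind (S2 a' a2) * ind (a' ≠ a1 ∧ θ.1 a' = θ.1 a1))) := by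
        refine avg_mono fun θ => (ind_exists_le _).trans (Finset.sum_le_sum fun a' _ => ?_)
        rw [← ind_and]
        exact ind_mono (by tauto)
    _ = ∑ a', ind (S2 a' a2) * avg (fun θ : Th A1 V1 V2 m1 l1 m21 l2 m22 =>
        ind (a' ≠ a1 ∧ θ.1 a' = θ.1 a1)) := by
        rw [avg_sum]; simp_rw [avg_mul_left]
    _ ≤ ∑ a', ind (S2 a' a2) * (1 / (m1 + 1)) := by
        refine Finset.sum_le_sum fun a' _ => mul_le_mul_of_nonneg_left ?_ (ind_nonneg _)
        by_cases h : a' = a1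
        · simp only [h, ne_eq, not_true_eq_false, false_and, ind_false not_false]
          rw [avg_const]
          positivity
        · simp only [ne_eq, h, not_false_eq_true, true_and]
          have := avg_prod3 (fun h : A1 → Fin (m1 + 1) => ind (h a' = h a1))
            (fun _ : Ph1 A1 V1 l1 m21 => 1) (fun _ : Ph2 A1 V1 V2 l2 m22 => 1)
          simp only [avg_const, mul_one] at this
          rw [this, avg_coll _ _ _ (Ne.symm h)]
    _ ≤ _ := by
        rw [← Finset.sum_mul, mul_one_div]
        gcongr

lemma avg_conf1 (a1 : A1) (v : V1 × V2) {N1 : ℝ} (hN : ∑ v', ind (S1 a1 v') ≤ N1) :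
    ((l1 + 1 : ℝ) * (l2 + 1)) * avg (fun θ : Th A1 V1 V2 m1 l1 m21 l2 m22 =>
      ind (inC θ.2 a1 v ∧ conf1 S1 θ a1 v.1)) ≤ N1 / ((l1 + 1) * (m21 + 1)) := by
  have hl1 : (l1 : ℝ) + 1 ≠ 0 := by positivity
  have hl2 : (l2 : ℝ) + 1 ≠ 0 := by positivity
  have key : avg (fun θ : Th A1 V1 V2 m1 l1 m21 l2 m22 =>
      ind (inC θ.2 a1 v ∧ conf1 S1 θ a1 v.1)) ≤
      N1 * (1 * ((1 / (l1 + 1) * (1 / (l1 + 1)) * (1 / (m21 + 1))) * (1 / (l2 + 1)))) := by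
    calc _ ≤ avg (fun θ : Th A1 V1 V2 m1 l1 m21 l2 m22 =>
        ∑ v', (ind (S1 a1 v') * (ind (v' ≠ v.1) * (1 * (ind (mtch θ.2.1 (a1, v.1) (a1, v')) *
          ind ((θ.2.2 (a1, v.1, v.2)).1 = 0)))))) := by
          refine avg_mono fun θ => ?_
          refine (ind_mono (Q := ∃ v', S1 a1 v' ∧ v' ≠ v.1 ∧ mtch θ.2.1 (a1, v.1) (a1, v') ∧
            (θ.2.2 (a1, v.1, v.2)).1 = 0) ?_).trans
            ((ind_exists_le _).trans (Finset.sum_le_sum fun v' _ => ?_))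
          · rintro ⟨⟨h1, h2⟩, v', h3, h4, h5, h6⟩
            exact ⟨v', h4, h3, ⟨h1, h5, h6⟩, h2⟩
          · rw [ind_and, ind_and, ind_and, one_mul]
      _ = ∑ v', ind (S1 a1 v') * (ind (v' ≠ v.1) * avg (fun θ : Th A1 V1 V2 m1 l1 m21 l2 m22 =>
          1 * (ind (mtch θ.2.1 (a1, v.1) (a1, v')) * ind ((θ.2.2 (a1, v.1, v.2)).1 = 0)))) := by
          rw [avg_sum]; simp_rw [avg_mul_left]
      _ ≤ ∑ v', ind (S1 a1 v') * (1 * ((1 / (l1 + 1) * (1 / (l1 + 1)) * (1 / (m21 + 1))) *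
          (1 / (l2 + 1)))) := by
          refine Finset.sum_le_sum fun v' _ => mul_le_mul_of_nonneg_left ?_ (ind_nonneg _)
          by_cases h : v' = v.1
          · rw [ind_false (not_not.2 h), zero_mul]
            positivity
          · rw [ind_true h, one_mul, avg_prod3 (fun _ : A1 → Fin (m1 + 1) => 1)
              (fun Φ : Ph1 A1 V1 l1 m21 => ind (mtch Φ (a1, v.1) (a1, v')))
              (fun Φ : Ph2 A1 V1 V2 l2 m22 => ind ((Φ (a1, v.1, v.2)).1 = 0)), avg_const, avg_inc,
              avg_mtch]
            intro h2
            simp only [Prod.mk.injEq, true_and] at h2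
            exact h h2.symm
      _ ≤ _ := by
          rw [← Finset.sum_mul]
          gcongr
  calc _ ≤ _ := mul_le_mul_of_nonneg_left key (by positivity)
    _ = _ := by field_simp

lemma avg_conf3 (a3 : A3) (a1 : A1) (v : V1 × V2) {N30 N31 N32 : ℝ}
    (hN0 : ∑ i : A1 × V1 × V2, ind (S3 a3 i.1 i.2.1 i.2.2) ≤ N30)
    (hN1 : ∑ i : V1 × V2, ind (S3 a3 a1 i.1 i.2) ≤ N31)
    (hN2 : ∑ v2, ind (S3 a3 a1 v.1 v2) ≤ N32) :
    ((l1 + 1 : ℝ) * (l2 + 1)) * avg (fun θ : Th A1 V1 V2 m1 l1 m21 l2 m22 =>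
      ind (inC θ.2 a1 v ∧ conf3 S3 θ a3 a1 v)) ≤ N30 / ((m1 + 1) * ((l1 + 1) * (m21 + 1)) * ((l2 + 1) * (m22 + 1)))
       + N31 / (((l1 + 1) * (m21 + 1)) * ((l2 + 1) * (m22 + 1))) + N32 / ((l2 + 1) * (m22 + 1)) := by
  have hl1 : (l1 : ℝ) + 1 ≠ 0 := by positivity
  have hl2 : (l2 : ℝ) + 1 ≠ 0 := by positivity
  set c1 : ℝ := 1 / (l1 + 1) * (1 / (l1 + 1)) * (1 / (m21 + 1)) with hc1
  set c2 : ℝ := 1 / (l2 + 1) * (1 / (l2 + 1)) * (1 / (m22 + 1)) with hc2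
  have hc1' : 0 ≤ c1 := by positivity
  have hc2' : 0 ≤ c2 := by positivity
  have key : avg (fun θ : Th A1 V1 V2 m1 l1 m21 l2 m22 =>
      ind (inC θ.2 a1 v ∧ conf3 S3 θ a3 a1 v)) ≤
      N30 * (1 / (m1 + 1) * (c1 * c2)) + N31 * (1 * (c1 * c2)) + N32 * (1 * (1 / (l1 + 1) * c2)) := by
    calc _ ≤ avg (fun θ : Th A1 V1 V2 m1 l1 m21 l2 m22 =>
        (∑ i : A1 × V1 × V2, (ind (S3 a3 i.1 i.2.1 i.2.2) * (ind (i.1 ≠ a1) * (ind (θ.1 i.1 = θ.1 a1) *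
          (ind (mtch θ.2.1 (a1, v.1) (i.1, i.2.1)) * ind (mtch θ.2.2 (a1, v.1, v.2) i))))))
        + (∑ i : V1 × V2, (ind (S3 a3 a1 i.1 i.2) * (ind (i.1 ≠ v.1) * (1 *
          (ind (mtch θ.2.1 (a1, v.1) (a1, i.1)) * ind (mtch θ.2.2 (a1, v.1, v.2) (a1, i.1, i.2)))))))
        + (∑ v2, (ind (S3 a3 a1 v.1 v2) * (ind (v2 ≠ v.2) * (1 *
          (ind ((θ.2.1 (a1, v.1)).1 = 0) * ind (mtch θ.2.2 (a1, v.1, v.2) (a1, v.1, v2)))))))) := by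
          refine avg_mono fun θ => ?_
          refine (ind_mono (Q := ((∃ i : A1 × V1 × V2, S3 a3 i.1 i.2.1 i.2.2 ∧ i.1 ≠ a1 ∧ θ.1 i.1 = θ.1 a1 ∧
              mtch θ.2.1 (a1, v.1) (i.1, i.2.1) ∧ mtch θ.2.2 (a1, v.1, v.2) i)
            ∨ (∃ i : V1 × V2, S3 a3 a1 i.1 i.2 ∧ i.1 ≠ v.1 ∧
              mtch θ.2.1 (a1, v.1) (a1, i.1) ∧ mtch θ.2.2 (a1, v.1, v.2) (a1, i.1, i.2)))
            ∨ (∃ v2, S3 a3 a1 v.1 v2 ∧ v2 ≠ v.2 ∧ (θ.2.1 (a1, v.1)).1 = 0 ∧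
              mtch θ.2.2 (a1, v.1, v.2) (a1, v.1, v2))) ?_).trans ?_
          · rintro ⟨⟨h1, h2⟩, ⟨x, y, z⟩, h3, h4, h5, h6, h7, h8, h9⟩
            simp only at *
            by_cases hx : x = a1
            · subst hx
              by_cases hy : y = v.1
              · subst hy
                refine Or.inr ⟨z, h4, ?_, h1, h2, h7, h9⟩
                rintro rfl
                exact h3 rfl
              · exact Or.inl (Or.inr ⟨(y, z), h4, hy, ⟨h1, h6, h8⟩, h2, h7, h9⟩)
            · exact Or.inl (Or.inl ⟨(x, y, z), h4, hx, h5, ⟨h1, h6, h8⟩, h2, h7, h9⟩)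
          · refine (ind_or_le _ _).trans (add_le_add ((ind_or_le _ _).trans (add_le_add ?_ ?_)) ?_)
            · refine (ind_exists_le _).trans (le_of_eq (Finset.sum_congr rfl fun i _ => ?_))
              simp_rw [ind_and]
            · refine (ind_exists_le _).trans (le_of_eq (Finset.sum_congr rfl fun i _ => ?_))
              simp_rw [ind_and, one_mul]
            · refine (ind_exists_le _).trans (le_of_eq (Finset.sum_congr rfl fun i _ => ?_))
              simp_rw [ind_and, one_mul]
      _ ≤ (∑ i : A1 × V1 × V2, ind (S3 a3 i.1 i.2.1 i.2.2) * (1 / (m1 + 1) * (c1 * c2)))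
          + (∑ i : V1 × V2, ind (S3 a3 a1 i.1 i.2) * (1 * (c1 * c2)))
          + (∑ v2, ind (S3 a3 a1 v.1 v2) * (1 * (1 / (l1 + 1) * c2))) := by
          rw [avg_add, avg_add, avg_sum, avg_sum, avg_sum]
          simp_rw [avg_mul_left]
          refine add_le_add (add_le_add ?_ ?_) ?_
          · refine Finset.sum_le_sum fun i _ => mul_le_mul_of_nonneg_left ?_ (ind_nonneg _)
            by_cases h : i.1 = a1
            · rw [ind_false (not_not.2 h), zero_mul]
              positivity
            · rw [ind_true h, one_mul, avg_prod3 (fun h : A1 → Fin (m1 + 1) => ind (h i.1 = h a1))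
                (fun Φ : Ph1 A1 V1 l1 m21 => ind (mtch Φ (a1, v.1) (i.1, i.2.1)))
                (fun Φ : Ph2 A1 V1 V2 l2 m22 => ind (mtch Φ (a1, v.1, v.2) i)),
                avg_coll _ _ _ (Ne.symm h), avg_mtch, avg_mtch]
              · rintro rfl
                exact h rfl
              · intro h2
                simp only [Prod.mk.injEq] at h2
                exact h h2.1.symm
          · refine Finset.sum_le_sum fun i _ => mul_le_mul_of_nonneg_left ?_ (ind_nonneg _)
            by_cases h : i.1 = v.1
            · rw [ind_false (not_not.2 h), zero_mul]
              positivity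
            · rw [ind_true h, one_mul, ← avg_mul_left, avg_prod3 (fun _ : A1 → Fin (m1 + 1) => 1)
                (fun Φ : Ph1 A1 V1 l1 m21 => ind (mtch Φ (a1, v.1) (a1, i.1)))
                (fun Φ : Ph2 A1 V1 V2 l2 m22 => ind (mtch Φ (a1, v.1, v.2) (a1, i.1, i.2))),
                avg_const, avg_mtch, avg_mtch]
              · intro h2
                simp only [Prod.mk.injEq, true_and] at h2
                exact h h2.1.symm
              · intro h2
                simp only [Prod.mk.injEq, true_and] at h2
                exact h h2.symm
          · refine Finset.sum_le_sum fun v2 _ => mul_le_mul_of_nonneg_left ?_ (ind_nonneg _)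
            by_cases h : v2 = v.2
            · rw [ind_false (not_not.2 h), zero_mul]
              positivity
            · rw [ind_true h, one_mul, ← avg_mul_left, avg_prod3 (fun _ : A1 → Fin (m1 + 1) => 1)
                (fun Φ : Ph1 A1 V1 l1 m21 => ind ((Φ (a1, v.1)).1 = 0))
                (fun Φ : Ph2 A1 V1 V2 l2 m22 => ind (mtch Φ (a1, v.1, v.2) (a1, v.1, v2))),
                avg_const, avg_inc, avg_mtch]
              intro h2
              simp only [Prod.mk.injEq, true_and] at h2
              exact h h2.symm
      _ ≤ _ := by
          rw [← Finset.sum_mul, ← Finset.sum_mul, ← Finset.sum_mul]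
          gcongr
  calc _ ≤ _ := mul_le_mul_of_nonneg_left key (by positivity)
    _ = _ := by
      rw [hc1, hc2]
      field_simp

end oneshot
end TE

namespace TE

section oneshot5
variable {A1 A2 A3 V1 V2 : Type*} [Fintype A1] [Fintype A2] [Fintype A3] [Fintype V1] [Fintype V2]
  [DecidableEq A1] [DecidableEq V1] [DecidableEq V2]
  [Nonempty A1] [Nonempty V1] [Nonempty V2]

lemma epsilon_unique {α : Type*} [Nonempty α] {Q : α → Prop} {a : α} (h : Q a) (hu : ∀ b, b ≠ a → ¬ Q b) :
    Classical.epsilon Q = a := by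
  by_contra hne
  exact hu _ hne (Classical.epsilon_spec ⟨a, h⟩)

/-- deterministic part: given the hash functions, the code works -/
lemma oneshot_det (P : A1 → A2 → A3 → ℝ) (hP0 : ∀ a b c, 0 ≤ P a b c)
    (k : A1 → A2 → V1 × V2 → ℝ) (hk0 : ∀ a b v, 0 ≤ k a b v)
    (G : A1 → A2 → A3 → V1 × V2 → Prop) (S2 : A1 → A2 → Prop) (S1 : A1 → V1 → Prop)
    (S3 : A3 → A1 → V1 → V2 → Prop) (Tc : A1 → A2 → V1 × V2 → Prop)
    (hG2 : ∀ a b c v, G a b c v → S2 a b) (hG1 : ∀ a b c v, G a b c v → S1 a v.1)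
    (hG3 : ∀ a b c v, G a b c v → S3 c a v.1 v.2)
    {m1 l1 m21 l2 m22 : ℕ} (θ : Th A1 V1 V2 m1 l1 m21 l2 m22) :
    ∃ (h : A1 → Fin (m1 + 1)) (enc : A2 → Fin (m1 + 1) → Fin (m21 + 1) × Fin (m22 + 1))
      (dec2 : A2 → Fin (m1 + 1) → A1) (dec1 : A1 → Fin (m21 + 1) × Fin (m22 + 1) → V1)
      (dec3 : A3 → Fin (m1 + 1) → Fin (m21 + 1) × Fin (m22 + 1) → A1 × V1 × V2)
      (sel : A1 → A2 → V1 × V2),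
      ∑ a, ∑ b, ∑ c, P a b c * ind (¬ (dec2 b (h a) = a ∧ dec1 a (enc b (h a)) = (sel a b).1 ∧
        dec3 c (h a) (enc b (h a)) = (a, (sel a b).1, (sel a b).2) ∧ G a b c (sel a b))) ≤
      ∑ a, ∑ b, ∑ c, P a b c * (ind (conf2 S2 θ a b)
        + ind (((l1 + 1 : ℝ) * (l2 + 1)) * ∑ v, (k a b v * ind (Tc a b v)) * ind (inC θ.2 a v) < 1 / 2)
        + 2 * ∑ v, k a b v * (((l1 + 1 : ℝ) * (l2 + 1)) * (ind (inC θ.2 a v) * (ind (¬ G a b c v))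
          + ind (inC θ.2 a v ∧ conf1 S1 θ a v.1) + ind (inC θ.2 a v ∧ conf3 S3 θ c a v)))) := by
  set L : ℝ := (l1 + 1 : ℝ) * (l2 + 1) with hL
  have hL0 : 0 ≤ L := by positivity
  let bad : A1 → A2 → A3 → V1 × V2 → Prop := fun a b c v => ¬ G a b c v ∨ conf1 S1 θ a v.1 ∨ conf3 S3 θ c a v
  let e : A1 → A2 → V1 × V2 → ℝ := fun a b v => ∑ c, P a b c * ind (bad a b c v)
  have he0 : ∀ a b v, 0 ≤ e a b v := fun a b v =>
    Finset.sum_nonneg fun c _ => mul_nonneg (hP0 _ _ _) (ind_nonneg _)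
  have hsel : ∀ a b, ∃ v : V1 × V2, (∃ v', inC θ.2 a v') → (inC θ.2 a v ∧ ∀ v', inC θ.2 a v' → e a b v ≤ e a b v') := by
    intro a b
    by_cases hex : ∃ v', inC θ.2 a v'
    · obtain ⟨v, hv, hv'⟩ := Set.exists_min_image {v | inC θ.2 a v} (e a b) (Set.toFinite _) hex
      exact ⟨v, fun _ => ⟨hv, hv'⟩⟩
    · exact ⟨Classical.arbitrary _, fun h => absurd h hex⟩
  choose sel hsel using hsel
  let h : A1 → Fin (m1 + 1) := θ.1
  let dec2 : A2 → Fin (m1 + 1) → A1 := fun b j => Classical.epsilon fun a => S2 a b ∧ h a = j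
  let enc : A2 → Fin (m1 + 1) → Fin (m21 + 1) × Fin (m22 + 1) := fun b j =>
    let a := dec2 b j
    ((θ.2.1 (a, (sel a b).1)).2, (θ.2.2 (a, (sel a b).1, (sel a b).2)).2)
  let dec1 : A1 → Fin (m21 + 1) × Fin (m22 + 1) → V1 := fun a j =>
    Classical.epsilon fun v => S1 a v ∧ (θ.2.1 (a, v)).1 = 0 ∧ (θ.2.1 (a, v)).2 = j.1
  let dec3 : A3 → Fin (m1 + 1) → Fin (m21 + 1) × Fin (m22 + 1) → A1 × V1 × V2 := fun c j1 j2 =>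
    Classical.epsilon fun i => S3 c i.1 i.2.1 i.2.2 ∧ θ.1 i.1 = j1 ∧
      (θ.2.1 (i.1, i.2.1)).1 = 0 ∧ (θ.2.2 i).1 = 0 ∧ (θ.2.1 (i.1, i.2.1)).2 = j2.1 ∧ (θ.2.2 i).2 = j2.2
  refine ⟨h, enc, dec2, dec1, dec3, sel, ?_⟩
  refine Finset.sum_le_sum fun a _ => Finset.sum_le_sum fun b _ => ?_
  set W : ℝ := L * ∑ v, (k a b v * ind (Tc a b v)) * ind (inC θ.2 a v) with hW
  -- pointwise failure bound
  have hfail : ∀ c, ind (¬ (dec2 b (h a) = a ∧ dec1 a (enc b (h a)) = (sel a b).1 ∧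
        dec3 c (h a) (enc b (h a)) = (a, (sel a b).1, (sel a b).2) ∧ G a b c (sel a b))) ≤
      ind (conf2 S2 θ a b) + ind (W < 1 / 2) + ind (¬ W < 1 / 2) * ind (bad a b c (sel a b)) := by
    intro c
    rw [← ind_and]
    refine (ind_mono ?_).trans ((ind_or_le _ _).trans (add_le_add (ind_or_le _ _) le_rfl))
    intro hf
    by_contra hcon
    push Not at hcon
    obtain ⟨⟨hc2, hW2⟩, hbad⟩ := hcon
    have hb := hbad hW2
    simp only [bad, not_or, not_not] at hb
    obtain ⟨hG, hc1, hc3⟩ := hb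
    apply hf
    have hinC : inC θ.2 a (sel a b) := by
      refine (hsel a b ?_).1
      by_contra hno
      push Not at hno
      have : W = 0 := by
        rw [hW]
        simp [fun v => ind_false (hno v)]
      rw [this] at hW2
      norm_num at hW2
    have d2 : dec2 b (h a) = a := by
      refine epsilon_unique ⟨hG2 _ _ _ _ hG, rfl⟩ ?_
      rintro a' hne ⟨h1, h2⟩
      exact hc2 ⟨a', hne, h1, h2⟩
    have denc : enc b (h a) = ((θ.2.1 (a, (sel a b).1)).2, (θ.2.2 (a, (sel a b).1, (sel a b).2)).2) := by
      simp only [enc, d2]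
    refine ⟨d2, ?_, ?_, hG⟩
    · rw [denc]
      refine epsilon_unique ⟨hG1 _ _ _ _ hG, hinC.1, rfl⟩ ?_
      rintro v' hne ⟨h1, h2, h3⟩
      exact hc1 ⟨v', hne, h1, h2, h3⟩
    · rw [denc]
      refine epsilon_unique ⟨hG3 _ _ _ _ hG, rfl, hinC.1, hinC.2, rfl, rfl⟩ ?_
      rintro v' hne ⟨h1, h2, h3, h4, h5, h6⟩
      exact hc3 ⟨v', hne, h1, h2, h3, h4, h5, h6⟩
  have hkey : ind (¬ W < 1 / 2) * e a b (sel a b) ≤ 2 * ∑ v, k a b v * (L * (ind (inC θ.2 a v) * e a b v)) := by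
    by_cases hW2 : W < 1 / 2
    · rw [ind_false (not_not.2 hW2), zero_mul]
      have : 0 ≤ ∑ v, k a b v * (L * (ind (inC θ.2 a v) * e a b v)) :=
        Finset.sum_nonneg fun v _ => mul_nonneg (hk0 _ _ _) (mul_nonneg hL0 (mul_nonneg (ind_nonneg _) (he0 _ _ _)))
      linarith
    · rw [ind_true hW2, one_mul]
      have h1 : W * e a b (sel a b) ≤ ∑ v, k a b v * (L * (ind (inC θ.2 a v) * e a b v)) := by
        obtain ⟨E, hE⟩ : ∃ E, E = e a b (sel a b) := ⟨_, rfl⟩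
        rw [← hE, hW, Finset.mul_sum, Finset.sum_mul]
        refine Finset.sum_le_sum fun v _ => ?_
        rw [hE]
        by_cases hv : inC θ.2 a v
        · rw [ind_true hv]
          have h2 := (hsel a b ⟨v, hv⟩).2 v hv
          have h3 : k a b v * ind (Tc a b v) ≤ k a b v := mul_le_of_le_one_right (hk0 _ _ _) (ind_le_one _)
          calc L * (k a b v * ind (Tc a b v) * 1) * e a b (sel a b) ≤ L * (k a b v * 1) * e a b v := by
                have := he0 a b (sel a b)
                have := hk0 a b v
                gcongr
            _ = _ := by ring
        · rw [ind_false hv]; simp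
      have h2 := he0 a b (sel a b)
      have h3 : 1 / 2 ≤ W := not_lt.1 hW2
      nlinarith
  have hbadle : ∀ c v, ind (inC θ.2 a v) * ind (bad a b c v) ≤ ind (inC θ.2 a v) * (ind (¬ G a b c v))
          + ind (inC θ.2 a v ∧ conf1 S1 θ a v.1) + ind (inC θ.2 a v ∧ conf3 S3 θ c a v) := by
    intro c v
    rw [← ind_and, ← ind_and]
    refine (ind_mono ?_).trans ((ind_or_le _ _).trans (add_le_add (ind_or_le _ _) le_rfl))
    simp only [bad]
    tauto
  calc _ ≤ ∑ c, P a b c * (ind (conf2 S2 θ a b) + ind (W < 1 / 2) + ind (¬ W < 1 / 2) * ind (bad a b c (sel a b))) :=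
        Finset.sum_le_sum fun c _ => mul_le_mul_of_nonneg_left (hfail c) (hP0 _ _ _)
    _ = ∑ c, P a b c * (ind (conf2 S2 θ a b) + ind (W < 1 / 2)) + ind (¬ W < 1 / 2) * e a b (sel a b) := by
        simp only [e]
        rw [Finset.mul_sum, ← Finset.sum_add_distrib]
        refine Finset.sum_congr rfl fun c _ => ?_
        ring
    _ ≤ ∑ c, P a b c * (ind (conf2 S2 θ a b) + ind (W < 1 / 2)) + 
          2 * ∑ v, k a b v * (L * (ind (inC θ.2 a v) * e a b v)) := by linarith
    _ = ∑ c, P a b c * (ind (conf2 S2 θ a b) + ind (W < 1 / 2) + 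
          2 * ∑ v, k a b v * (L * (ind (inC θ.2 a v) * ind (bad a b c v)))) := by
        simp_rw [mul_add, Finset.sum_add_distrib]
        congr 1
        simp only [e]
        simp_rw [Finset.mul_sum]
        rw [Finset.sum_comm]
        refine Finset.sum_congr rfl fun c _ => ?_
        refine Finset.sum_congr rfl fun v _ => ?_
        ring
    _ ≤ _ := by
        refine Finset.sum_le_sum fun c _ => mul_le_mul_of_nonneg_left ?_ (hP0 _ _ _)
        have := Finset.sum_le_sum fun v (_ : v ∈ Finset.univ) =>
          mul_le_mul_of_nonneg_left (mul_le_mul_of_nonneg_left (hbadle c v) hL0) (hk0 a b v)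
        linarith

theorem oneshot (P : A1 → A2 → A3 → ℝ) (hP0 : ∀ a b c, 0 ≤ P a b c)
    (hP1 : ∑ a, ∑ b, ∑ c, P a b c = 1)
    (k : A1 → A2 → V1 × V2 → ℝ) (hk0 : ∀ a b v, 0 ≤ k a b v) (hk1 : ∀ a b, ∑ v, k a b v = 1)
    (G : A1 → A2 → A3 → V1 × V2 → Prop) (S2 : A1 → A2 → Prop) (S1 : A1 → V1 → Prop)
    (S3 : A3 → A1 → V1 → V2 → Prop) (Tc : A1 → A2 → V1 × V2 → Prop)
    (hG2 : ∀ a b c v, G a b c v → S2 a b) (hG1 : ∀ a b c v, G a b c v → S1 a v.1)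
    (hG3 : ∀ a b c v, G a b c v → S3 c a v.1 v.2) (hGc : ∀ a b c v, G a b c v → Tc a b v)
    (m1 l1 m21 l2 m22 : ℕ) {N2 N1 N30 N31 N32 κ1 κ2 η : ℝ}
    (hN2 : ∀ b, ∑ a, ind (S2 a b) ≤ N2) (hN1 : ∀ a, ∑ v, ind (S1 a v) ≤ N1)
    (hN30 : ∀ c, ∑ i : A1 × V1 × V2, ind (S3 c i.1 i.2.1 i.2.2) ≤ N30)
    (hN31 : ∀ c a, ∑ i : V1 × V2, ind (S3 c a i.1 i.2) ≤ N31)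
    (hN32 : ∀ c a v1, ∑ v2, ind (S3 c a v1 v2) ≤ N32)
    (hκ1 : ∀ a b v1, ∑ v2, k a b (v1, v2) * ind (Tc a b (v1, v2)) ≤ κ1) 
    (hκ2 : ∀ a b v, k a b v * ind (Tc a b v) ≤ κ2) (hκ1' : 0 ≤ κ1) (hκ2' : 0 ≤ κ2)
    (hη : ∑ a, ∑ b, ∑ c, P a b c * ∑ v, k a b v * ind (¬ G a b c v) ≤ η) :
    ∃ (h : A1 → Fin (m1 + 1)) (enc : A2 → Fin (m1 + 1) → Fin (m21 + 1) × Fin (m22 + 1))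
      (dec2 : A2 → Fin (m1 + 1) → A1) (dec1 : A1 → Fin (m21 + 1) × Fin (m22 + 1) → V1)
      (dec3 : A3 → Fin (m1 + 1) → Fin (m21 + 1) × Fin (m22 + 1) → A1 × V1 × V2)
      (sel : A1 → A2 → V1 × V2),
      ∑ a, ∑ b, ∑ c, P a b c * ind (¬ (dec2 b (h a) = a ∧ dec1 a (enc b (h a)) = (sel a b).1 ∧
        dec3 c (h a) (enc b (h a)) = (a, (sel a b).1, (sel a b).2) ∧ G a b c (sel a b))) ≤
      N2 / (m1 + 1) + 4 * (η + l1 * κ1 + (l1 + 1) * l2 * κ2) + 2 * (η + N1 / ((l1 + 1) * (m21 + 1)) +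
        (N30 / ((m1 + 1) * ((l1 + 1) * (m21 + 1)) * ((l2 + 1) * (m22 + 1)))
       + N31 / (((l1 + 1) * (m21 + 1)) * ((l2 + 1) * (m22 + 1))) + N32 / ((l2 + 1) * (m22 + 1)))) := by
  have hl1 : (l1 : ℝ) + 1 ≠ 0 := by positivity
  have hl2 : (l2 : ℝ) + 1 ≠ 0 := by positivity
  obtain ⟨θ, hθ⟩ := exists_le_avg (fun θ : Th A1 V1 V2 m1 l1 m21 l2 m22 => 
    ∑ a, ∑ b, ∑ c, P a b c * (ind (conf2 S2 θ a b)
        + ind (((l1 + 1 : ℝ) * (l2 + 1)) * ∑ v, (k a b v * ind (Tc a b v)) * ind (inC θ.2 a v) < 1 / 2)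
        + 2 * ∑ v, k a b v * (((l1 + 1 : ℝ) * (l2 + 1)) * (ind (inC θ.2 a v) * (ind (¬ G a b c v))
          + ind (inC θ.2 a v ∧ conf1 S1 θ a v.1) + ind (inC θ.2 a v ∧ conf3 S3 θ c a v)))))
  obtain ⟨h, enc, dec2, dec1, dec3, sel, hdet⟩ := oneshot_det P hP0 k hk0 G S2 S1 S3 Tc hG2 hG1 hG3 θ
  refine ⟨h, enc, dec2, dec1, dec3, sel, hdet.trans (hθ.trans ?_)⟩
  set B1 : ℝ := N1 / ((l1 + 1) * (m21 + 1)) with hB1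
  set B3 : ℝ := (N30 / ((m1 + 1) * ((l1 + 1) * (m21 + 1)) * ((l2 + 1) * (m22 + 1)))
       + N31 / (((l1 + 1) * (m21 + 1)) * ((l2 + 1) * (m22 + 1))) + N32 / ((l2 + 1) * (m22 + 1))) with hB3
  rw [avg_sum]
  simp_rw [avg_sum, avg_mul_left]
  have hpt : ∀ a b c, avg (fun θ : Th A1 V1 V2 m1 l1 m21 l2 m22 => (ind (conf2 S2 θ a b)
        + ind (((l1 + 1 : ℝ) * (l2 + 1)) * ∑ v, (k a b v * ind (Tc a b v)) * ind (inC θ.2 a v) < 1 / 2)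
        + 2 * ∑ v, k a b v * (((l1 + 1 : ℝ) * (l2 + 1)) * (ind (inC θ.2 a v) * (ind (¬ G a b c v))
          + ind (inC θ.2 a v ∧ conf1 S1 θ a v.1) + ind (inC θ.2 a v ∧ conf3 S3 θ c a v))))) ≤
      (N2 / (m1 + 1) + 4 * (l1 * κ1 + (l1 + 1) * l2 * κ2) + 2 * (B1 + B3)) +
        6 * ∑ v, k a b v * ind (¬ G a b c v) := by
    intro a b c
    rw [avg_add, avg_add, avg_mul_left, avg_sum]
    have e1 := avg_conf2 (V1 := V1) (V2 := V2) (m1 := m1) (l1 := l1) (m21 := m21) (l2 := l2) (m22 := m22) S2 a b (hN2 b)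
    have hkt1 : ∑ v, k a b v * ind (Tc a b v) ≤ 1 := by
      rw [← hk1 a b]
      exact Finset.sum_le_sum fun v _ => mul_le_of_le_one_right (hk0 _ _ _) (ind_le_one _)
    have e2 := cover_bound (A1 := A1) l1 m21 l2 m22 a (fun v => k a b v * ind (Tc a b v))
      (fun v => mul_nonneg (hk0 _ _ _) (ind_nonneg _)) hkt1 (hκ1 a b) (hκ2 a b) hκ1' hκ2'
    have e2' : avg (fun θ : Th A1 V1 V2 m1 l1 m21 l2 m22 => 
        ind (((l1 + 1 : ℝ) * (l2 + 1)) * ∑ v, (k a b v * ind (Tc a b v)) * ind (inC θ.2 a v) < 1 / 2)) =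
        avg (fun Φ : Ph1 A1 V1 l1 m21 × Ph2 A1 V1 V2 l2 m22 =>
      ind (((l1 + 1 : ℝ) * (l2 + 1)) * ∑ v, (k a b v * ind (Tc a b v)) * ind (inC Φ a v) < 1 / 2)) :=
      avg_snd (fun Φ : Ph1 A1 V1 l1 m21 × Ph2 A1 V1 V2 l2 m22 =>
      ind (((l1 + 1 : ℝ) * (l2 + 1)) * ∑ v, (k a b v * ind (Tc a b v)) * ind (inC Φ a v) < 1 / 2))
    have e3 : 1 - ∑ v, k a b v * ind (Tc a b v) ≤ ∑ v, k a b v * ind (¬ G a b c v) := by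
      rw [← hk1 a b, ← Finset.sum_sub_distrib]
      refine Finset.sum_le_sum fun v _ => ?_
      have : 1 - ind (Tc a b v) ≤ ind (¬ G a b c v) := by
        by_cases hg : G a b c v
        · rw [ind_true (hGc _ _ _ _ hg), ind_false (not_not.2 hg)]; norm_num
        · rw [ind_true hg]
          linarith [ind_nonneg (Tc a b v)]
      nlinarith [hk0 a b v]
    have e4 : ∑ v, avg (fun θ : Th A1 V1 V2 m1 l1 m21 l2 m22 => 
        k a b v * (((l1 + 1 : ℝ) * (l2 + 1)) * (ind (inC θ.2 a v) * (ind (¬ G a b c v))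
          + ind (inC θ.2 a v ∧ conf1 S1 θ a v.1) + ind (inC θ.2 a v ∧ conf3 S3 θ c a v)))) ≤
        ∑ v, k a b v * (ind (¬ G a b c v) + B1 + B3) := by
      refine Finset.sum_le_sum fun v _ => ?_
      rw [avg_mul_left, avg_mul_left, avg_add, avg_add]
      refine mul_le_mul_of_nonneg_left ?_ (hk0 _ _ _)
      have f1 := avg_conf1 (m1 := m1) (l1 := l1) (m21 := m21) (l2 := l2) (m22 := m22) S1 a v (hN1 a)
      have f3 := avg_conf3 (m1 := m1) (l1 := l1) (m21 := m21) (l2 := l2) (m22 := m22) S3 c a v (hN30 c) (hN31 c a) (hN32 c a v.1)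
      have f0 : ((l1 + 1 : ℝ) * (l2 + 1)) * avg (fun θ : Th A1 V1 V2 m1 l1 m21 l2 m22 => 
          ind (inC θ.2 a v) * (ind (¬ G a b c v))) = ind (¬ G a b c v) := by
        simp_rw [mul_comm (ind (inC _ _ _))]
        rw [avg_mul_left, avg_snd (fun Φ : Ph1 A1 V1 l1 m21 × Ph2 A1 V1 V2 l2 m22 => ind (inC Φ a v)), avg_inC]
        field_simp
      rw [mul_add, mul_add, f0]
      linarith
    have e5 : ∑ v, k a b v * (ind (¬ G a b c v) + B1 + B3) = ∑ v, k a b v * ind (¬ G a b c v) + (B1 + B3) := by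
      have : ∀ v, k a b v * (ind (¬ G a b c v) + B1 + B3) = k a b v * ind (¬ G a b c v) + k a b v * (B1 + B3) :=
        fun v => by ring
      simp_rw [this]
      rw [Finset.sum_add_distrib, ← Finset.sum_mul, hk1, one_mul]
    rw [e2']
    linarith
  calc _ ≤ ∑ a, ∑ b, ∑ c, P a b c * ((N2 / (m1 + 1) + 4 * (l1 * κ1 + (l1 + 1) * l2 * κ2) + 2 * (B1 + B3)) +
        6 * ∑ v, k a b v * ind (¬ G a b c v)) := by
        refine Finset.sum_le_sum fun a _ => Finset.sum_le_sum fun b _ => Finset.sum_le_sum fun c _ => ?_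
        exact mul_le_mul_of_nonneg_left (hpt a b c) (hP0 _ _ _)
    _ = (∑ a, ∑ b, ∑ c, P a b c) * (N2 / (m1 + 1) + 4 * (l1 * κ1 + (l1 + 1) * l2 * κ2) + 2 * (B1 + B3)) +
        6 * ∑ a, ∑ b, ∑ c, P a b c * ∑ v, k a b v * ind (¬ G a b c v) := by
        simp_rw [Finset.sum_mul]
        rw [Finset.mul_sum, ← Finset.sum_add_distrib]
        refine Finset.sum_congr rfl fun a _ => ?_
        rw [Finset.mul_sum, ← Finset.sum_add_distrib]
        refine Finset.sum_congr rfl fun b _ => ?_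
        rw [Finset.mul_sum, ← Finset.sum_add_distrib]
        refine Finset.sum_congr rfl fun c _ => ?_
        ring
    _ ≤ _ := by
        rw [hP1]
        linarith

end oneshot5
end TE

namespace TE

section kern
lemma dist_eq_ind {Ω α : Type*} [Fintype Ω] [Fintype α] (w : Ω → ℝ) (X : Ω → α) (a : α) :
    IT.dist w X a = ∑ ω, w ω * ind (X ω = a) := by
  unfold IT.dist ind
  simp

lemma sum_mul_ind {α : Type*} [Fintype α] (F : α → ℝ) (a : α) : ∑ x, F x * ind (x = a) = F a := by
  classical
  rw [Finset.sum_eq_single a]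
  · simp [ind_true]
  · intro b _ hb
    rw [ind_false hb, mul_zero]
  · simp

/-- conditional probability mass -/
def cp {Ω α β : Type*} [Fintype Ω] [Fintype α] [Fintype β] (w : Ω → ℝ) (Y : Ω → α) (Z : Ω → β)
    (y : α) (z : β) : ℝ := IT.dist w (fun ω => (Y ω, Z ω)) (y, z) / IT.dist w Z z

section
variable {Ω α β : Type*} [Fintype Ω] [Fintype α] [Fintype β] {w : Ω → ℝ}

lemma cp_nonneg (hw : IsPMF w) (Y : Ω → α) (Z : Ω → β) (y : α) (z : β) : 0 ≤ cp w Y Z y z :=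
  div_nonneg (dist_nonneg hw.1 _ _) (dist_nonneg hw.1 _ _)

lemma cp_pos (hw : IsPMF w) (Y : Ω → α) (Z : Ω → β) (ω : Ω) (h : 0 < w ω) : 0 < cp w Y Z (Y ω) (Z ω) :=
  div_pos (h.trans_le (le_dist hw.1 (fun ω => (Y ω, Z ω)) ω)) (h.trans_le (le_dist hw.1 Z ω))

lemma sum_cp (hw : IsPMF w) (Y : Ω → α) (Z : Ω → β) (z : β) : ∑ y, cp w Y Z y z ≤ 1 := by
  unfold cp
  rw [← Finset.sum_div, sum_dist_left]
  exact div_self_le_one _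

lemma expect_cp (hw : IsPMF w) (Y : Ω → α) (Z : Ω → β) :
    ∑ ω, w ω * (-Real.logb 2 (cp w Y Z (Y ω) (Z ω))) = condH w Y Z := by
  unfold condH
  rw [H_eq, H_eq, neg_sub_neg, ← Finset.sum_sub_distrib]
  refine Finset.sum_congr rfl fun ω _ => ?_
  rcases (hw.1 ω).eq_or_lt with h | h
  · rw [← h]; simp
  · unfold cp
    rw [Real.logb_div (h.trans_le (le_dist hw.1 (fun ω => (Y ω, Z ω)) ω)).ne'
      (h.trans_le (le_dist hw.1 Z ω)).ne']
    ring
end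

/-- counting typical sequences -/
lemma count_le {Y : Type*} [Fintype Y] {n : ℕ} (c : Fin n → Y → ℝ) (h0 : ∀ t y, 0 ≤ c t y)
    (h1 : ∀ t, ∑ y, c t y ≤ 1) (s : ℝ) {I : Type*} [Fintype I] (φ : I → Fin n → Y)
    (hφ : Function.Injective φ) :
    ∑ i, ind ((∀ t, 0 < c t (φ i t)) ∧ ∑ t, -Real.logb 2 (c t (φ i t)) ≤ s) ≤ 2 ^ s := by
  classical
  have hpt : ∀ i, ind ((∀ t, 0 < c t (φ i t)) ∧ ∑ t, -Real.logb 2 (c t (φ i t)) ≤ s) ≤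
      2 ^ s * ∏ t, c t (φ i t) := by
    intro i
    by_cases h : (∀ t, 0 < c t (φ i t)) ∧ ∑ t, -Real.logb 2 (c t (φ i t)) ≤ s
    · rw [ind_true h]
      have e : ∏ t, c t (φ i t) = 2 ^ (∑ t, Real.logb 2 (c t (φ i t))) := by
        rw [Real.rpow_sum_of_pos (by norm_num)]
        exact Finset.prod_congr rfl fun t _ => (Real.rpow_logb (by norm_num) (by norm_num) (h.1 t)).symm
      rw [e, ← Real.rpow_add (by norm_num)]
      refine Real.one_le_rpow (by norm_num) ?_
      have := h.2
      rw [Finset.sum_neg_distrib] at this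
      linarith
    · rw [ind_false h]
      exact mul_nonneg (by positivity) (Finset.prod_nonneg fun t _ => h0 _ _)
  calc _ ≤ ∑ i, 2 ^ s * ∏ t, c t (φ i t) := Finset.sum_le_sum fun i _ => hpt i
    _ = 2 ^ s * ∑ i, ∏ t, c t (φ i t) := by rw [Finset.mul_sum]
    _ ≤ 2 ^ s * ∑ y : Fin n → Y, ∏ t, c t (y t) := by
        refine mul_le_mul_of_nonneg_left ?_ (by positivity)
        rw [← Finset.sum_image (f := fun y : Fin n → Y => ∏ t, c t (y t)) (g := φ) (s := Finset.univ)
          (fun a _ b _ h => hφ h)]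
        exact Finset.sum_le_sum_of_subset_of_nonneg (Finset.subset_univ _)
          (fun y _ _ => Finset.prod_nonneg fun t _ => h0 _ _)
    _ = 2 ^ s * ∏ t, ∑ y, c t y := by rw [sum_prod_fun]
    _ ≤ 2 ^ s * 1 := by
        refine mul_le_mul_of_nonneg_left ?_ (by positivity)
        exact Finset.prod_le_one (fun t _ => Finset.sum_nonneg fun y _ => h0 _ _) (fun t _ => h1 t)
    _ = _ := mul_one _

lemma sum_pi_prod {n : ℕ} {α β : Type*} [Fintype α] [Fintype β] (F : (Fin n → α × β) → ℝ) :
    ∑ x, F x = ∑ a : Fin n → α, ∑ b : Fin n → β, F (fun t => (a t, b t)) := by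
  rw [← Fintype.sum_prod_type' (f := fun (a : Fin n → α) (b : Fin n → β) => F (fun t => (a t, b t)))]
  exact Fintype.sum_equiv (Equiv.arrowProdEquivProdArrow _ _ _) _ _ (fun x => rfl)

variable {X1 X2 X3 U1 U2 : Type*} [Fintype X1] [Fintype X2] [Fintype X3] [Fintype U1] [Fintype U2]

/-- joint pmf from source and kernel -/
def jq (p : X1 × X2 × X3 → ℝ) (k : X1 → X2 → U1 × U2 → ℝ) : X1 × X2 × X3 × U1 × U2 → ℝ :=
  fun v => p (v.1, v.2.1, v.2.2.1) * k v.1 v.2.1 v.2.2.2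

lemma isPMF_jq {p : X1 × X2 × X3 → ℝ} (hp : IsPMF p) {k : X1 → X2 → U1 × U2 → ℝ}
    (hk0 : ∀ a b v, 0 ≤ k a b v) (hk1 : ∀ a b, ∑ v, k a b v = 1) : IsPMF (jq p k) := by
  refine ⟨fun v => mul_nonneg (hp.1 _) (hk0 _ _ _), ?_⟩
  rw [← hp.2]
  simp only [jq, Fintype.sum_prod_type (α₁ := X1), Fintype.sum_prod_type (α₁ := X2), Fintype.sum_prod_type (α₁ := X3)]
  simp_rw [← Finset.mul_sum, hk1, mul_one]

lemma dist_jq_12 (p : X1 × X2 × X3 → ℝ) {k : X1 → X2 → U1 × U2 → ℝ} (hk1 : ∀ a b, ∑ v, k a b v = 1) (a b) :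
    IT.dist (jq p k) (fun v => (v.1, v.2.1)) (a, b) = ∑ c, p (a, b, c) := by
  rw [dist_eq_ind]
  simp only [jq, Fintype.sum_prod_type (α₁ := X1), Fintype.sum_prod_type (α₁ := X2), Fintype.sum_prod_type (α₁ := X3),
    Prod.mk.injEq, ind_and]
  have : ∀ x1 x2, ∑ c, ∑ v, p (x1, x2, c) * k x1 x2 v * (ind (x1 = a) * ind (x2 = b)) =
      ((∑ c, p (x1, x2, c)) * ind (x2 = b)) * ind (x1 = a) := by
    intro x1 x2
    simp_rw [← Finset.sum_mul, ← Finset.mul_sum, hk1]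
    ring
  simp_rw [this, ← Finset.sum_mul]
  rw [sum_mul_ind (fun x1 => ∑ x2, (∑ c, p (x1, x2, c)) * ind (x2 = b)), sum_mul_ind (fun x2 => ∑ c, p (a, x2, c))]

lemma dist_jq_12u (p : X1 × X2 × X3 → ℝ) (k : X1 → X2 → U1 × U2 → ℝ)
    {β : Type*} [Fintype β] (f : U1 × U2 → β) (a b u) :
    IT.dist (jq p k) (fun v => (f v.2.2.2, v.1, v.2.1)) (u, a, b) =
      (∑ c, p (a, b, c)) * ∑ v, k a b v * ind (f v = u) := by
  rw [dist_eq_ind]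
  simp only [jq, Fintype.sum_prod_type (α₁ := X1), Fintype.sum_prod_type (α₁ := X2), Fintype.sum_prod_type (α₁ := X3),
    Prod.mk.injEq, ind_and]
  have : ∀ x1 x2, ∑ c, ∑ v, p (x1, x2, c) * k x1 x2 v * (ind (f v = u) * (ind (x1 = a) * ind (x2 = b))) =
      (((∑ c, p (x1, x2, c)) * ∑ v, k x1 x2 v * ind (f v = u)) * ind (x2 = b)) * ind (x1 = a) := by
    intro x1 x2
    rw [Finset.sum_mul_sum]
    simp_rw [Finset.sum_mul]
    refine Finset.sum_congr rfl fun c _ => Finset.sum_congr rfl fun v _ => ?_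
    ring
  simp_rw [this, ← Finset.sum_mul]
  rw [sum_mul_ind (fun x1 => ∑ x2, ((∑ c, p (x1, x2, c)) * ∑ v, k x1 x2 v * ind (f v = u)) * ind (x2 = b)),
    sum_mul_ind (fun x2 => (∑ c, p (a, x2, c)) * ∑ v, k a x2 v * ind (f v = u))]

/-- the kernel is the conditional probability -/
lemma cp_jq {p : X1 × X2 × X3 → ℝ} {k : X1 → X2 → U1 × U2 → ℝ} (hk1 : ∀ a b, ∑ v, k a b v = 1)
    {β : Type*} [Fintype β] (f : U1 × U2 → β) (a b u) (h : 0 < ∑ c, p (a, b, c)) :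
    cp (jq p k) (fun v => f v.2.2.2) (fun v => (v.1, v.2.1)) u (a, b) = ∑ v, k a b v * ind (f v = u) := by
  unfold cp
  rw [dist_jq_12u, dist_jq_12 p hk1]
  field_simp

lemma jq_pos_marg {p : X1 × X2 × X3 → ℝ} (hp : IsPMF p) {k : X1 → X2 → U1 × U2 → ℝ}
    (hk0 : ∀ a b v, 0 ≤ k a b v) (v) (h : 0 < jq p k v) :
    0 < ∑ c, p (v.1, v.2.1, c) ∧ 0 < k v.1 v.2.1 v.2.2.2 := by
  have h1 : 0 < p (v.1, v.2.1, v.2.2.1) := by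
    rcases (hp.1 (v.1, v.2.1, v.2.2.1)).eq_or_lt with h' | h'
    · simp [jq, ← h'] at h
    · exact h'
  refine ⟨h1.trans_le (Finset.single_le_sum (f := fun c => p (v.1, v.2.1, c)) (fun c _ => hp.1 _)
    (Finset.mem_univ v.2.2.1)), ?_⟩
  exact (pos_iff_pos_of_mul_pos h).1 h1

/-- E log k = - H -/
lemma expect_kern {p : X1 × X2 × X3 → ℝ} (hp : IsPMF p) {k : X1 → X2 → U1 × U2 → ℝ}
    (hk0 : ∀ a b v, 0 ≤ k a b v) (hk1 : ∀ a b, ∑ v, k a b v = 1)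
    {β : Type*} [Fintype β] (f : U1 × U2 → β) :
    ∑ v, jq p k v * Real.logb 2 (∑ v', k v.1 v.2.1 v' * ind (f v' = f v.2.2.2)) =
      - condH (jq p k) (fun v => f v.2.2.2) (fun v => (v.1, v.2.1)) := by
  have hq := isPMF_jq hp hk0 hk1
  rw [← expect_cp hq, ← Finset.sum_neg_distrib]
  refine Finset.sum_congr rfl fun v _ => ?_
  rcases (hq.1 v).eq_or_lt with h | h
  · rw [← h]; simp
  · rw [cp_jq hk1 f _ _ _ (jq_pos_marg hp hk0 v h).1]
    ring

lemma exists_kernel {p : X1 × X2 × X3 → ℝ} {q : X1 × X2 × X3 × U1 × U2 → ℝ} (hq : IsPMF q)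
    (hm : ∀ a b c, (∑ d, ∑ e, q (a, b, c, d, e)) = p (a, b, c))
    (hM : IT.condMutInfo q (fun v => (v.2.2.2.1, v.2.2.2.2)) (fun v => v.2.2.1)
          (fun v => (v.1, v.2.1)) = 0) :
    ∃ k : X1 → X2 → U1 × U2 → ℝ, (∀ a b v, 0 ≤ k a b v) ∧ (∀ a b, ∑ v, k a b v = 1) ∧ q = jq p k := by
  classical
  rw [condMutInfo_eq_zero_iff _ _ _ hq] at hM
  have hne : Nonempty (U1 × U2) := by
    by_contra hemp
    rw [not_nonempty_iff] at hemp
    have : IsEmpty (X1 × X2 × X3 × U1 × U2) := ⟨fun v => hemp.elim v.2.2.2⟩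
    have := hq.2
    simp at this
  obtain ⟨u0⟩ := hne
  let k : X1 → X2 → U1 × U2 → ℝ := fun a b v => 
    if IT.dist q (fun v => (v.1, v.2.1)) (a, b) = 0 then ind (v = u0) else
      cp q (fun v => (v.2.2.2.1, v.2.2.2.2)) (fun v => (v.1, v.2.1)) v (a, b)
  refine ⟨k, ?_, ?_, ?_⟩
  · intro a b v
    simp only [k]
    split_ifs
    · exact ind_nonneg _
    · exact cp_nonneg hq _ _ _ _
  · intro a b
    simp only [k]
    split_ifs with h
    · simpa using sum_mul_ind (fun _ => (1 : ℝ)) u0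
    · unfold cp
      rw [← Finset.sum_div, sum_dist_left, div_self h]
  · funext ⟨a, b, c, d, e⟩
    have h1 := hM (d, e) c (a, b)
    have e1 : IT.dist q (fun ω => ((ω.2.2.2.1, ω.2.2.2.2), ω.2.2.1, ω.1, ω.2.1)) ((d, e), c, a, b) = q (a, b, c, d, e) := by
      rw [dist_eq_ind, ← sum_mul_ind q (a, b, c, d, e)]
      refine Finset.sum_congr rfl fun v _ => ?_
      congr 2
      apply propext
      constructor
      · intro h
        simp only [Prod.mk.injEq] at h
        obtain ⟨⟨h1, h2⟩, h3, h4, h5⟩ := h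
        exact Prod.ext h4 (Prod.ext h5 (Prod.ext h3 (Prod.ext h1 h2)))
      · rintro rfl; rfl
    have e2 : IT.dist q (fun ω => (ω.2.2.1, ω.1, ω.2.1)) (c, a, b) = p (a, b, c) := by
      rw [← hm, ← Fintype.sum_prod_type' (f := fun d e => q (a, b, c, d, e)), dist_eq_ind]
      simp only [Fintype.sum_prod_type (α₁ := X1), Fintype.sum_prod_type (α₁ := X2), Fintype.sum_prod_type (α₁ := X3),
        Prod.mk.injEq, ind_and]
      have : ∀ x1 x2 x3, ∑ v : U1 × U2, q (x1, x2, x3, v) * (ind (x3 = c) * (ind (x1 = a) * ind (x2 = b))) =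
          (((∑ v, q (x1, x2, x3, v)) * ind (x3 = c)) * ind (x2 = b)) * ind (x1 = a) := by
        intro x1 x2 x3
        rw [← Finset.sum_mul]
        ring
      simp_rw [this, ← Finset.sum_mul]
      rw [sum_mul_ind (fun x1 => ∑ x2, (∑ x3, (∑ v, q (x1, x2, x3, v)) * ind (x3 = c)) * ind (x2 = b)),
        sum_mul_ind (fun x2 => ∑ x3, (∑ v, q (a, x2, x3, v)) * ind (x3 = c)),
        sum_mul_ind (fun x3 => (∑ v, q (a, b, x3, v)))]
    rw [e1, e2] at h1
    simp only [jq, k]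
    split_ifs with h
    · have h2 : p (a, b, c) = 0 := by
        rw [← e2]
        exact dist_mono_zero hq.1 (fun ω => (ω.2.2.1, ω.1, ω.2.1)) (fun v => v.2) (c, a, b) h
      have h3 : q (a, b, c, d, e) = 0 := by
        rw [← e1]
        exact dist_mono_zero hq.1 (fun ω => ((ω.2.2.2.1, ω.2.2.2.2), ω.2.2.1, ω.1, ω.2.1)) (fun v => v.2.2) ((d, e), c, a, b) h
      rw [h2, h3, zero_mul]
    · unfold cp
      field_simp
      rw [h1]
      ring

end kern
end TE

namespace TE

section block
variable {X1 X2 X3 U1 U2 : Type*} [Fintype X1] [Fintype X2] [Fintype X3] [Fintype U1] [Fintype U2]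
  [DecidableEq X1] [DecidableEq U1] [DecidableEq U2] [Nonempty X1] [Nonempty U1] [Nonempty U2]

/-- n-letter kernel -/
def kn (k : X1 → X2 → U1 × U2 → ℝ) (n : ℕ) (a : Fin n → X1) (b : Fin n → X2) (v : (Fin n → U1) × (Fin n → U2)) : ℝ :=
  ∏ t, k (a t) (b t) (v.1 t, v.2 t)

lemma prod_le_rpow {n : ℕ} (c : Fin n → ℝ) (h : ∀ t, 0 < c t) {s : ℝ} (hs : ∑ t, Real.logb 2 (c t) ≤ s) :
    ∏ t, c t ≤ 2 ^ s := by
  have e : ∏ t, c t = 2 ^ (∑ t, Real.logb 2 (c t)) := by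
    rw [Real.rpow_sum_of_pos (by norm_num)]
    exact Finset.prod_congr rfl fun t _ => (Real.rpow_logb (by norm_num) (by norm_num) (h t)).symm
  rw [e]
  exact Real.rpow_le_rpow_of_exponent_le (by norm_num) hs

lemma kfst (k : X1 → X2 → U1 × U2 → ℝ) (a b u) :
    ∑ v', k a b v' * ind (v'.1 = u) = ∑ u2, k a b (u, u2) := by
  rw [Fintype.sum_prod_type]
  simp_rw [← Finset.sum_mul]
  exact sum_mul_ind (fun u => ∑ u2, k a b (u, u2)) u

/-- conditional typicality of y given z -/
def SY {Ω α β : Type*} [Fintype Ω] [Fintype α] [Fintype β] (q : Ω → ℝ) (Y : Ω → α) (Z : Ω → β) {n : ℕ} (s : ℝ)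
    (y : Fin n → α) (z : Fin n → β) : Prop :=
  (∀ t, 0 < cp q Y Z (y t) (z t)) ∧ ∑ t, -Real.logb 2 (cp q Y Z (y t) (z t)) ≤ s

lemma SY_count {Ω α β : Type*} [Fintype Ω] [Fintype α] [Fintype β] {q : Ω → ℝ} (hq : IsPMF q) (Y : Ω → α) (Z : Ω → β)
    {n : ℕ} (s : ℝ) (z : Fin n → β) {I : Type*} [Fintype I] (φ : I → Fin n → α)
    (hφ : Function.Injective φ) : ∑ i, ind (SY q Y Z s (φ i) z) ≤ 2 ^ s :=
  count_le (fun t y => cp q Y Z y (z t)) (fun t y => cp_nonneg hq _ _ _ _) (fun t => sum_cp hq _ _ _) _ φ hφ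

/-- the log functional -/
def lgf {Ω α β : Type*} [Fintype Ω] [Fintype α] [Fintype β] (q : Ω → ℝ) (Y : Ω → α) (Z : Ω → β) (v : Ω) : ℝ :=
  -Real.logb 2 (cp q Y Z (Y v) (Z v))

lemma SY_of {Ω α β : Type*} [Fintype Ω] [Fintype α] [Fintype β] {q : Ω → ℝ} (hq : IsPMF q) (Y : Ω → α) (Z : Ω → β)
    {n : ℕ} {h δ : ℝ} (hh : condH q Y Z = h) (x : Fin n → Ω) (hx : ∀ t, 0 < q (x t))
    (hs : ∑ t, lgf q Y Z (x t) ≤ n * ((∑ a, q a * lgf q Y Z a) + δ)) :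
    SY q Y Z (n * (h + δ)) (fun t => Y (x t)) (fun t => Z (x t)) := by
  refine ⟨fun t => cp_pos hq Y Z _ (hx t), ?_⟩
  rw [← hh, ← expect_cp hq]
  exact hs

/-- kernel log functional -/
def lgk {β : Type*} (k : X1 → X2 → U1 × U2 → ℝ) (f : U1 × U2 → β) (v : X1 × X2 × X3 × U1 × U2) : ℝ :=
  Real.logb 2 (∑ v', k v.1 v.2.1 v' * ind (f v' = f v.2.2.2))

/-- kernel typicality -/
def TY {β : Type*} (k : X1 → X2 → U1 × U2 → ℝ) (f : U1 × U2 → β) {n : ℕ} (s : ℝ) (a : Fin n → X1) (b : Fin n → X2)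
    (u : Fin n → β) : Prop :=
  (∀ t, 0 < ∑ v', k (a t) (b t) v' * ind (f v' = u t)) ∧
    ∑ t, Real.logb 2 (∑ v', k (a t) (b t) v' * ind (f v' = u t)) ≤ s

lemma TY_of {β : Type*} [Fintype β] {p : X1 × X2 × X3 → ℝ} (hp : IsPMF p) {k : X1 → X2 → U1 × U2 → ℝ}
    (hk0 : ∀ a b v, 0 ≤ k a b v) (hk1 : ∀ a b, ∑ v, k a b v = 1) (f : U1 × U2 → β) {n : ℕ} {e δ : ℝ}
    (he : condH (jq p k) (fun v => f v.2.2.2) (fun v => (v.1, v.2.1)) = e)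
    (x : Fin n → X1 × X2 × X3 × U1 × U2) (hx : ∀ t, 0 < jq p k (x t))
    (hs : ∑ t, lgk k f (x t) ≤ n * ((∑ a, jq p k a * lgk k f a) + δ)) :
    TY k f (n * (-e + δ)) (fun t => (x t).1) (fun t => (x t).2.1) (fun t => f (x t).2.2.2) := by
  refine ⟨fun t => ?_, ?_⟩
  · have h1 := (jq_pos_marg hp hk0 _ (hx t)).2
    refine h1.trans_le ?_
    have h2 := Finset.single_le_sum (f := fun v' => k (x t).1 (x t).2.1 v' * ind (f v' = f (x t).2.2.2)) (s := Finset.univ)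
      (fun v _ => mul_nonneg (hk0 _ _ _) (ind_nonneg _)) (Finset.mem_univ (x t).2.2.2)
    refine le_trans (le_of_eq ?_) h2
    rw [ind_true (show f (x t).2.2.2 = f (x t).2.2.2 from rfl), mul_one]
  · rw [← he, ← expect_kern hp hk0 hk1 f]
    exact hs

/-- the nine functionals -/
def Fs (q : X1 × X2 × X3 × U1 × U2 → ℝ) (k : X1 → X2 → U1 × U2 → ℝ) (f12 f32 : X1 × X2 × X3 × U1 × U2 → ℝ) :
    Fin 9 → X1 × X2 × X3 × U1 × U2 → ℝ
  | 0 => lgf q (fun v => v.1) (fun v => v.2.1)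
  | 1 => lgf q (fun v => v.2.2.2.1) (fun v => v.1)
  | 2 => lgf q (fun v => (v.1, v.2.2.2)) (fun v => v.2.2.1)
  | 3 => lgf q (fun v => v.2.2.2) (fun v => (v.1, v.2.2.1))
  | 4 => lgf q (fun v => v.2.2.2.2) (fun v => (v.1, v.2.2.2.1, v.2.2.1))
  | 5 => lgk k (fun v => v.1)
  | 6 => lgk k (fun v => v)
  | 7 => f12
  | 8 => f32

/-- joint typicality -/
def Good (q : X1 × X2 × X3 × U1 × U2 → ℝ) (k : X1 → X2 → U1 × U2 → ℝ) (f12 f32 : X1 × X2 × X3 × U1 × U2 → ℝ) (δ : ℝ)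
    {n : ℕ} (x : Fin n → X1 × X2 × X3 × U1 × U2) : Prop :=
  (∀ t, 0 < q (x t)) ∧ ∀ i, ∑ t, Fs q k f12 f32 i (x t) ≤ n * ((∑ a, q a * Fs q k f12 f32 i a) + δ)

set_option maxHeartbeats 1000000 in
theorem ach_block {p : X1 × X2 × X3 → ℝ} (hp : IsPMF p) {k : X1 → X2 → U1 × U2 → ℝ}
    (hk0 : ∀ a b v, 0 ≤ k a b v) (hk1 : ∀ a b, ∑ v, k a b v = 1)
    (f12 f32 : X1 × X2 × X3 × U1 × U2 → ℝ) {δ η : ℝ} (hδ : 0 < δ) (hη : 0 < η)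
    {h2 h1 h30 h31 h32 e1 e2 : ℝ}
    (hh2 : condH (jq p k) (fun v => v.1) (fun v => v.2.1) = h2)
    (hh1 : condH (jq p k) (fun v => v.2.2.2.1) (fun v => v.1) = h1)
    (hh30 : condH (jq p k) (fun v => (v.1, v.2.2.2)) (fun v => v.2.2.1) = h30)
    (hh31 : condH (jq p k) (fun v => v.2.2.2) (fun v => (v.1, v.2.2.1)) = h31)
    (hh32 : condH (jq p k) (fun v => v.2.2.2.2) (fun v => (v.1, v.2.2.2.1, v.2.2.1)) = h32)
    (he1 : condH (jq p k) (fun v => v.2.2.2.1) (fun v => (v.1, v.2.1)) = e1)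
    (he2 : condH (jq p k) (fun v => v.2.2.2) (fun v => (v.1, v.2.1)) = e2) :
    ∃ N : ℕ, ∀ n ≥ N, 0 < n → ∀ m1 l1 m21 l2 m22 : ℕ,
    ∃ (h : (Fin n → X1) → Fin (m1 + 1)) (enc : (Fin n → X2) → Fin (m1 + 1) → Fin (m21 + 1) × Fin (m22 + 1))
      (dec2 : (Fin n → X2) → Fin (m1 + 1) → (Fin n → X1))
      (dec1 : (Fin n → X1) → Fin (m21 + 1) × Fin (m22 + 1) → (Fin n → U1))
      (dec3 : (Fin n → X3) → Fin (m1 + 1) → Fin (m21 + 1) × Fin (m22 + 1) → (Fin n → X1) × (Fin n → U1) × (Fin n → U2))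
      (sel : (Fin n → X1) → (Fin n → X2) → (Fin n → U1) × (Fin n → U2)),
      IT.pr (iidW p n) (fun ω => ¬ (
        dec2 (fun t => (ω t).2.1) (h (fun t => (ω t).1)) = (fun t => (ω t).1) ∧ 
        dec1 (fun t => (ω t).1) (enc (fun t => (ω t).2.1) (h (fun t => (ω t).1))) 
          = (sel (fun t => (ω t).1) (fun t => (ω t).2.1)).1 ∧
        dec3 (fun t => (ω t).2.2) (h (fun t => (ω t).1)) (enc (fun t => (ω t).2.1) (h (fun t => (ω t).1)))
          = (fun t => (ω t).1, (sel (fun t => (ω t).1) (fun t => (ω t).2.1)).1,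
            (sel (fun t => (ω t).1) (fun t => (ω t).2.1)).2) ∧
        ∑ t, f12 ((ω t).1, (ω t).2.1, (ω t).2.2, (sel (fun t => (ω t).1) (fun t => (ω t).2.1)).1 t,
            (sel (fun t => (ω t).1) (fun t => (ω t).2.1)).2 t) ≤ n * ((∑ v, jq p k v * f12 v) + δ) ∧
        ∑ t, f32 ((ω t).1, (ω t).2.1, (ω t).2.2, (sel (fun t => (ω t).1) (fun t => (ω t).2.1)).1 t,
            (sel (fun t => (ω t).1) (fun t => (ω t).2.1)).2 t) ≤ n * ((∑ v, jq p k v * f32 v) + δ))) ≤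
      2 ^ (n * (h2 + δ)) / (m1 + 1) + 4 * (η + l1 * 2 ^ (n * (-e1 + δ)) + (l1 + 1) * l2 * 2 ^ (n * (-e2 + δ))) + 
        2 * (η + 2 ^ (n * (h1 + δ)) / ((l1 + 1) * (m21 + 1)) +
        (2 ^ (n * (h30 + δ)) / ((m1 + 1) * ((l1 + 1) * (m21 + 1)) * ((l2 + 1) * (m22 + 1)))
       + 2 ^ (n * (h31 + δ)) / (((l1 + 1) * (m21 + 1)) * ((l2 + 1) * (m22 + 1)))
       + 2 ^ (n * (h32 + δ)) / ((l2 + 1) * (m22 + 1)))) := by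
  set q := jq p k with hqdef
  have hq : IsPMF q := isPMF_jq hp hk0 hk1
  obtain ⟨N, hN⟩ := wlln hq (Fs q k f12 f32) hδ hη
  refine ⟨N, fun n hn hn0 m1 l1 m21 l2 m22 => ?_⟩
  have hprob := hN n hn hn0
  obtain ⟨G, hGdef⟩ : ∃ G : (Fin n → X1) → (Fin n → X2) → (Fin n → X3) → (Fin n → U1) × (Fin n → U2) → Prop,
    G = fun a b c v => Good q k f12 f32 δ (fun t => (a t, b t, c t, v.1 t, v.2 t)) := ⟨_, rfl⟩
  obtain ⟨S2, hS2⟩ : ∃ S2 : (Fin n → X1) → (Fin n → X2) → Prop, S2 = fun a b =>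
    SY q (fun v => v.1) (fun v => v.2.1) (n * (h2 + δ)) a b := ⟨_, rfl⟩
  obtain ⟨S1, hS1⟩ : ∃ S1 : (Fin n → X1) → (Fin n → U1) → Prop, S1 = fun a u =>
    SY q (fun v => v.2.2.2.1) (fun v => v.1) (n * (h1 + δ)) u a := ⟨_, rfl⟩
  obtain ⟨S3, hS3⟩ : ∃ S3 : (Fin n → X3) → (Fin n → X1) → (Fin n → U1) → (Fin n → U2) → Prop, S3 = fun c a u v =>
    SY q (fun v => (v.1, v.2.2.2)) (fun v => v.2.2.1) (n * (h30 + δ)) (fun t => (a t, u t, v t)) c ∧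
    SY q (fun v => v.2.2.2) (fun v => (v.1, v.2.2.1)) (n * (h31 + δ)) (fun t => (u t, v t)) (fun t => (a t, c t)) ∧
    SY q (fun v => v.2.2.2.2) (fun v => (v.1, v.2.2.2.1, v.2.2.1)) (n * (h32 + δ)) v (fun t => (a t, u t, c t)) :=
    ⟨_, rfl⟩
  obtain ⟨Tc, hTc⟩ : ∃ Tc : (Fin n → X1) → (Fin n → X2) → (Fin n → U1) × (Fin n → U2) → Prop, Tc = fun a b v =>
    TY k (fun v => v.1) (n * (-e1 + δ)) a b v.1 ∧ TY k (fun v => v) (n * (-e2 + δ)) a b (fun t => (v.1 t, v.2 t)) :=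
    ⟨_, rfl⟩
  have hG2 : ∀ a b c v, G a b c v → S2 a b := by
    intro a b c v hg
    rw [hGdef] at hg
    rw [hS2]
    exact SY_of hq (fun v => v.1) (fun v => v.2.1) hh2 _ hg.1 (hg.2 0)
  have hG1 : ∀ a b c v, G a b c v → S1 a v.1 := by
    intro a b c v hg
    rw [hGdef] at hg
    rw [hS1]
    exact SY_of hq (fun v => v.2.2.2.1) (fun v => v.1) hh1 _ hg.1 (hg.2 1)
  have hG3 : ∀ a b c v, G a b c v → S3 c a v.1 v.2 := by
    intro a b c v hg
    rw [hGdef] at hg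
    rw [hS3]
    exact ⟨SY_of hq (fun v => (v.1, v.2.2.2)) (fun v => v.2.2.1) hh30 _ hg.1 (hg.2 2),
      SY_of hq (fun v => v.2.2.2) (fun v => (v.1, v.2.2.1)) hh31 _ hg.1 (hg.2 3),
      SY_of hq (fun v => v.2.2.2.2) (fun v => (v.1, v.2.2.2.1, v.2.2.1)) hh32 _ hg.1 (hg.2 4)⟩
  have hGc : ∀ a b c v, G a b c v → Tc a b v := by
    intro a b c v hg
    rw [hGdef] at hg
    rw [hTc]
    exact ⟨TY_of hp hk0 hk1 (fun v => v.1) he1 _ hg.1 (hg.2 5), TY_of hp hk0 hk1 (fun v => v) he2 _ hg.1 (hg.2 6)⟩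
  have hkn0 : ∀ a b v, 0 ≤ kn k n a b v := fun a b v => Finset.prod_nonneg fun t _ => hk0 _ _ _
  have hkn1 : ∀ a b, ∑ v, kn k n a b v = 1 := by
    intro a b
    rw [Fintype.sum_prod_type]
    have := sum_pi_prod (fun x : Fin n → U1 × U2 => ∏ t, k (a t) (b t) (x t))
    rw [sum_prod_fun] at this
    simp only [kn]
    rw [← this]
    simp [hk1]
  have hP1 : ∑ a : Fin n → X1, ∑ b : Fin n → X2, ∑ c : Fin n → X3, iidW p n (fun t => (a t, b t, c t)) = 1 := by
    rw [← (isPMF_iidW hp n).2, sum_pi_prod]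
    refine Finset.sum_congr rfl fun a _ => ?_
    rw [sum_pi_prod (fun x : Fin n → X2 × X3 => iidW p n (fun t => (a t, x t)))]
  have hηs : ∑ a : Fin n → X1, ∑ b : Fin n → X2, ∑ c : Fin n → X3, iidW p n (fun t => (a t, b t, c t)) *
      ∑ v, kn k n a b v * ind (¬ G a b c v) ≤ η := by
    refine le_trans (le_of_eq ?_) hprob
    rw [pr_eq_ind, sum_pi_prod]
    refine Finset.sum_congr rfl fun a _ => ?_
    rw [sum_pi_prod]
    refine Finset.sum_congr rfl fun b _ => ?_
    rw [sum_pi_prod]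
    refine Finset.sum_congr rfl fun c _ => ?_
    rw [sum_pi_prod, Fintype.sum_prod_type, Finset.mul_sum]
    refine Finset.sum_congr rfl fun u _ => ?_
    rw [Finset.mul_sum]
    refine Finset.sum_congr rfl fun v _ => ?_
    rw [← mul_assoc]
    congr 1
    · simp only [iidW, kn, hqdef, jq]
      rw [Finset.prod_mul_distrib]
    · rw [hGdef]
      rfl
  have c2 : ∀ b, ∑ a, ind (S2 a b) ≤ (2 : ℝ) ^ (n * (h2 + δ)) := by
    intro b
    rw [hS2]
    exact SY_count hq (fun v => v.1) (fun v => v.2.1) _ b (fun y => y) (fun _ _ h => h)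
  have c1 : ∀ a, ∑ u, ind (S1 a u) ≤ (2 : ℝ) ^ (n * (h1 + δ)) := by
    intro a
    rw [hS1]
    exact SY_count hq (fun v => v.2.2.2.1) (fun v => v.1) _ a (fun y => y) (fun _ _ h => h)
  have c30 : ∀ c, ∑ i : (Fin n → X1) × (Fin n → U1) × (Fin n → U2), ind (S3 c i.1 i.2.1 i.2.2) ≤ (2 : ℝ) ^ (n * (h30 + δ)) := by
    intro c
    rw [hS3]
    refine le_trans (Finset.sum_le_sum fun i _ => ind_mono (fun hs => hs.1)) 
      (SY_count hq (fun v => (v.1, v.2.2.2)) (fun v => v.2.2.1) _ c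
      (fun i : (Fin n → X1) × (Fin n → U1) × (Fin n → U2) => fun t => (i.1 t, i.2.1 t, i.2.2 t)) ?_)
    rintro ⟨x, y, z⟩ ⟨x', y', z'⟩ hxy
    have := fun t => congrFun hxy t
    simp only [Prod.mk.injEq] at this ⊢
    exact ⟨funext fun t => (this t).1, funext fun t => (this t).2.1, funext fun t => (this t).2.2⟩
  have c31 : ∀ c a, ∑ i : (Fin n → U1) × (Fin n → U2), ind (S3 c a i.1 i.2) ≤ (2 : ℝ) ^ (n * (h31 + δ)) := by
    intro c a
    rw [hS3]
    refine le_trans (Finset.sum_le_sum fun i _ => ind_mono (fun hs => hs.2.1)) 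
      (SY_count hq (fun v => v.2.2.2) (fun v => (v.1, v.2.2.1)) _ (fun t => (a t, c t))
      (fun i : (Fin n → U1) × (Fin n → U2) => fun t => (i.1 t, i.2 t)) ?_)
    rintro ⟨y, z⟩ ⟨y', z'⟩ hxy
    have := fun t => congrFun hxy t
    simp only [Prod.mk.injEq] at this ⊢
    exact ⟨funext fun t => (this t).1, funext fun t => (this t).2⟩
  have c32 : ∀ c a u, ∑ v2, ind (S3 c a u v2) ≤ (2 : ℝ) ^ (n * (h32 + δ)) := by
    intro c a u
    rw [hS3]
    exact le_trans (Finset.sum_le_sum fun i _ => ind_mono (fun hs => hs.2.2)) 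
      (SY_count hq (fun v => v.2.2.2.2) (fun v => (v.1, v.2.2.2.1, v.2.2.1)) _ (fun t => (a t, u t, c t))
       (fun i : (Fin n → U2) => i) (fun _ _ h => h))
  have ck1 : ∀ a b u, ∑ v2, kn k n a b (u, v2) * ind (Tc a b (u, v2)) ≤ (2 : ℝ) ^ (n * (-e1 + δ)) := by
    intro a b u
    rw [hTc]
    by_cases ht : TY k (fun v => v.1) (n * (-e1 + δ)) a b u
    · calc _ ≤ ∑ v2, kn k n a b (u, v2) := Finset.sum_le_sum fun v2 _ =>
            mul_le_of_le_one_right (hkn0 _ _ _) (ind_le_one _)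
        _ = ∏ t, ∑ v', k (a t) (b t) v' * ind (v'.1 = u t) := by
            simp only [kn]
            rw [sum_prod_fun (fun t u2 => k (a t) (b t) (u t, u2))]
            exact Finset.prod_congr rfl fun t _ => (kfst _ _ _ _).symm
        _ ≤ _ := prod_le_rpow _ ht.1 ht.2
    · rw [Finset.sum_eq_zero]
      · positivity
      · intro v2 _
        rw [ind_false (fun h => ht h.1), mul_zero]
  have ck2 : ∀ a b v, kn k n a b v * ind (Tc a b v) ≤ (2 : ℝ) ^ (n * (-e2 + δ)) := by
    intro a b v
    rw [hTc]
    by_cases ht : TY k (fun v => v) (n * (-e2 + δ)) a b (fun t => (v.1 t, v.2 t))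
    · refine (mul_le_of_le_one_right (hkn0 _ _ _) (ind_le_one _)).trans (le_trans (le_of_eq ?_) (prod_le_rpow _ ht.1 ht.2))
      unfold kn
      exact Finset.prod_congr rfl fun t _ => (sum_mul_ind (k (a t) (b t)) (v.1 t, v.2 t)).symm
    · rw [ind_false (fun h => ht h.2), mul_zero]
      positivity
  obtain ⟨P, hP⟩ : ∃ P : (Fin n → X1) → (Fin n → X2) → (Fin n → X3) → ℝ,
    P = fun a b c => iidW p n (fun t => (a t, b t, c t)) := ⟨_, rfl⟩
  have hP0 : ∀ a b c, 0 ≤ P a b c := by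
    intro a b c
    rw [hP]
    exact (isPMF_iidW hp n).1 _
  have hP1' : ∑ a, ∑ b, ∑ c, P a b c = 1 := by
    rw [hP]
    exact hP1
  have hηs' : ∑ a, ∑ b, ∑ c, P a b c * ∑ v, kn k n a b v * ind (¬ G a b c v) ≤ η := by
    rw [hP]
    exact hηs
  have os := oneshot (A1 := Fin n → X1) (A2 := Fin n → X2) (A3 := Fin n → X3) (V1 := Fin n → U1) (V2 := Fin n → U2)
    P hP0 hP1' (kn k n) hkn0 hkn1 G S2 S1 S3 Tc hG2 hG1 hG3 hGc m1 l1 m21 l2 m22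
    c2 c1 c30 c31 c32 ck1 ck2 (Real.rpow_nonneg (by norm_num) _) (Real.rpow_nonneg (by norm_num) _) hηs'
  obtain ⟨h, enc, dec2, dec1, dec3, sel, hmain⟩ := os
  rw [hP] at hmain
  refine ⟨h, enc, dec2, dec1, dec3, sel, le_trans ?_ hmain⟩
  rw [pr_eq_ind, sum_pi_prod]
  refine Finset.sum_le_sum fun a _ => ?_
  rw [sum_pi_prod]
  refine Finset.sum_le_sum fun b _ => ?_
  refine Finset.sum_le_sum fun c _ => ?_
  refine mul_le_mul_of_nonneg_left (ind_mono ?_) ((isPMF_iidW hp n).1 _)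
  rw [not_imp_not]
  rintro ⟨g1, g2, g3, g4⟩
  rw [hGdef] at g4
  exact ⟨g1, g2, g3, g4.2 7, g4.2 8⟩

end block
end TE

namespace TE

section entfacts
variable {X1 X2 X3 U1 U2 : Type*} [Fintype X1] [Fintype X2] [Fintype X3] [Fintype U1] [Fintype U2]

set_option maxHeartbeats 2000000 in
/-- entropy relations used for achievability -/
lemma ent_facts {q : X1 × X2 × X3 × U1 × U2 → ℝ} (hq : IsPMF q)
    (hM : IT.condMutInfo q (fun v => (v.2.2.2.1, v.2.2.2.2)) (fun v => v.2.2.1)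
          (fun v => (v.1, v.2.1)) = 0) :
    0 ≤ condH q (fun v => v.2.2.2.1) (fun v => (v.1, v.2.1)) ∧
    condH q (fun v => v.2.2.2.1) (fun v => (v.1, v.2.1)) ≤ condH q (fun v => v.2.2.2) (fun v => (v.1, v.2.1)) ∧
    condH q (fun v => v.2.2.2.1) (fun v => v.1) - condH q (fun v => v.2.2.2.1) (fun v => (v.1, v.2.1)) =
      IT.condMutInfo q (fun v => v.2.2.2.1) (fun v => v.2.1) (fun v => v.1) ∧
    condH q (fun v => v.2.2.2.2) (fun v => (v.1, v.2.2.2.1, v.2.2.1)) - 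
      (condH q (fun v => v.2.2.2) (fun v => (v.1, v.2.1)) - condH q (fun v => v.2.2.2.1) (fun v => (v.1, v.2.1))) =
      IT.condMutInfo q (fun v => v.2.2.2.2) (fun v => v.2.1) (fun v => (v.2.2.2.1, v.1, v.2.2.1)) ∧
    condH q (fun v => v.2.2.2) (fun v => (v.1, v.2.2.1)) - condH q (fun v => v.2.2.2) (fun v => (v.1, v.2.1)) =
      IT.condMutInfo q (fun v => (v.2.2.2.1, v.2.2.2.2)) (fun v => v.2.1) (fun v => (v.1, v.2.2.1)) ∧
    condH q (fun v => (v.1, v.2.2.2)) (fun v => v.2.2.1) - condH q (fun v => v.2.2.2) (fun v => (v.1, v.2.1)) =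
      IT.condH q (fun v => v.1) (fun v => v.2.2.1) +
      IT.condMutInfo q (fun v => (v.2.2.2.1, v.2.2.2.2)) (fun v => v.2.1) (fun v => (v.1, v.2.2.1)) ∧
    IT.condMutInfo q (fun v => (v.2.2.2.1, v.2.2.2.2)) (fun v => v.2.1) (fun v => (v.1, v.2.2.1)) ≤
      IT.condMutInfo q (fun v => v.2.2.2.1) (fun v => v.2.1) (fun v => v.1) + 
      IT.condMutInfo q (fun v => v.2.2.2.2) (fun v => v.2.1) (fun v => (v.2.2.2.1, v.1, v.2.2.1)) ∧
    IT.condMutInfo q (fun v => (v.2.2.2.1, v.2.2.2.2)) (fun v => v.2.1) (fun v => (v.1, v.2.2.1)) =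
      IT.condMutInfo q (fun v => v.2.2.2.1) (fun v => v.2.1) (fun v => v.1) + 
      IT.condMutInfo q (fun v => v.2.2.2.2) (fun v => v.2.1) (fun v => (v.2.2.2.1, v.1, v.2.2.1)) - 
      IT.condMutInfo q (fun v => v.2.2.2.1) (fun v => v.2.2.1) (fun v => v.1) := by
  have hM1 := H_submod (fun v : X1 × X2 × X3 × U1 × U2 => v.2.2.2.2) (fun v => v.2.2.1) (fun v => (v.1, v.2.1, v.2.2.2.1)) hq
  have hM2 := H_submod (fun v : X1 × X2 × X3 × U1 × U2 => v.2.2.2.1) (fun v => v.2.2.1) (fun v => (v.1, v.2.1)) hq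
  have hM3 := H_submod (fun v : X1 × X2 × X3 × U1 × U2 => v.2.2.2.1) (fun v => v.2.2.1) (fun v => v.1) hq
  have m0 := H_mono hq.1 (fun v => (v.1, v.2.1)) (fun v => (v.2.2.2.1, v.1, v.2.1)) (by simp +contextual)
  have m1 := H_mono hq.1 (fun v => (v.2.2.2.1, v.1, v.2.1)) (fun v => (v.2.2.2, v.1, v.2.1)) (by simp +contextual)
  simp only [condMutInfo_def, condH] at *
  have c1 := H_congr hq.1 (fun v => (v.2.1, v.1)) (fun v => (v.1, v.2.1)) (by simp; tauto)
  have c2 := H_congr hq.1 (fun v => (v.2.2.2.1, v.2.1, v.1)) (fun v => (v.2.2.2.1, v.1, v.2.1)) (by simp; tauto)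
  have c3 := H_congr hq.1 (fun v => (v.2.2.2.2, v.2.2.2.1, v.1, v.2.2.1)) (fun v => (v.2.2.2, v.1, v.2.2.1)) (by simp [Prod.ext_iff]; tauto)
  have c4 := H_congr hq.1 (fun v => (v.2.2.2.2, v.1, v.2.2.2.1, v.2.2.1)) (fun v => (v.2.2.2, v.1, v.2.2.1)) (by simp [Prod.ext_iff]; tauto)
  have c5 := H_congr hq.1 (fun v => ((v.2.2.2.1, v.2.2.2.2), v.1, v.2.2.1)) (fun v => (v.2.2.2, v.1, v.2.2.1)) (by simp [Prod.ext_iff])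
  have c6 := H_congr hq.1 (fun v => ((v.1, v.2.2.2), v.2.2.1)) (fun v => (v.2.2.2, v.1, v.2.2.1)) (by simp [Prod.ext_iff]; tauto)
  have c7 := H_congr hq.1 (fun v => (v.2.1, v.2.2.2.1, v.1, v.2.2.1)) (fun v => (v.2.2.2.1, v.2.2.1, v.1, v.2.1)) (by simp [Prod.ext_iff]; tauto)
  have c8 := H_congr hq.1 (fun v => (v.2.2.2.2, v.2.1, v.2.2.2.1, v.1, v.2.2.1)) (fun v => ((v.2.2.2.1, v.2.2.2.2), v.2.2.1, v.1, v.2.1)) (by simp [Prod.ext_iff]; tauto)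
  have c9 := H_congr hq.1 (fun v => ((v.2.2.2.1, v.2.2.2.2), v.2.1, v.1, v.2.2.1)) (fun v => ((v.2.2.2.1, v.2.2.2.2), v.2.2.1, v.1, v.2.1)) (by simp [Prod.ext_iff]; tauto)
  have c10 := H_congr hq.1 (fun v => (v.2.1, v.1, v.2.2.1)) (fun v => (v.2.2.1, v.1, v.2.1)) (by simp [Prod.ext_iff]; tauto)
  have c11 := H_congr hq.1 (fun v => (v.1, v.2.2.2.1, v.2.2.1)) (fun v => (v.2.2.2.1, v.2.2.1, v.1)) (by simp [Prod.ext_iff]; tauto)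
  have c12 := H_congr hq.1 (fun v => (v.2.2.2.1, v.1, v.2.2.1)) (fun v => (v.2.2.2.1, v.2.2.1, v.1)) (by simp [Prod.ext_iff]; tauto)
  have c13 := H_congr hq.1 (fun v => (v.1, v.2.2.1)) (fun v => (v.2.2.1, v.1)) (by simp [Prod.ext_iff]; tauto)
  have c14 := H_congr hq.1 (fun v => ((v.2.2.2.1, v.2.2.2.2), v.1, v.2.1)) (fun v => (v.2.2.2, v.1, v.2.1)) (by simp [Prod.ext_iff])
  have c15 := H_congr hq.1 (fun v => (v.2.2.2.2, v.1, v.2.1, v.2.2.2.1)) (fun v => (v.2.2.2, v.1, v.2.1)) (by simp [Prod.ext_iff]; tauto)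
  have c16 := H_congr hq.1 (fun v => (v.1, v.2.1, v.2.2.2.1)) (fun v => (v.2.2.2.1, v.1, v.2.1)) (by simp [Prod.ext_iff]; tauto)
  have c17 := H_congr hq.1 (fun v => (v.2.2.2.2, v.2.2.1, v.1, v.2.1, v.2.2.2.1)) (fun v => ((v.2.2.2.1, v.2.2.2.2), v.2.2.1, v.1, v.2.1)) (by simp [Prod.ext_iff]; tauto)
  have c18 := H_congr hq.1 (fun v => (v.2.2.1, v.1, v.2.1, v.2.2.2.1)) (fun v => (v.2.2.2.1, v.2.2.1, v.1, v.2.1)) (by simp [Prod.ext_iff]; tauto)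
  rw [c14] at hM
  rw [c15, c16, c17, c18] at hM1
  rw [c1, c2, c3, c4, c5, c6, c7, c8, c9, c10, c11, c12, c13]
  refine ⟨?_, ?_, ?_, ?_, ?_, ?_, ?_, ?_⟩ <;> linarith

end entfacts
end TE

namespace TE

lemma fl_lt (x : ℝ) : (2 : ℝ) ^ x ≤ (⌊(2 : ℝ) ^ x⌋₊ : ℝ) + 1 := (Nat.lt_floor_add_one _).le

lemma fl_le (x : ℝ) : (⌊(2 : ℝ) ^ x⌋₊ : ℝ) ≤ (2 : ℝ) ^ x := Nat.floor_le (Real.rpow_nonneg (by norm_num) _)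

lemma fl_le2 {x : ℝ} (hx : 0 ≤ x) : (⌊(2 : ℝ) ^ x⌋₊ : ℝ) + 1 ≤ 2 * (2 : ℝ) ^ x := by
  have := fl_le x
  have := Real.one_le_rpow (x := 2) (by norm_num) hx
  linarith

lemma div_bd {x y z D : ℝ} (hD : 2 ^ y ≤ D) (h : x - y ≤ z) : (2 : ℝ) ^ x / D ≤ 2 ^ z := by
  have hy : (0 : ℝ) < 2 ^ y := Real.rpow_pos_of_pos (by norm_num) _
  calc (2 : ℝ) ^ x / D ≤ 2 ^ x / 2 ^ y := div_le_div_of_nonneg_left (Real.rpow_nonneg (by norm_num) _) hy hD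
    _ = 2 ^ (x - y) := (Real.rpow_sub (by norm_num) _ _).symm
    _ ≤ _ := Real.rpow_le_rpow_of_exponent_le (by norm_num) h

lemma mul_bd {x y a b : ℝ} (h1 : 2 ^ x ≤ a) (h2 : 2 ^ y ≤ b) : (2 : ℝ) ^ (x + y) ≤ a * b := by
  rw [Real.rpow_add (by norm_num)]
  exact mul_le_mul h1 h2 (Real.rpow_nonneg (by norm_num) _) ((Real.rpow_nonneg (by norm_num) _).trans h1)

lemma logb_fl {x : ℝ} (hx : 0 ≤ x) : Real.logb 2 ((⌊(2 : ℝ) ^ x⌋₊ : ℝ) + 1) ≤ x + 1 := by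
  rw [Real.logb_le_iff_le_rpow (by norm_num) (by positivity), Real.rpow_add (by norm_num)]
  have := fl_le2 hx
  simp only [Real.rpow_one]
  linarith

lemma ach_num {n δ η h2 h1 h30 h31 h32 e1 e2 R1 R2 : ℝ} (hn : 0 ≤ n) (hδ : 0 < δ) (he1 : 0 ≤ e1)
    (hh2 : h2 ≤ R1) (hh20 : 0 ≤ h2) (hA : 0 ≤ h1 - e1) (hB : 0 ≤ h32 - (e2 - e1))
    (hR2 : (h1 - e1) + (h32 - (e2 - e1)) ≤ R2) (h31' : h31 - e2 ≤ R2) (h30' : h30 - e2 ≤ R1 + R2) :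
    ∃ m1 l1 m21 l2 m22 : ℕ, 
      2 ^ (n * (h2 + δ)) / (m1 + 1) + 4 * (η + l1 * 2 ^ (n * (-e1 + δ)) + (l1 + 1) * l2 * 2 ^ (n * (-e2 + δ))) + 
        2 * (η + 2 ^ (n * (h1 + δ)) / ((l1 + 1) * (m21 + 1)) +
        (2 ^ (n * (h30 + δ)) / ((m1 + 1) * ((l1 + 1) * (m21 + 1)) * ((l2 + 1) * (m22 + 1)))
       + 2 ^ (n * (h31 + δ)) / (((l1 + 1) * (m21 + 1)) * ((l2 + 1) * (m22 + 1)))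
       + 2 ^ (n * (h32 + δ)) / ((l2 + 1) * (m22 + 1)))) ≤ 21 * (2 : ℝ) ^ (-(n * δ)) + 6 * η ∧
      Real.logb 2 (m1 + 1) ≤ n * (R1 + 6 * δ) + 1 ∧
      Real.logb 2 ((m21 + 1) * (m22 + 1)) ≤ n * (R2 + 10 * δ) + 2 := by
  have hnδ : 0 ≤ n * δ := mul_nonneg hn hδ.le
  have a1 := mul_le_mul_of_nonneg_left hh2 hn
  have a2 := mul_le_mul_of_nonneg_left hR2 hn
  have a3 := mul_le_mul_of_nonneg_left h31' hn
  have a4 := mul_le_mul_of_nonneg_left h30' hn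
  have a5 := mul_nonneg hn hA
  have a6 := mul_nonneg hn hB
  have a7 := mul_nonneg hn he1
  have a8 := mul_nonneg hn hh20
  have b1 := fl_lt (n * (R1 + 6 * δ))
  have b2 := fl_lt (n * (e1 - 2 * δ))
  have b3 := fl_lt (n * ((h1 - e1) + 4 * δ))
  have b4 := fl_lt (n * (e2 - e1 - 2 * δ))
  have b5 := fl_lt (n * (R2 - (h1 - e1) + 6 * δ))
  refine ⟨⌊(2 : ℝ) ^ (n * (R1 + 6 * δ))⌋₊, ⌊(2 : ℝ) ^ (n * (e1 - 2 * δ))⌋₊, ⌊(2 : ℝ) ^ (n * ((h1 - e1) + 4 * δ))⌋₊,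
    ⌊(2 : ℝ) ^ (n * (e2 - e1 - 2 * δ))⌋₊, ⌊(2 : ℝ) ^ (n * (R2 - (h1 - e1) + 6 * δ))⌋₊, ?_, ?_, ?_⟩
  · have t1 := div_bd (x := n * (h2 + δ)) (z := -(n * δ)) b1 (by linarith)
    have t4 := div_bd (x := n * (h1 + δ)) (z := -(n * δ)) (mul_bd b2 b3) (by linarith)
    have t5 := div_bd (x := n * (h30 + δ)) (z := -(n * δ)) (mul_bd (mul_bd b1 (mul_bd b2 b3)) (mul_bd b4 b5)) (by linarith)
    have t6 := div_bd (x := n * (h31 + δ)) (z := -(n * δ)) (mul_bd (mul_bd b2 b3) (mul_bd b4 b5)) (by linarith)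
    have t7 := div_bd (x := n * (h32 + δ)) (z := -(n * δ)) (mul_bd b4 b5) (by linarith)
    have t2 : (⌊(2 : ℝ) ^ (n * (e1 - 2 * δ))⌋₊ : ℝ) * 2 ^ (n * (-e1 + δ)) ≤ 2 ^ (-(n * δ)) := by
      refine (mul_le_mul_of_nonneg_right (fl_le _) (Real.rpow_nonneg (by norm_num) _)).trans (le_of_eq ?_)
      rw [← Real.rpow_add (by norm_num)]
      congr 1
      ring
    have t3 : ((⌊(2 : ℝ) ^ (n * (e1 - 2 * δ))⌋₊ : ℝ) + 1) * ⌊(2 : ℝ) ^ (n * (e2 - e1 - 2 * δ))⌋₊ * 2 ^ (n * (-e2 + δ)) 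
        ≤ 2 * 2 ^ (-(n * δ)) := by
      have u1 : (⌊(2 : ℝ) ^ (n * (e1 - 2 * δ))⌋₊ : ℝ) + 1 ≤ 2 * 2 ^ (n * e1) := by
        have := fl_le (n * (e1 - 2 * δ))
        have := Real.one_le_rpow (x := 2) (by norm_num) a7
        have := Real.rpow_le_rpow_of_exponent_le (x := 2) (by norm_num) (show n * (e1 - 2 * δ) ≤ n * e1 by linarith)
        linarith
      have u2 := mul_le_mul u1 (fl_le (n * (e2 - e1 - 2 * δ))) (by positivity) (by positivity)
      refine (mul_le_mul_of_nonneg_right u2 (Real.rpow_nonneg (by norm_num) _)).trans (le_of_eq ?_)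
      rw [mul_assoc, mul_assoc, ← Real.rpow_add (by norm_num), ← Real.rpow_add (by norm_num)]
      congr 2
      ring
    linarith
  · exact logb_fl (by linarith)
  · rw [Real.logb_mul (by positivity) (by positivity)]
    have c1 := logb_fl (x := n * ((h1 - e1) + 4 * δ)) (by linarith)
    have c2 := logb_fl (x := n * (R2 - (h1 - e1) + 6 * δ)) (by linarith)
    linarith

lemma dist_bound {Ω : Type*} [Fintype Ω] {w : Ω → ℝ} (hw : IsPMF w) {n : ℕ} (hn : 0 < n) (F : Ω → Fin n → ℝ) {M c β : ℝ}
    (hc : 0 ≤ c) (hF : ∀ ω t, F ω t ≤ M) (hM : 0 ≤ M) (E : Ω → Prop) (hE : IT.pr w (fun ω => ¬ E ω) ≤ β)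
    (h : ∀ ω, E ω → ∑ t, F ω t ≤ n * c) :
    (1 / (n : ℝ)) * ∑ t, IT.expect w (fun ω => F ω t) ≤ c + M * β := by
  have hn' : (0 : ℝ) < n := by exact_mod_cast hn
  rw [one_div, inv_mul_le_iff₀ hn']
  unfold IT.expect
  rw [Finset.sum_comm]
  simp_rw [← Finset.mul_sum]
  rw [pr_eq_ind] at hE
  have h1 : ∀ ω, w ω * ∑ t, F ω t ≤ w ω * (n * c) + n * M * (w ω * ind (¬ E ω)) := by
    intro ω
    by_cases hω : E ω
    · rw [ind_false (not_not.2 hω)]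
      simpa using mul_le_mul_of_nonneg_left (h ω hω) (hw.1 ω)
    · rw [ind_true hω, mul_one]
      have : ∑ t, F ω t ≤ n * M := by
        refine (Finset.sum_le_sum fun t _ => hF ω t).trans ?_
        simp
      have := mul_le_mul_of_nonneg_left this (hw.1 ω)
      have := mul_nonneg (hw.1 ω) (mul_nonneg hn'.le hc)
      linarith
  refine (Finset.sum_le_sum fun ω _ => h1 ω).trans ?_
  rw [Finset.sum_add_distrib, ← Finset.sum_mul, ← Finset.mul_sum, hw.2]
  have := mul_le_mul_of_nonneg_left hE (mul_nonneg hn'.le hM)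
  linarith

lemma pr_mono {Ω : Type*} [Fintype Ω] {w : Ω → ℝ} (hw : ∀ ω, 0 ≤ w ω) {E F : Ω → Prop} (h : ∀ ω, E ω → F ω) :
    IT.pr w E ≤ IT.pr w F := by
  rw [pr_eq_ind, pr_eq_ind]
  exact Finset.sum_le_sum fun ω _ => mul_le_mul_of_nonneg_left (ind_mono (h ω)) (hw ω)

end TE

namespace TE

section achdef
variable {X1 X2 X3 Xh2 : Type} [Fintype X1] [Fintype X2] [Fintype X3] [Fintype Xh2]

/-- achievability -/
def Ach (p : X1 × X2 × X3 → ℝ) (d2 : X2 → Xh2 → ℝ) (R1 R2 D12 D32 : ℝ) : Prop :=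
    (∀ ε > (0 : ℝ), ∃ (n K : ℕ), 0 < n ∧ ∃ m1 m2 : Fin K → ℕ,
      (∀ l, 0 < m1 l) ∧ (∀ l, 0 < m2 l) ∧
      ∃ (J1 : (l : Fin K) → (Fin n → X1 × X2 × X3) → Fin (m1 l))
        (J2 : (l : Fin K) → (Fin n → X1 × X2 × X3) → Fin (m2 l))
        (g12 : (Fin n → X1) → ((l : Fin K) → Fin (m2 l)) → Fin n → Xh2)
        (g21 : (Fin n → X2) → ((l : Fin K) → Fin (m1 l)) → Fin n → X1)
        (g31 : (Fin n → X3) → ((l : Fin K) → Fin (m1 l)) → ((l : Fin K) → Fin (m2 l)) → Fin n → X1)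
        (g32 : (Fin n → X3) → ((l : Fin K) → Fin (m1 l)) → ((l : Fin K) → Fin (m2 l)) → Fin n → Xh2),
        -- encoder causality
        (∀ l : Fin K, ∃ f : (Fin n → X1) →
            ((k : Fin K) → k.val < l.val → Fin (m2 k)) → Fin (m1 l),
          ∀ ω, J1 l ω = f (fun t => (ω t).1) (fun k _ => J2 k ω)) ∧
        (∀ l : Fin K, ∃ f : (Fin n → X2) →
            ((k : Fin K) → k.val ≤ l.val → Fin (m1 k)) → Fin (m2 l),
          ∀ ω, J2 l ω = f (fun t => (ω t).2.1) (fun k _ => J1 k ω)) ∧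
        -- rates
        (1 / (n : ℝ)) * ∑ l, Real.logb 2 (m1 l) ≤ R1 + ε ∧
        (1 / (n : ℝ)) * ∑ l, Real.logb 2 (m2 l) ≤ R2 + ε ∧
        -- node 1 reconstructs X₂ⁿ within distortion D12
        (1 / (n : ℝ)) * ∑ t : Fin n, IT.expect (iidW p n)
            (fun ω => d2 (ω t).2.1
              (g12 (fun s => (ω s).1) (fun l => J2 l ω) t)) ≤ D12 + ε ∧
        -- node 2 reconstructs X₁ⁿ losslessly
        IT.pr (iidW p n)
          (fun ω => (fun t => g21 (fun s => (ω s).2.1) (fun l => J1 l ω) t) ≠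
            fun t => (ω t).1) ≤ ε ∧
        -- node 3 reconstructs X₁ⁿ losslessly
        IT.pr (iidW p n)
          (fun ω => (fun t => g31 (fun s => (ω s).2.2) (fun l => J1 l ω) (fun l => J2 l ω) t) ≠
            fun t => (ω t).1) ≤ ε ∧
        -- node 3 reconstructs X₂ⁿ within distortion D32
        (1 / (n : ℝ)) * ∑ t : Fin n, IT.expect (iidW p n)
            (fun ω => d2 (ω t).2.1
              (g32 (fun s => (ω s).2.2) (fun l => J1 l ω) (fun l => J2 l ω) t)) ≤ D32 + ε)

/-- single-letter region -/
def Reg (p : X1 × X2 × X3 → ℝ) (d2 : X2 → Xh2 → ℝ) (R1 R2 D12 D32 : ℝ) : Prop :=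
    (∃ u1 u2 : ℕ, u1 ≤ Fintype.card X1 * Fintype.card X2 + 2 ∧
      u2 ≤ Fintype.card X1 * Fintype.card X2 * u1 + 1 ∧
      ∃ q : X1 × X2 × X3 × Fin u1 × Fin u2 → ℝ, IsPMF q ∧
        (∀ a b c, (∑ d : Fin u1, ∑ e : Fin u2, q (a, b, c, d, e)) = p (a, b, c)) ∧
        -- Markov chain (U1,U2) -∘- (X1,X2) -∘- X3
        IT.condMutInfo q (fun v => (v.2.2.2.1, v.2.2.2.2)) (fun v => v.2.2.1)
          (fun v => (v.1, v.2.1)) = 0 ∧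
        ∃ (g32 : X1 → X3 → Fin u1 → Fin u2 → Xh2) (g12 : X1 → Fin u1 → Xh2),
          IT.expect q (fun v => d2 v.2.1 (g32 v.1 v.2.2.1 v.2.2.2.1 v.2.2.2.2)) ≤ D32 ∧
          IT.expect q (fun v => d2 v.2.1 (g12 v.1 v.2.2.2.1)) ≤ D12 ∧
          IT.condH q (fun v => v.1) (fun v => v.2.1) ≤ R1 ∧
          IT.condMutInfo q (fun v => v.2.2.2.1) (fun v => v.2.1) (fun v => v.1) +
            IT.condMutInfo q (fun v => v.2.2.2.2) (fun v => v.2.1)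
              (fun v => (v.2.2.2.1, v.1, v.2.2.1)) ≤ R2 ∧
          IT.condH q (fun v => v.1) (fun v => v.2.2.1) +
            IT.condMutInfo q (fun v => (v.2.2.2.1, v.2.2.2.2)) (fun v => v.2.1)
              (fun v => (v.1, v.2.2.1)) ≤ R1 + R2)

set_option maxHeartbeats 1000000 in
theorem ach_of_reg [Nonempty X1] [Nonempty X2]
    (p : X1 × X2 × X3 → ℝ) (hp : IsPMF p) (d2 : X2 → Xh2 → ℝ) (hd2 : ∀ x y, 0 ≤ d2 x y)
    (R1 R2 D12 D32 : ℝ) (hReg : Reg p d2 R1 R2 D12 D32) : Ach p d2 R1 R2 D12 D32 := by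
  classical
  obtain ⟨u1, u2, -, -, q, hq, hmarg, hMk, γ32, γ12, hD32, hD12, hR1, hR2, hR12⟩ := hReg
  obtain ⟨f1, f2, f3, f4, f5, f6, f7, -⟩ := ent_facts hq hMk
  obtain ⟨k, hk0, hk1, rfl⟩ := exists_kernel hq hmarg hMk
  have hne : Nonempty (Fin u1 × Fin u2) := by
    by_contra hemp
    rw [not_nonempty_iff] at hemp
    have h := hk1 (Classical.arbitrary X1) (Classical.arbitrary X2)
    simp at h
  haveI : Nonempty (Fin u1) := ⟨hne.some.1⟩
  haveI : Nonempty (Fin u2) := ⟨hne.some.2⟩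
  have hh20 : 0 ≤ condH (jq p k) (fun v => v.1) (fun v => v.2.1) := by
    have := H_mono hq.1 (fun v => v.2.1) (fun v => (v.1, v.2.1)) (by simp +contextual)
    unfold condH
    linarith
  have hA0 := condMutInfo_nonneg (fun v : X1 × X2 × X3 × Fin u1 × Fin u2 => v.2.2.2.1) (fun v => v.2.1) (fun v => v.1) hq
  have hB0 := condMutInfo_nonneg (fun v : X1 × X2 × X3 × Fin u1 × Fin u2 => v.2.2.2.2) (fun v => v.2.1)
    (fun v => (v.2.2.2.1, v.1, v.2.2.1)) hq
  intro ε hε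
  obtain ⟨M, hM0, hM⟩ : ∃ M : ℝ, 0 ≤ M ∧ ∀ x y, d2 x y ≤ M := by
    refine ⟨∑ x, ∑ y, d2 x y, Finset.sum_nonneg fun x _ => Finset.sum_nonneg fun y _ => hd2 x y, fun x y => ?_⟩
    exact (Finset.single_le_sum (f := fun y => d2 x y) (fun y _ => hd2 x y) (Finset.mem_univ y)).trans
      (Finset.single_le_sum (f := fun x => ∑ y, d2 x y) (fun x _ => Finset.sum_nonneg fun y _ => hd2 x y) (Finset.mem_univ x))
  obtain ⟨δ, hδ⟩ : ∃ δ, δ = ε / 20 := ⟨_, rfl⟩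
  obtain ⟨η, hη⟩ : ∃ η, η = ε / (24 * (M + 1)) := ⟨_, rfl⟩
  have hδ0 : 0 < δ := by rw [hδ]; positivity
  have hη0 : 0 < η := by rw [hη]; positivity
  obtain ⟨N, hN⟩ := ach_block hp hk0 hk1 (fun v => d2 v.2.1 (γ12 v.1 v.2.2.2.1))
    (fun v => d2 v.2.1 (γ32 v.1 v.2.2.1 v.2.2.2.1 v.2.2.2.2)) hδ0 hη0 rfl rfl rfl rfl rfl rfl rfl
  have hlim : Filter.Tendsto (fun n : ℕ => 21 * (2 : ℝ) ^ (-((n : ℝ) * δ))) Filter.atTop (nhds 0) := by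
    have h1 : ∀ n : ℕ, (2 : ℝ) ^ (-((n : ℝ) * δ)) = ((2 : ℝ) ^ (-δ)) ^ n := by
      intro n
      rw [← Real.rpow_natCast, ← Real.rpow_mul (by norm_num)]
      congr 1
      ring
    simp_rw [h1]
    have := (tendsto_pow_atTop_nhds_zero_of_lt_one (Real.rpow_nonneg (by norm_num) (-δ))
      (Real.rpow_lt_one_of_one_lt_of_neg (x := 2) (by norm_num) (neg_lt_zero.2 hδ0))).const_mul 21
    simpa using this
  have hε4 : 0 < ε / (4 * (M + 1)) := by positivity
  have ev1 := hlim.eventually (gt_mem_nhds hε4)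
  have ev2 : ∀ᶠ n : ℕ in Filter.atTop, 4 / ε ≤ (n : ℝ) := tendsto_natCast_atTop_atTop.eventually_ge_atTop _
  obtain ⟨n, hn1, hn2, hnN, hn0⟩ := (ev1.and (ev2.and ((Filter.eventually_ge_atTop N).and
    (Filter.eventually_gt_atTop 0)))).exists
  have hn0' : (0 : ℝ) < n := by exact_mod_cast hn0
  obtain ⟨m1, l1, m21, l2, m22, hb, hr1, hr2⟩ := ach_num (n := n) (η := η) hn0'.le hδ0 f1 hR1 hh20
    (f3 ▸ hA0) (f4 ▸ hB0) (f3.symm ▸ f4.symm ▸ hR2) (f5.symm ▸ (f7.trans hR2)) (f6.symm ▸ hR12)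
  obtain ⟨h, enc, dec2, dec1, dec3, sel, hmain⟩ := hN n hnN hn0 m1 l1 m21 l2 m22
  have hβ := hmain.trans hb
  obtain ⟨β, hβdef⟩ : ∃ β : ℝ, β = 21 * (2 : ℝ) ^ (-((n : ℝ) * δ)) + 6 * η := ⟨_, rfl⟩
  rw [← hβdef] at hβ
  have hβ1 : β ≤ ε / (2 * (M + 1)) := by
    rw [hβdef, hη]
    have : 6 * (ε / (24 * (M + 1))) = ε / (4 * (M + 1)) := by field_simp; norm_num
    have : ε / (2 * (M + 1)) = ε / (4 * (M + 1)) + ε / (4 * (M + 1)) := by field_simp; norm_num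
    linarith
  have hβ2 : (M + 1) * β ≤ ε / 2 := by
    have := mul_le_mul_of_nonneg_left hβ1 (show (0 : ℝ) ≤ M + 1 by linarith)
    have e : (M + 1) * (ε / (2 * (M + 1))) = ε / 2 := by field_simp
    linarith
  have hβ0 : 0 ≤ β := by rw [hβdef]; positivity
  have hMβ : 0 ≤ M * β := mul_nonneg hM0 hβ0
  have hw := isPMF_iidW hp n
  have hnε : 2 ≤ n * (ε / 2) := by
    rw [div_le_iff₀ hε] at hn2
    linarith
  refine ⟨n, 1, hn0, fun _ => m1 + 1, fun _ => (m21 + 1) * (m22 + 1), fun _ => Nat.succ_pos _, fun _ => by positivity,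
    fun _ ω => h (fun t => (ω t).1),
    fun _ ω => finProdFinEquiv (enc (fun t => (ω t).2.1) (h (fun t => (ω t).1))),
    fun a j t => γ12 (a t) (dec1 a (finProdFinEquiv.symm (j 0)) t),
    fun b j => dec2 b (j 0),
    fun c j1 j2 => (dec3 c (j1 0) (finProdFinEquiv.symm (j2 0))).1,
    fun c j1 j2 t => γ32 ((dec3 c (j1 0) (finProdFinEquiv.symm (j2 0))).1 t) (c t)
      ((dec3 c (j1 0) (finProdFinEquiv.symm (j2 0))).2.1 t) ((dec3 c (j1 0) (finProdFinEquiv.symm (j2 0))).2.2 t),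
    ?_, ?_, ?_, ?_, ?_, ?_, ?_, ?_⟩
  · exact fun l => ⟨fun a _ => h a, fun ω => rfl⟩
  · intro l
    refine ⟨fun b j => finProdFinEquiv (enc b (j l le_rfl)), fun ω => rfl⟩
  · rw [one_div, inv_mul_le_iff₀ hn0']
    simp only [Finset.univ_unique, Finset.sum_const, Finset.card_singleton, one_smul, Nat.cast_add, Nat.cast_one]
    rw [hδ] at hr1
    linarith
  · rw [one_div, inv_mul_le_iff₀ hn0']
    simp only [Finset.univ_unique, Finset.sum_const, Finset.card_singleton, one_smul, Nat.cast_add, Nat.cast_one,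
      Nat.cast_mul]
    rw [hδ] at hr2
    linarith
  · have hc : 0 ≤ (∑ v, jq p k v * d2 v.2.1 (γ12 v.1 v.2.2.2.1)) + δ :=
      add_nonneg (Finset.sum_nonneg fun v _ => mul_nonneg (hq.1 v) (hd2 _ _)) hδ0.le
    have := dist_bound hw hn0 (fun ω t => d2 (ω t).2.1 (γ12 (ω t).1 (dec1 (fun s => (ω s).1) (finProdFinEquiv.symm
      (finProdFinEquiv (enc (fun t => (ω t).2.1) (h (fun t => (ω t).1))))) t))) hc (fun ω t => hM _ _) hM0 _ hβ ?_
    · refine this.trans ?_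
      have h1 : (∑ v, jq p k v * d2 v.2.1 (γ12 v.1 v.2.2.2.1)) ≤ D12 := hD12
      rw [hδ]
      linarith
    · rintro ω ⟨g1, g2, g3, g4, g5⟩
      simp only [Equiv.symm_apply_apply]
      rw [g2]
      exact g4
  · refine (pr_mono hw.1 ?_).trans (hβ.trans (by linarith))
    intro ω hω hg
    exact hω hg.1
  · refine (pr_mono hw.1 ?_).trans (hβ.trans (by linarith))
    intro ω hω hg
    refine hω ?_
    simp only [Equiv.symm_apply_apply]
    rw [hg.2.2.1]
  · have hc : 0 ≤ (∑ v, jq p k v * d2 v.2.1 (γ32 v.1 v.2.2.1 v.2.2.2.1 v.2.2.2.2)) + δ :=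
      add_nonneg (Finset.sum_nonneg fun v _ => mul_nonneg (hq.1 v) (hd2 _ _)) hδ0.le
    have := dist_bound hw hn0 (fun ω t => d2 (ω t).2.1 (γ32 ((dec3 (fun t => (ω t).2.2) (h (fun t => (ω t).1)) (finProdFinEquiv.symm
      (finProdFinEquiv (enc (fun t => (ω t).2.1) (h (fun t => (ω t).1)))))).1 t) (ω t).2.2 
      ((dec3 (fun t => (ω t).2.2) (h (fun t => (ω t).1)) (finProdFinEquiv.symm
      (finProdFinEquiv (enc (fun t => (ω t).2.1) (h (fun t => (ω t).1)))))).2.1 t) ((dec3 (fun t => (ω t).2.2) (h (fun t => (ω t).1)) (finProdFinEquiv.symm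
      (finProdFinEquiv (enc (fun t => (ω t).2.1) (h (fun t => (ω t).1)))))).2.2 t))) hc (fun ω t => hM _ _) hM0 _ hβ ?_
    · refine this.trans ?_
      have h1 : (∑ v, jq p k v * d2 v.2.1 (γ32 v.1 v.2.2.1 v.2.2.2.1 v.2.2.2.2)) ≤ D32 := hD32
      rw [hδ]
      linarith
    · rintro ω ⟨g1, g2, g3, g4, g5⟩
      simp only [Equiv.symm_apply_apply]
      rw [g3]
      exact g5

end achdef
end TE

namespace TE

section belowl
variable {n : ℕ} {α : Type*}

lemma below_eq_iff (t : ℕ) (x y : Fin n → α) : below t x = below t y ↔ ∀ s : Fin n, s.val < t → x s = y s := by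
  constructor
  · intro h s hs
    have := congrFun h s
    simpa [below, hs] using this
  · intro h
    funext s
    by_cases hs : s.val < t
    · simp [below, hs, h s hs]
    · simp [below, hs]

lemma above_eq_iff (t : ℕ) (x y : Fin n → α) : above t x = above t y ↔ ∀ s : Fin n, t < s.val → x s = y s := by
  constructor
  · intro h s hs
    have := congrFun h s
    simpa [above, hs] using this
  · intro h
    funext s
    by_cases hs : t < s.val
    · simp [above, hs, h s hs]
    · simp [above, hs]

lemma below_succ_iff (t : Fin n) (x y : Fin n → α) :
    below (t.val + 1) x = below (t.val + 1) y ↔ x t = y t ∧ below t.val x = below t.val y := by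
  simp only [below_eq_iff]
  constructor
  · exact fun h => ⟨h t (Nat.lt_succ_self _), fun s hs => h s (hs.trans (Nat.lt_succ_self _))⟩
  · rintro ⟨h1, h2⟩ s hs
    rcases Nat.lt_succ_iff_lt_or_eq.1 hs with h | h
    · exact h2 s h
    · rw [show s = t from Fin.ext h]
      exact h1

lemma below_top_iff (x y : Fin n → α) : below n x = below n y ↔ x = y := by
  simp only [below_eq_iff]
  exact ⟨fun h => funext fun s => h s s.2, fun h s _ => congrFun h s⟩

lemma split_iff (t : Fin n) (x y : Fin n → α) :
    x = y ↔ x t = y t ∧ below t.val x = below t.val y ∧ above t.val x = above t.val y := by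
  simp only [below_eq_iff, above_eq_iff]
  constructor
  · rintro rfl
    simp
  · rintro ⟨h1, h2, h3⟩
    funext s
    rcases lt_trichotomy s.val t.val with h | h | h
    · exact h2 s h
    · rw [show s = t from Fin.ext h]
      exact h1
    · exact h3 s h
end belowl

section chain
variable {Ω : Type*} [Fintype Ω] {α β γ : Type*} [Fintype α] [Fintype β] [Fintype γ] {w : Ω → ℝ}

lemma chain_rule (hw : IsPMF w) {n : ℕ} (Y : Ω → Fin n → α) (Z : Ω → β) :
    ∑ t : Fin n, (H w (fun ω => (Y ω t, below t.val (Y ω), Z ω)) - H w (fun ω => (below t.val (Y ω), Z ω)))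
      = H w (fun ω => (Y ω, Z ω)) - H w Z := by
  have h1 : ∀ t : Fin n, H w (fun ω => (Y ω t, below t.val (Y ω), Z ω)) = H w (fun ω => (below (t.val + 1) (Y ω), Z ω)) := by
    intro t
    refine H_congr hw.1 _ _ fun ω ω' _ _ => ?_
    simp only [Prod.mk.injEq, below_succ_iff]
    tauto
  simp_rw [h1]
  rw [Fin.sum_univ_eq_sum_range (fun t => H w (fun ω => (below (t + 1) (Y ω), Z ω)) - H w (fun ω => (below t (Y ω), Z ω))) n,
    Finset.sum_range_sub (fun t => H w (fun ω => (below t (Y ω), Z ω)))]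
  congr 1
  · refine H_congr hw.1 _ _ fun ω ω' _ _ => ?_
    simp only [Prod.mk.injEq, below_top_iff]
  · refine H_congr hw.1 _ _ fun ω ω' _ _ => ?_
    simp only [Prod.mk.injEq, below_eq_iff]
    simp

lemma H_fam_le (hw : IsPMF w) {n : ℕ} (Y : Ω → Fin n → α) :
    H w Y ≤ ∑ t, H w (fun ω => Y ω t) := by
  have h := chain_rule hw Y (fun _ => ())
  rw [H_const hw (fun _ => ()) (fun _ _ _ _ => rfl), sub_zero] at h
  have h2 : H w (fun ω => (Y ω, ())) = H w Y := H_congr hw.1 _ _ (by simp)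
  rw [← h2, ← h]
  refine Finset.sum_le_sum fun t _ => ?_
  have := H_subadd hw (fun ω => Y ω t) (fun ω => (below t.val (Y ω), ()))
  linarith

lemma fano (hw : IsPMF w) [Nonempty α] (X : Ω → α) (Y : Ω → β) (g : β → α) {ε : ℝ} (hε : 0 < ε) (hε1 : ε < 1)
    (h : IT.pr w (fun ω => g (Y ω) ≠ X ω) ≤ ε) :
    H w (fun ω => (X ω, Y ω)) - H w Y ≤
      -Real.logb 2 (1 - ε) + ε * (-Real.logb 2 ε + Real.logb 2 (Fintype.card α)) := by
  classical
  have hc : (0 : ℝ) < Fintype.card α := by exact_mod_cast Fintype.card_pos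
  set r : α × β → ℝ := fun z => if g z.2 = z.1 then 1 - ε else ε / Fintype.card α with hr
  have hr0 : ∀ z, 0 < r z := by
    intro z
    simp only [hr]
    split_ifs
    · linarith
    · positivity
  set P := IT.dist w (fun ω => (X ω, Y ω)) with hP
  have hP0 : ∀ z, 0 ≤ P z := dist_nonneg hw.1 _
  have hPY : ∀ z, P z ≤ IT.dist w Y z.2 := by
    rintro ⟨x, y⟩
    rw [← sum_dist_left w X Y y]
    exact Finset.single_le_sum (f := fun a => IT.dist w (fun ω => (X ω, Y ω)) (a, y)) (fun a _ => dist_nonneg hw.1 _ _) (Finset.mem_univ x)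
  have hY0 : ∀ y, 0 ≤ IT.dist w Y y := dist_nonneg hw.1 _
  have hrs : ∀ y, ∑ x, r (x, y) ≤ 1 := by
    intro y
    have : ∀ x, r (x, y) ≤ (if g y = x then 1 - ε else 0) + ε / Fintype.card α := by
      intro x
      simp only [hr]
      split_ifs
      · have : 0 < ε / Fintype.card α := by positivity
        linarith
      · linarith
    refine (Finset.sum_le_sum fun x _ => this x).trans (le_of_eq ?_)
    rw [Finset.sum_add_distrib]
    simp only [Finset.sum_ite_eq, Finset.mem_univ, if_true, Finset.sum_const, Finset.card_univ, nsmul_eq_mul]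
    field_simp
    ring
  have hg := gibbs P (fun z => IT.dist w Y z.2 * r z) hP0 (fun z => mul_nonneg (hY0 _) (hr0 z).le)
    (fun z hz => by
      rcases mul_eq_zero.1 hz with h0 | h0
      · exact le_antisymm ((hPY z).trans h0.le) (hP0 z)
      · exact absurd h0 (hr0 z).ne')
    (by
      rw [hP, sum_dist, hw.2, Fintype.sum_prod_type, Finset.sum_comm]
      simp only [← Finset.mul_sum]
      calc _ ≤ ∑ y, IT.dist w Y y * 1 := Finset.sum_le_sum fun y _ => mul_le_mul_of_nonneg_left (hrs y) (hY0 y)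
        _ = 1 := by simp only [mul_one]; rw [sum_dist, hw.2])
  rw [hP, sum_dist_mul w (fun ω => (X ω, Y ω)) (fun z => Real.logb 2 (IT.dist w Y z.2 * r z)),
    sum_dist_mul w (fun ω => (X ω, Y ω)) (fun z => Real.logb 2 (IT.dist w (fun ω => (X ω, Y ω)) z))] at hg
  have h1 : ∑ ω, w ω * Real.logb 2 (IT.dist w Y (Y ω) * r (X ω, Y ω)) = - H w Y + ∑ ω, w ω * Real.logb 2 (r (X ω, Y ω)) := by
    rw [H_eq, neg_neg, ← Finset.sum_add_distrib]
    refine Finset.sum_congr rfl fun ω _ => ?_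
    rcases (hw.1 ω).eq_or_lt with h0 | h0
    · simp [← h0]
    · rw [Real.logb_mul (h0.trans_le (le_dist hw.1 Y ω)).ne' (hr0 _).ne']
      ring
  have h2 : H w (fun ω => (X ω, Y ω)) = - ∑ ω, w ω * Real.logb 2 (IT.dist w (fun ω => (X ω, Y ω)) (X ω, Y ω)) := H_eq _ _
  simp only at hg
  rw [h1] at hg
  have hlog : Real.logb 2 ε ≤ 0 := Real.logb_nonpos (by norm_num) hε.le hε1.le
  have hlog1 : Real.logb 2 (1 - ε) ≤ 0 := Real.logb_nonpos (by norm_num) (by linarith) (by linarith)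
  have hlogc : 0 ≤ Real.logb 2 (Fintype.card α) := Real.logb_nonneg (by norm_num) (by exact_mod_cast Fintype.card_pos)
  have h3 : ∀ ω, - Real.logb 2 (r (X ω, Y ω)) ≤ -Real.logb 2 (1 - ε) +
      ind (g (Y ω) ≠ X ω) * (-Real.logb 2 ε + Real.logb 2 (Fintype.card α)) := by
    intro ω
    by_cases h0 : g (Y ω) = X ω
    · rw [ind_false (not_not.2 h0)]
      simp [hr, h0]
    · rw [ind_true h0]
      simp only [hr, h0, if_false]
      rw [Real.logb_div hε.ne' hc.ne']
      linarith
  have h4 : -∑ ω, w ω * Real.logb 2 (r (X ω, Y ω)) ≤ ∑ ω, (w ω * -Real.logb 2 (1 - ε) + 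
      (w ω * ind (g (Y ω) ≠ X ω)) * (-Real.logb 2 ε + Real.logb 2 (Fintype.card α))) := by
    rw [← Finset.sum_neg_distrib]
    refine Finset.sum_le_sum fun ω _ => ?_
    have := mul_le_mul_of_nonneg_left (h3 ω) (hw.1 ω)
    linarith
  rw [Finset.sum_add_distrib, ← Finset.sum_mul, ← Finset.sum_mul, hw.2, ← pr_eq_ind] at h4
  have h5 := mul_le_mul_of_nonneg_right h (show 0 ≤ -Real.logb 2 ε + Real.logb 2 (Fintype.card α) by linarith)
  linarith
end chain

section timeshare
variable {Ω : Type*} [Fintype Ω] {α : Type*} [Fintype α]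

/-- uniform time sharing weight -/
def wT (n : ℕ) (w : Ω → ℝ) : Fin n × Ω → ℝ := fun y => w y.2 / n

lemma sum_wT (n : ℕ) (w : Ω → ℝ) (f : Fin n × Ω → ℝ) :
    ∑ y, wT n w y * f y = (1 / (n : ℝ)) * ∑ t, ∑ ω, w ω * f (t, ω) := by
  rw [Fintype.sum_prod_type, Finset.mul_sum]
  refine Finset.sum_congr rfl fun t _ => ?_
  rw [Finset.mul_sum]
  refine Finset.sum_congr rfl fun ω _ => ?_
  simp only [wT]
  ring

lemma isPMF_wT {n : ℕ} (hn : 0 < n) {w : Ω → ℝ} (hw : IsPMF w) : IsPMF (wT n w) := by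
  refine ⟨fun y => div_nonneg (hw.1 _) (Nat.cast_nonneg _), ?_⟩
  have := sum_wT n w (fun _ => 1)
  simp only [mul_one] at this
  rw [this]
  simp only [hw.2, Finset.sum_const, Finset.card_univ, Fintype.card_fin, nsmul_eq_mul, mul_one]
  have : (n : ℝ) ≠ 0 := by positivity
  field_simp

lemma H_wT {n : ℕ} (hn : 0 < n) {w : Ω → ℝ} (hw : IsPMF w) (X : Fin n → Ω → α) :
    H (wT n w) (fun y => (X y.1 y.2, y.1)) = Real.logb 2 n + (1 / (n : ℝ)) * ∑ t, H w (X t) := by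
  have hn' : (0 : ℝ) < n := by exact_mod_cast hn
  have hd : ∀ t ω, IT.dist (wT n w) (fun y => (X y.1 y.2, y.1)) (X t ω, t) = IT.dist w (X t) (X t ω) / n := by
    intro t ω
    rw [dist_eq_ind, dist_eq_ind, sum_wT]
    simp only [Prod.mk.injEq, ind_and]
    have : ∀ s, ∑ ω', w ω' * (ind (X s ω' = X t ω) * ind (s = t)) = (∑ ω', w ω' * ind (X s ω' = X t ω)) * ind (s = t) := by
      intro s
      rw [Finset.sum_mul]
      exact Finset.sum_congr rfl fun ω' _ => by ring
    simp_rw [this]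
    rw [sum_mul_ind (fun s => ∑ ω', w ω' * ind (X s ω' = X t ω))]
    ring
  rw [H_eq, sum_wT]
  simp only [hd, H_eq]
  have h2 : ∀ t, ∑ ω, w ω * Real.logb 2 (IT.dist w (X t) (X t ω) / n) = 
      (∑ ω, w ω * Real.logb 2 (IT.dist w (X t) (X t ω))) - Real.logb 2 n := by
    intro t
    have : Real.logb 2 n = ∑ ω, w ω * Real.logb 2 n := by rw [← Finset.sum_mul, hw.2, one_mul]
    rw [this, ← Finset.sum_sub_distrib]
    refine Finset.sum_congr rfl fun ω _ => ?_
    rcases (hw.1 ω).eq_or_lt with h0 | h0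
    · simp [← h0]
    · rw [Real.logb_div (h0.trans_le (le_dist hw.1 (X t) ω)).ne' hn'.ne']
      ring
  simp_rw [h2]
  rw [Finset.sum_sub_distrib, Finset.sum_neg_distrib]
  simp only [Finset.sum_const, Finset.card_univ, Fintype.card_fin, nsmul_eq_mul]
  field_simp
  ring

lemma dist_wT {n : ℕ} (hn : 0 < n) {p : α → ℝ} (hp : IsPMF p) :
    IT.dist (wT n (iidW p n)) (fun y => y.2 y.1) = p := by
  have hn' : (0 : ℝ) < n := by exact_mod_cast hn
  funext a
  rw [dist_eq_ind, sum_wT]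
  have : ∀ t, ∑ ω, iidW p n ω * ind (ω t = a) = p a := by
    intro t
    rw [iid_marg1 hp t (fun b => ind (b = a)), sum_mul_ind]
  simp_rw [this]
  simp only [Finset.sum_const, Finset.card_univ, Fintype.card_fin, nsmul_eq_mul]
  field_simp

end timeshare
end TE

namespace TE

section conv
variable {X1 X2 X3 JT : Type} [Fintype X1] [Fintype X2] [Fintype X3] [Fintype JT]

/-- auxiliary alphabet 1 -/
abbrev U1T (n : ℕ) (X1 X3 JT : Type) : Type := Fin n × JT × (Fin n → X1) × (Fin n → Option X3)
/-- auxiliary alphabet 2 -/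
abbrev U2T (n : ℕ) (X2 X3 : Type) : Type := (Fin n → Option X2) × (Fin n → Option X3)

/-- single-letter random variables -/
def Vf (n : ℕ) (J : (Fin n → X1 × X2 × X3) → JT) (y : Fin n × (Fin n → X1 × X2 × X3)) :
    X1 × X2 × X3 × U1T n X1 X3 JT × U2T n X2 X3 :=
  ((y.2 y.1).1, (y.2 y.1).2.1, (y.2 y.1).2.2,
    (y.1, J y.2, fun t => (y.2 t).1, below y.1.val (fun t => (y.2 t).2.2)),
    (below y.1.val (fun t => (y.2 t).2.1), above y.1.val (fun t => (y.2 t).2.2)))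

lemma iid_fun_congr {n : ℕ} {w : (Fin n → X1 × X2 × X3) → ℝ} {α : Type*} {p : X1 × X2 × X3 → ℝ} (hp : IsPMF p)
    [Fintype α] (f : X1 × X2 × X3 → α) {β : Type*} [Fintype β] (Y : (Fin n → X1 × X2 × X3) → β)
    (h : ∀ ω ω', Y ω = Y ω' ↔ ∀ t, f (ω t) = f (ω' t)) : H (iidW p n) Y = n * H p f := by
  rw [← H_iid hp n f]
  refine H_congr (isPMF_iidW hp n).1 _ _ fun ω ω' _ _ => ?_
  rw [h, funext_iff]

lemma H_single {n : ℕ} (hn : 0 < n) {p : X1 × X2 × X3 → ℝ} (hp : IsPMF p) {α : Type*} [Fintype α] (f : X1 × X2 × X3 → α) :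
    H (wT n (iidW p n)) (fun y => f (y.2 y.1)) = H p f := by
  rw [← H_map, dist_wT hn hp]

variable {n : ℕ} {p : X1 × X2 × X3 → ℝ} {J : (Fin n → X1 × X2 × X3) → JT}

lemma H_wT' (hn : 0 < n) (hp : IsPMF p) {α β : Type*} [Fintype α] [Fintype β]
    (Y : Fin n × (Fin n → X1 × X2 × X3) → β) (X : Fin n → (Fin n → X1 × X2 × X3) → α) 
    (h : ∀ t ω t' ω', Y (t, ω) = Y (t', ω') ↔ (t = t' ∧ X t ω = X t ω')) :
    H (wT n (iidW p n)) Y = Real.logb 2 n + (1 / (n : ℝ)) * ∑ t, H (iidW p n) (X t) := by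
  rw [← H_wT hn (isPMF_iidW hp n)]
  refine H_congr (isPMF_wT hn (isPMF_iidW hp n)).1 _ _ ?_
  rintro ⟨t, ω⟩ ⟨t', ω'⟩ _ _
  rw [h]
  simp only [Prod.mk.injEq]
  constructor
  · rintro ⟨rfl, h⟩
    exact ⟨h, rfl⟩
  · rintro ⟨h, rfl⟩
    exact ⟨rfl, h⟩

/-- sum form of C -/
lemma conv_C (hn : 0 < n) (hp : IsPMF p)
    (hJ : ∀ ω ω', (∀ t, (ω t).1 = (ω' t).1) → (∀ t, (ω t).2.1 = (ω' t).2.1) → J ω = J ω') :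
    (n : ℝ) * condMutInfo (IT.dist (wT n (iidW p n)) (Vf n J)) (fun v => (v.2.2.2.1, v.2.2.2.2)) (fun v => v.2.1) (fun v => (v.1, v.2.2.1))
      = H (iidW p n) (fun ω => (J ω, (fun t => (ω t).1), (fun t => (ω t).2.2))) - n * H p (fun v => (v.1, v.2.2)) := by
  have hw := isPMF_iidW hp n
  have hn' : (n : ℝ) ≠ 0 := by positivity
  rw [condMutInfo_def]
  simp only [H_map]
  have e1 := H_single hn hp (fun v => (v.2.1, v.1, v.2.2))
  have e2 := H_single hn hp (fun v => (v.1, v.2.2))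
  have e3 : H p (fun v => (v.2.1, v.1, v.2.2)) = H p (fun v => v) := H_congr hp.1 _ _ (by simp [Prod.ext_iff]; tauto)
  have e4 := H_wT' hn hp (fun y => (((Vf n J y).2.2.2.1, (Vf n J y).2.2.2.2), (Vf n J y).1, (Vf n J y).2.2.1))
    (fun t ω => (below t.val (fun t => (ω t).2.1), J ω, (fun t => (ω t).1), (fun t => (ω t).2.2))) (by
      intro t ω t' ω'
      simp only [Vf, Prod.mk.injEq]
      constructor
      · rintro ⟨⟨⟨rfl, h1, h2, h3⟩, h4, h5⟩, h6, h7⟩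
        exact ⟨rfl, h4, h1, h2, (split_iff t _ _).2 ⟨h7, h3, h5⟩⟩
      · rintro ⟨rfl, h1, h2, h3, h4⟩
        have := (split_iff t _ _).1 h4
        exact ⟨⟨⟨rfl, h2, h3, this.2.1⟩, h1, this.2.2⟩, congrFun h3 t, this.1⟩)
  have e5 := H_wT' hn hp (fun y => (((Vf n J y).2.2.2.1, (Vf n J y).2.2.2.2), (Vf n J y).2.1, (Vf n J y).1, (Vf n J y).2.2.1))
    (fun t ω => ((ω t).2.1, below t.val (fun t => (ω t).2.1), J ω, (fun t => (ω t).1), (fun t => (ω t).2.2))) (by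
      intro t ω t' ω'
      simp only [Vf, Prod.mk.injEq]
      constructor
      · rintro ⟨⟨⟨rfl, h1, h2, h3⟩, h4, h5⟩, h8, h6, h7⟩
        exact ⟨rfl, h8, h4, h1, h2, (split_iff t _ _).2 ⟨h7, h3, h5⟩⟩
      · rintro ⟨rfl, h8, h1, h2, h3, h4⟩
        have := (split_iff t _ _).1 h4
        exact ⟨⟨⟨rfl, h2, h3, this.2.1⟩, h1, this.2.2⟩, h8, congrFun h3 t, this.1⟩)
  have ch := chain_rule hw (fun ω t => (ω t).2.1) (fun ω => (J ω, (fun t => (ω t).1), (fun t => (ω t).2.2)))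
  have e6 : H (iidW p n) (fun ω => ((fun t => (ω t).2.1), J ω, (fun t => (ω t).1), (fun t => (ω t).2.2))) = n * H p (fun v => v) := by
    refine iid_fun_congr (w := iidW p n) hp _ _ fun ω ω' => ?_
    simp only [Prod.mk.injEq, funext_iff, Prod.ext_iff]
    constructor
    · rintro ⟨h1, _, h2, h3⟩ t
      exact ⟨h2 t, h1 t, h3 t⟩
    · intro h
      exact ⟨fun t => (h t).2.1, hJ _ _ (fun t => (h t).1) (fun t => (h t).2.1), fun t => (h t).1, fun t => (h t).2.2⟩
  rw [Finset.sum_sub_distrib, e6] at ch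
  rw [e3] at e1
  have e1' : H (wT n (iidW p n)) (fun ω => ((Vf n J ω).2.1, (Vf n J ω).1, (Vf n J ω).2.2.1)) = H p (fun v => v) := e1
  have e2' : H (wT n (iidW p n)) (fun ω => ((Vf n J ω).1, (Vf n J ω).2.2.1)) = H p (fun v => (v.1, v.2.2)) := e2
  rw [e1', e2', e4, e5]
  field_simp
  linarith

lemma conv_I3 (hn : 0 < n) (hp : IsPMF p) :
    (n : ℝ) * condMutInfo (IT.dist (wT n (iidW p n)) (Vf n J)) (fun v => v.2.2.2.1) (fun v => v.2.2.1) (fun v => v.1)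
      = n * H p (fun v => (v.1, v.2.2)) - n * H p (fun v => v.1) -
        H (iidW p n) (fun ω => (J ω, (fun t => (ω t).1), (fun t => (ω t).2.2))) + H (iidW p n) (fun ω => (J ω, (fun t => (ω t).1))) := by
  have hw := isPMF_iidW hp n
  have hn' : (n : ℝ) ≠ 0 := by positivity
  rw [condMutInfo_def]
  simp only [H_map]
  have e1 := H_single hn hp (fun v => (v.2.2, v.1))
  have e2 := H_single hn hp (fun v => v.1)
  have e3 : H p (fun v => (v.2.2, v.1)) = H p (fun v => (v.1, v.2.2)) := H_congr hp.1 _ _ (by simp; tauto)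
  have e4 := H_wT' hn hp (fun y => ((Vf n J y).2.2.2.1, (Vf n J y).1))
    (fun t ω => (below t.val (fun t => (ω t).2.2), J ω, (fun t => (ω t).1))) (by
      intro t ω t' ω'
      simp only [Vf, Prod.mk.injEq]
      constructor
      · rintro ⟨⟨rfl, h1, h2, h3⟩, h4⟩
        exact ⟨rfl, h3, h1, h2⟩
      · rintro ⟨rfl, h1, h2, h3⟩
        exact ⟨⟨rfl, h2, h3, h1⟩, congrFun h3 t⟩)
  have e5 := H_wT' hn hp (fun y => ((Vf n J y).2.2.2.1, (Vf n J y).2.2.1, (Vf n J y).1))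
    (fun t ω => ((ω t).2.2, below t.val (fun t => (ω t).2.2), J ω, (fun t => (ω t).1))) (by
      intro t ω t' ω'
      simp only [Vf, Prod.mk.injEq]
      constructor
      · rintro ⟨⟨rfl, h1, h2, h3⟩, h5, h4⟩
        exact ⟨rfl, h5, h3, h1, h2⟩
      · rintro ⟨rfl, h5, h1, h2, h3⟩
        exact ⟨⟨rfl, h2, h3, h1⟩, h5, congrFun h3 t⟩)
  have ch := chain_rule hw (fun ω t => (ω t).2.2) (fun ω => (J ω, (fun t => (ω t).1)))
  have e6 : H (iidW p n) (fun ω => ((fun t => (ω t).2.2), J ω, (fun t => (ω t).1))) = 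
      H (iidW p n) (fun ω => (J ω, (fun t => (ω t).1), (fun t => (ω t).2.2))) := by
    refine H_congr hw.1 _ _ fun ω ω' _ _ => ?_
    simp only [Prod.mk.injEq]
    tauto
  rw [Finset.sum_sub_distrib, e6] at ch
  rw [e3] at e1
  have e1' : H (wT n (iidW p n)) (fun ω => ((Vf n J ω).2.2.1, (Vf n J ω).1)) = H p (fun v => (v.1, v.2.2)) := e1
  have e2' : H (wT n (iidW p n)) (fun ω => (Vf n J ω).1) = H p (fun v => v.1) := e2
  rw [e1', e2', e4, e5]
  field_simp
  linarith

lemma conv_markov (hn : 0 < n) (hp : IsPMF p)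
    (hJ : ∀ ω ω', (∀ t, (ω t).1 = (ω' t).1) → (∀ t, (ω t).2.1 = (ω' t).2.1) → J ω = J ω') :
    condMutInfo (IT.dist (wT n (iidW p n)) (Vf n J)) (fun v => (v.2.2.2.1, v.2.2.2.2)) (fun v => v.2.2.1) (fun v => (v.1, v.2.1)) = 0 := by
  classical
  have hw := isPMF_iidW hp n
  have hn' : (0 : ℝ) < n := by exact_mod_cast hn
  refine le_antisymm ?_ (condMutInfo_nonneg _ _ _ (isPMF_dist (isPMF_wT hn hw) _))
  rw [condMutInfo_def]
  simp only [H_map]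
  have e1 := H_single hn hp (fun v => (v.2.2, v.1, v.2.1))
  have e2 := H_single hn hp (fun v => (v.1, v.2.1))
  have e3 : H p (fun v => (v.2.2, v.1, v.2.1)) = H p (fun v => v) := H_congr hp.1 _ _ (by simp [Prod.ext_iff]; tauto)
  rw [e3] at e1
  have e1' : H (wT n (iidW p n)) (fun ω => ((Vf n J ω).2.2.1, (Vf n J ω).1, (Vf n J ω).2.1)) = H p (fun v => v) := e1
  have e2' : H (wT n (iidW p n)) (fun ω => ((Vf n J ω).1, (Vf n J ω).2.1)) = H p (fun v => (v.1, v.2.1)) := e2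
  have e4 := H_wT' hn hp (fun y => (((Vf n J y).2.2.2.1, (Vf n J y).2.2.2.2), (Vf n J y).1, (Vf n J y).2.1))
    (fun t ω => ((ω t).2.1, below t.val (fun t => (ω t).2.1), J ω, (fun t => (ω t).1), below t.val (fun t => (ω t).2.2), 
      above t.val (fun t => (ω t).2.2))) (by
      intro t ω t' ω'
      simp only [Vf, Prod.mk.injEq]
      constructor
      · rintro ⟨⟨⟨rfl, h1, h2, h3⟩, h4, h5⟩, h6, h7⟩
        exact ⟨rfl, h7, h4, h1, h2, h3, h5⟩
      · rintro ⟨rfl, h7, h4, h1, h2, h3, h5⟩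
        exact ⟨⟨⟨rfl, h1, h2, h3⟩, h4, h5⟩, congrFun h2 t, h7⟩)
  have e5 := H_wT' hn hp (fun y => (((Vf n J y).2.2.2.1, (Vf n J y).2.2.2.2), (Vf n J y).2.2.1, (Vf n J y).1, (Vf n J y).2.1))
    (fun t ω => ((ω t).2.2, (ω t).2.1, below t.val (fun t => (ω t).2.1), J ω, (fun t => (ω t).1), below t.val (fun t => (ω t).2.2), 
      above t.val (fun t => (ω t).2.2))) (by
      intro t ω t' ω'
      simp only [Vf, Prod.mk.injEq]
      constructor
      · rintro ⟨⟨⟨rfl, h1, h2, h3⟩, h4, h5⟩, h8, h6, h7⟩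
        exact ⟨rfl, h8, h7, h4, h1, h2, h3, h5⟩
      · rintro ⟨rfl, h8, h7, h4, h1, h2, h3, h5⟩
        exact ⟨⟨⟨rfl, h1, h2, h3⟩, h4, h5⟩, h8, congrFun h2 t, h7⟩)
  rw [e1', e2', e4, e5]
  have key : ∀ t : Fin n, H (iidW p n) (fun ω => ((ω t).2.1, below t.val (fun t => (ω t).2.1), J ω, (fun t => (ω t).1), below t.val (fun t => (ω t).2.2), 
      above t.val (fun t => (ω t).2.2))) - H (iidW p n) (fun ω => ((ω t).2.2, (ω t).2.1, below t.val (fun t => (ω t).2.1), J ω, (fun t => (ω t).1), below t.val (fun t => (ω t).2.2), 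
      above t.val (fun t => (ω t).2.2))) ≤ H p (fun v => (v.1, v.2.1)) - H p (fun v => v) := by
    intro t
    have s := H_submod (fun ω : Fin n → X1 × X2 × X3 => (fun t => (ω t).2.1)) (fun ω => (ω t).2.2)
      (fun ω => ((ω t).2.1, below t.val (fun t => (ω t).2.1), J ω, (fun t => (ω t).1), below t.val (fun t => (ω t).2.2), 
      above t.val (fun t => (ω t).2.2))) hw
    have c1 : H (iidW p n) (fun ω => ((fun t => (ω t).2.1), (ω t).2.2, (ω t).2.1, below t.val (fun t => (ω t).2.1), J ω, (fun t => (ω t).1), below t.val (fun t => (ω t).2.2), 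
      above t.val (fun t => (ω t).2.2))) = n * H p (fun v => v) := by
      refine iid_fun_congr (w := iidW p n) hp _ _ fun ω ω' => ?_
      simp only [Prod.mk.injEq]
      constructor
      · rintro ⟨h1, h2, -, -, -, h3, h4, h5⟩ s
        exact Prod.ext (congrFun h3 s) (Prod.ext (congrFun h1 s) (congrFun ((split_iff t _ _).2 ⟨h2, h4, h5⟩) s))
      · intro h
        obtain rfl : ω = ω' := funext h
        simp
    have c2 : H (iidW p n) (fun ω => ((fun t => (ω t).2.1), (ω t).2.1, below t.val (fun t => (ω t).2.1), J ω, (fun t => (ω t).1), below t.val (fun t => (ω t).2.2), 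
      above t.val (fun t => (ω t).2.2))) ≤ H (iidW p n) (fun ω => fun s => ((ω s).1, (ω s).2.1, if s = t then none else some (ω s).2.2)) := by
      refine H_mono hw.1 _ _ fun ω ω' _ _ h => ?_
      have hs := fun s => congrFun h s
      simp only [Prod.mk.injEq] at hs ⊢
      have h1 : (fun t => (ω t).1) = fun t => (ω' t).1 := funext fun s => (hs s).1
      have h2 : (fun t => (ω t).2.1) = fun t => (ω' t).2.1 := funext fun s => (hs s).2.1
      refine ⟨h2, (hs t).2.1, by rw [h2], hJ _ _ (fun s => (hs s).1) (fun s => (hs s).2.1), h1, ?_, ?_⟩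
      · rw [below_eq_iff]
        intro s hst
        have := (hs s).2.2
        rw [if_neg (by rintro rfl; omega), if_neg (by rintro rfl; omega)] at this
        exact Option.some.inj this
      · rw [above_eq_iff]
        intro s hst
        have := (hs s).2.2
        rw [if_neg (by rintro rfl; omega), if_neg (by rintro rfl; omega)] at this
        exact Option.some.inj this
    have c3 := H_fam_le hw (fun ω => fun s => ((ω s).1, (ω s).2.1, if s = t then none else some (ω s).2.2))
    have c4 : ∀ s, H (iidW p n) (fun ω => ((ω s).1, (ω s).2.1, if s = t then none else some (ω s).2.2)) = 
        if s = t then H p (fun v => (v.1, v.2.1)) else H p (fun v => v) := by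
      intro s
      have m1 : IT.dist (iidW p n) (fun ω => ω s) = p := by
        funext a
        rw [dist_eq_ind, iid_marg1 hp s (fun b => ind (b = a)), sum_mul_ind]
      have m2 := H_map (iidW p n) (fun ω => ω s) (fun v => (v.1, v.2.1, if s = t then none else some v.2.2))
      rw [m1] at m2
      rw [← m2]
      split_ifs with hst
      · exact H_congr hp.1 _ _ (by simp)
      · exact H_congr hp.1 _ _ (by simp [Prod.ext_iff])
    simp only [c4] at c3
    have c5 : ∑ s, (if s = t then H p (fun v => (v.1, v.2.1)) else H p (fun v => v)) =
        n * H p (fun v => v) + (H p (fun v => (v.1, v.2.1)) - H p (fun v => v)) := by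
      have : ∀ s, (if s = t then H p (fun v => (v.1, v.2.1)) else H p (fun v => v)) = H p (fun v => v) + 
          (if s = t then H p (fun v => (v.1, v.2.1)) - H p (fun v => v) else 0) := by
        intro s
        split_ifs <;> ring
      simp_rw [this]
      rw [Finset.sum_add_distrib]
      simp
    rw [c5] at c3
    rw [c1] at s
    linarith
  have hs := Finset.sum_le_sum fun (t : Fin n) (_ : t ∈ Finset.univ) => key t
  rw [Finset.sum_sub_distrib] at hs
  simp only [Finset.sum_const, Finset.card_univ, Fintype.card_fin, nsmul_eq_mul] at hs
  have := mul_le_mul_of_nonneg_left hs (show 0 ≤ 1 / (n : ℝ) by positivity)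
  have e : 1 / (n : ℝ) * (n * (H p (fun v => (v.1, v.2.1)) - H p (fun v => v))) = H p (fun v => (v.1, v.2.1)) - H p (fun v => v) := by
    field_simp
  rw [e, mul_sub] at this
  linarith

end conv
end TE

namespace TE

section convcode
variable {X1 X2 X3 Xh2 : Type} [Fintype X1] [Fintype X2] [Fintype X3] [Fintype Xh2]

/-- single-letter region with given auxiliary alphabets -/
def RegU (p : X1 × X2 × X3 → ℝ) (d2 : X2 → Xh2 → ℝ) (R1 R2 D12 D32 : ℝ) (U1 U2 : Type) [Fintype U1] [Fintype U2] : Prop :=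
      ∃ q : X1 × X2 × X3 × U1 × U2 → ℝ, IsPMF q ∧
        (∀ a b c, (∑ d : U1, ∑ e : U2, q (a, b, c, d, e)) = p (a, b, c)) ∧
        IT.condMutInfo q (fun v => (v.2.2.2.1, v.2.2.2.2)) (fun v => v.2.2.1)
          (fun v => (v.1, v.2.1)) = 0 ∧
        ∃ (g32 : X1 → X3 → U1 → U2 → Xh2) (g12 : X1 → U1 → Xh2),
          IT.expect q (fun v => d2 v.2.1 (g32 v.1 v.2.2.1 v.2.2.2.1 v.2.2.2.2)) ≤ D32 ∧
          IT.expect q (fun v => d2 v.2.1 (g12 v.1 v.2.2.2.1)) ≤ D12 ∧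
          IT.condH q (fun v => v.1) (fun v => v.2.1) ≤ R1 ∧
          IT.condMutInfo q (fun v => v.2.2.2.1) (fun v => v.2.1) (fun v => v.1) +
            IT.condMutInfo q (fun v => v.2.2.2.2) (fun v => v.2.1)
              (fun v => (v.2.2.2.1, v.1, v.2.2.1)) ≤ R2 ∧
          IT.condH q (fun v => v.1) (fun v => v.2.2.1) +
            IT.condMutInfo q (fun v => (v.2.2.2.1, v.2.2.2.2)) (fun v => v.2.1)
              (fun v => (v.1, v.2.2.1)) ≤ R1 + R2

/-- Fano slack -/
def tau (c ε : ℝ) : ℝ := -Real.logb 2 (1 - ε) + ε * (-Real.logb 2 ε + c)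

lemma logb_card_pi {K : ℕ} (m : Fin K → ℕ) (hm : ∀ l, 0 < m l) :
    Real.logb 2 (Fintype.card ((l : Fin K) → Fin (m l))) = ∑ l, Real.logb 2 (m l) := by
  rw [Fintype.card_pi]
  simp only [Fintype.card_fin]
  push_cast
  unfold Real.logb
  rw [Real.log_prod (fun l _ => by exact_mod_cast (hm l).ne'), Finset.sum_div]

lemma marg_dist {U1 U2 Ω : Type*} [Fintype U1] [Fintype U2] [Fintype Ω] {w : Ω → ℝ} (V : Ω → X1 × X2 × X3 × U1 × U2) (a b c) :
    ∑ d : U1, ∑ e : U2, IT.dist w V (a, b, c, d, e) = IT.dist w (fun ω => ((V ω).1, (V ω).2.1, (V ω).2.2.1)) (a, b, c) := by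
  simp only [dist_eq_ind]
  rw [← Fintype.sum_prod_type' (f := fun d e => ∑ ω, w ω * ind (V ω = (a, b, c, d, e))), Finset.sum_comm]
  refine Finset.sum_congr rfl fun ω _ => ?_
  rw [← Finset.mul_sum]
  congr 1
  have : ∀ x : U1 × U2, ind (V ω = (a, b, c, x.1, x.2)) = ind (((V ω).1, (V ω).2.1, (V ω).2.2.1) = (a, b, c)) * ind (x = (V ω).2.2.2) := by
    intro x
    rw [← ind_and]
    congr 1
    simp only [Prod.ext_iff, eq_iff_iff]
    constructor
    · rintro ⟨h1, h2, h3, h4, h5⟩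
      exact ⟨⟨h1, h2, h3⟩, h4.symm, h5.symm⟩
    · rintro ⟨⟨h1, h2, h3⟩, h4, h5⟩
      exact ⟨h1, h2, h3, h4.symm, h5.symm⟩
  simp_rw [this]
  exact sum_mul_ind (fun _ => ind (((V ω).1, (V ω).2.1, (V ω).2.2.1) = (a, b, c))) _

set_option maxHeartbeats 1000000 in
theorem conv_code [Nonempty X1]
    (p : X1 × X2 × X3 → ℝ) (hp : IsPMF p) (d2 : X2 → Xh2 → ℝ)
    (R1 R2 D12 D32 ε : ℝ) (hε : 0 < ε) (hε1 : ε < 1)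
  {n K : ℕ} (hn : 0 < n) (m1 m2 : Fin K → ℕ) (hm1 : ∀ l, 0 < m1 l) (hm2 : ∀ l, 0 < m2 l)
        (J1 : (l : Fin K) → (Fin n → X1 × X2 × X3) → Fin (m1 l))
        (J2 : (l : Fin K) → (Fin n → X1 × X2 × X3) → Fin (m2 l))
        (g12 : (Fin n → X1) → ((l : Fin K) → Fin (m2 l)) → Fin n → Xh2)
        (g21 : (Fin n → X2) → ((l : Fin K) → Fin (m1 l)) → Fin n → X1)
        (g31 : (Fin n → X3) → ((l : Fin K) → Fin (m1 l)) → ((l : Fin K) → Fin (m2 l)) → Fin n → X1)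
        (g32 : (Fin n → X3) → ((l : Fin K) → Fin (m1 l)) → ((l : Fin K) → Fin (m2 l)) → Fin n → Xh2)
    (hc1 : (∀ l : Fin K, ∃ f : (Fin n → X1) →
            ((k : Fin K) → k.val < l.val → Fin (m2 k)) → Fin (m1 l),
          ∀ ω, J1 l ω = f (fun t => (ω t).1) (fun k _ => J2 k ω)))
    (hc2 : (∀ l : Fin K, ∃ f : (Fin n → X2) →
            ((k : Fin K) → k.val ≤ l.val → Fin (m1 k)) → Fin (m2 l),
          ∀ ω, J2 l ω = f (fun t => (ω t).2.1) (fun k _ => J1 k ω)))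
    (hr1 : (1 / (n : ℝ)) * ∑ l, Real.logb 2 (m1 l) ≤ R1 + ε)
    (hr2 : (1 / (n : ℝ)) * ∑ l, Real.logb 2 (m2 l) ≤ R2 + ε)
    (hd12 : (1 / (n : ℝ)) * ∑ t : Fin n, IT.expect (iidW p n)
            (fun ω => d2 (ω t).2.1
              (g12 (fun s => (ω s).1) (fun l => J2 l ω) t)) ≤ D12 + ε)
    (hl21 : IT.pr (iidW p n)
          (fun ω => (fun t => g21 (fun s => (ω s).2.1) (fun l => J1 l ω) t) ≠
            fun t => (ω t).1) ≤ ε)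
    (hl31 : IT.pr (iidW p n)
          (fun ω => (fun t => g31 (fun s => (ω s).2.2) (fun l => J1 l ω) (fun l => J2 l ω) t) ≠
            fun t => (ω t).1) ≤ ε)
    (hd32 : (1 / (n : ℝ)) * ∑ t : Fin n, IT.expect (iidW p n)
            (fun ω => d2 (ω t).2.1
              (g32 (fun s => (ω s).2.2) (fun l => J1 l ω) (fun l => J2 l ω) t)) ≤ D32 + ε) :
    RegU p d2 (R1 + ε + tau (Real.logb 2 (Fintype.card X1)) ε) (R2 + ε) (D12 + ε) (D32 + ε)
      (U1T n X1 X3 ((l : Fin K) → Fin (m2 l))) (U2T n X2 X3) := by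
  classical
  have hw := isPMF_iidW hp n
  have hn' : (0 : ℝ) < n := by exact_mod_cast hn
  have hn1 : (1 : ℝ) ≤ n := by exact_mod_cast hn
  obtain ⟨JJ2, hJJ2⟩ : ∃ J : (Fin n → X1 × X2 × X3) → ((l : Fin K) → Fin (m2 l)), J = fun ω l => J2 l ω := ⟨_, rfl⟩
  obtain ⟨JJ1, hJJ1⟩ : ∃ J : (Fin n → X1 × X2 × X3) → ((l : Fin K) → Fin (m1 l)), J = fun ω l => J1 l ω := ⟨_, rfl⟩
  -- functional dependence
  have hdep : ∀ ω ω', (∀ t, (ω t).1 = (ω' t).1) → (∀ t, (ω t).2.1 = (ω' t).2.1) → 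
      ∀ N : ℕ, ∀ l : Fin K, l.val < N → J1 l ω = J1 l ω' ∧ J2 l ω = J2 l ω' := by
    intro ω ω' hA hB N
    induction N with
    | zero => intro l hl; omega
    | succ N ih =>
      intro l hl
      have h1 : ∀ l : Fin K, l.val < N + 1 → J1 l ω = J1 l ω' := by
        intro l hl
        obtain ⟨f, hf⟩ := hc1 l
        rw [hf, hf, show (fun t => (ω t).1) = fun t => (ω' t).1 from funext hA]
        congr 1
        funext k hk
        exact (ih k (by omega)).2
      refine ⟨h1 l hl, ?_⟩
      obtain ⟨f, hf⟩ := hc2 l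
      rw [hf, hf, show (fun t => (ω t).2.1) = fun t => (ω' t).2.1 from funext hB]
      congr 1
      funext k hk
      exact h1 k (by omega)
  have hJ : ∀ ω ω', (∀ t, (ω t).1 = (ω' t).1) → (∀ t, (ω t).2.1 = (ω' t).2.1) → JJ2 ω = JJ2 ω' := by
    intro ω ω' hA hB
    rw [hJJ2]
    funext l
    exact (hdep ω ω' hA hB K l l.2).2
  choose F1 hF1 using hc1
  have hqW := isPMF_wT hn hw
  have hq := isPMF_dist hqW (Vf n JJ2)
  have hMk := conv_markov hn hp hJ
  obtain ⟨-, -, -, -, -, -, -, f8⟩ := ent_facts hq hMk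
  have hC := conv_C hn hp hJ
  have hI3 := conv_I3 (J := JJ2) hn hp
  have HA : H (iidW p n) (fun ω => fun t => (ω t).1) = n * H p (fun v => v.1) := H_iid hp n (fun v => v.1)
  have HB : H (iidW p n) (fun ω => fun t => (ω t).2.1) = n * H p (fun v => v.2.1) := H_iid hp n (fun v => v.2.1)
  have HC : H (iidW p n) (fun ω => fun t => (ω t).2.2) = n * H p (fun v => v.2.2) := H_iid hp n (fun v => v.2.2)
  have HAB : H (iidW p n) (fun ω => ((fun t => (ω t).1), (fun t => (ω t).2.1))) = n * H p (fun v => (v.1, v.2.1)) := by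
    refine iid_fun_congr (w := iidW p n) hp _ _ fun ω ω' => ?_
    simp only [Prod.mk.injEq, funext_iff]
    exact ⟨fun h t => ⟨h.1 t, h.2 t⟩, fun h => ⟨fun t => (h t).1, fun t => (h t).2⟩⟩
  have hne2 : Nonempty ((l : Fin K) → Fin (m2 l)) := ⟨fun l => ⟨0, hm2 l⟩⟩
  have hne1 : Nonempty ((l : Fin K) → Fin (m1 l)) := ⟨fun l => ⟨0, hm1 l⟩⟩
  have HJ2 : H (iidW p n) JJ2 ≤ n * (R2 + ε) := by
    refine (H_le_card hw JJ2).trans ?_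
    rw [logb_card_pi m2 hm2]
    rwa [one_div, inv_mul_le_iff₀ hn'] at hr2
  have HJ1 : H (iidW p n) JJ1 ≤ n * (R1 + ε) := by
    refine (H_le_card hw JJ1).trans ?_
    rw [logb_card_pi m1 hm1]
    rwa [one_div, inv_mul_le_iff₀ hn'] at hr1
  have hlog0 : 0 ≤ -Real.logb 2 ε := by
    have := Real.logb_nonpos (b := 2) (by norm_num) hε.le hε1.le
    linarith
  have hlog1 : 0 ≤ -Real.logb 2 (1 - ε) := by
    have := Real.logb_nonpos (b := 2) (x := 1 - ε) (by norm_num) (by linarith) (by linarith)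
    linarith
  have htau : -Real.logb 2 (1 - ε) + ε * (-Real.logb 2 ε + Real.logb 2 (Fintype.card (Fin n → X1))) ≤
      n * tau (Real.logb 2 (Fintype.card X1)) ε := by
    have : Real.logb 2 (Fintype.card (Fin n → X1)) = n * Real.logb 2 (Fintype.card X1) := by
      rw [Fintype.card_fun, Fintype.card_fin, Nat.cast_pow, Real.logb_pow]
    rw [this]
    unfold tau
    have h1 := mul_le_mul_of_nonneg_right hn1 hlog1
    have h2 := mul_le_mul_of_nonneg_right hn1 (mul_nonneg hε.le hlog0)
    linarith
  have fano1 := fano hw (fun ω => fun t => (ω t).1) (fun ω => ((fun t => (ω t).2.1), JJ1 ω)) (fun y => g21 y.1 y.2) hε hε1 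
    (by rw [hJJ1]; exact hl21)
  have fano3 := fano hw (fun ω => fun t => (ω t).1) (fun ω => ((fun t => (ω t).2.2), JJ1 ω, JJ2 ω)) (fun y => g31 y.1 y.2.1 y.2.2) hε hε1 
    (by rw [hJJ1, hJJ2]; exact hl31)
  have hmarg : IT.dist (wT n (iidW p n)) (fun ω => ((Vf n JJ2 ω).1, (Vf n JJ2 ω).2.1, (Vf n JJ2 ω).2.2.1)) = p := dist_wT hn hp
  have c12 : condH (IT.dist (wT n (iidW p n)) (Vf n JJ2)) (fun v => v.1) (fun v => v.2.1) = H p (fun v => (v.1, v.2.1)) - H p (fun v => v.2.1) := by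
    unfold condH
    rw [H_map, H_map, ← H_single hn hp, ← H_single hn hp]
    rfl
  have c13 : condH (IT.dist (wT n (iidW p n)) (Vf n JJ2)) (fun v => v.1) (fun v => v.2.2.1) = H p (fun v => (v.1, v.2.2)) - H p (fun v => v.2.2) := by
    unfold condH
    rw [H_map, H_map, ← H_single hn hp, ← H_single hn hp]
    rfl
  refine ⟨IT.dist (wT n (iidW p n)) (Vf n JJ2), hq, ?_, hMk, 
    fun a c u1 u2 => g32 (fun s => if s.val < u1.1.val then (u1.2.2.2 s).getD c else if u1.1.val < s.val then (u2.2 s).getD c else c)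
      (fun l => F1 l u1.2.2.1 (fun k _ => u1.2.1 k)) u1.2.1 u1.1,
    fun a u1 => g12 u1.2.2.1 u1.2.1 u1.1, ?_, ?_, ?_, ?_, ?_⟩
  · intro a b c
    rw [marg_dist, hmarg]
  · rw [expect_map]
    unfold expect
    rw [sum_wT]
    refine le_trans (le_of_eq ?_) hd32
    congr 1
    refine Finset.sum_congr rfl fun t _ => ?_
    refine Finset.sum_congr rfl fun ω _ => ?_
    congr 2
    simp only [Vf]
    congr 1
    · funext s
      by_cases h1 : s.val < t.val
      · refine (if_pos h1).trans ?_
        simp only [below, h1, if_true, Option.getD_some]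
      · refine (if_neg h1).trans ?_
        by_cases h2 : t.val < s.val
        · refine (if_pos h2).trans ?_
          simp only [above, h2, if_true, Option.getD_some]
        · refine (if_neg h2).trans ?_
          rw [show s = t from Fin.ext (by omega)]
    · funext l
      rw [hF1, hJJ2]
    · rw [hJJ2]
  · rw [expect_map]
    unfold expect
    rw [sum_wT]
    refine le_trans (le_of_eq ?_) hd12
    rw [hJJ2]
    rfl
  · rw [c12]
    have s1 := H_mono hw.1 (fun ω => ((fun t => (ω t).1), (fun t => (ω t).2.1))) (fun ω => ((fun t => (ω t).1), (fun t => (ω t).2.1), JJ1 ω))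
      (by intro ω ω' _ _ h; simp only [Prod.mk.injEq] at h ⊢; tauto)
    have s2 := H_subadd hw (fun ω => (fun t => (ω t).2.1)) JJ1
    have : (n : ℝ) * (H p (fun v => (v.1, v.2.1)) - H p (fun v => v.2.1)) ≤ n * (R1 + ε + tau (Real.logb 2 (Fintype.card X1)) ε) := by
      linarith
    exact le_of_mul_le_mul_left this hn'
  · have s2 := H_subadd hw JJ2 (fun ω => (fun t => (ω t).1))
    refine le_of_mul_le_mul_left (a := (n : ℝ)) ?_ hn'
    rw [f8, mul_sub] at hC
    linarith
  · rw [c13]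
    refine le_of_mul_le_mul_left (a := (n : ℝ)) ?_ hn'
    rw [mul_add, hC]
    have s1 := H_mono hw.1 (fun ω => (JJ2 ω, (fun t => (ω t).1), (fun t => (ω t).2.2))) (fun ω => ((fun t => (ω t).1), (fun t => (ω t).2.2), JJ1 ω, JJ2 ω))
      (by intro ω ω' _ _ h; simp only [Prod.mk.injEq] at h ⊢; tauto)
    have s2 := H_subadd hw (fun ω => (fun t => (ω t).2.2)) (fun ω => (JJ1 ω, JJ2 ω))
    have s3 := H_subadd hw JJ1 JJ2
    linarith

end convcode
end TE

namespace TE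

section card1
variable {X1 X2 X3 Xh2 : Type} [Fintype X1] [Fintype X2] [Fintype X3] [Fintype Xh2]
variable {U1 U2 V1 V2 : Type} [Fintype U1] [Fintype U2] [Fintype V1] [Fintype V2]

lemma dist_jq_123 (p : X1 × X2 × X3 → ℝ) {k : X1 → X2 → U1 × U2 → ℝ} (hk1 : ∀ a b, ∑ v, k a b v = 1) (x) :
    IT.dist (jq p k) (fun v => (v.1, v.2.1, v.2.2.1)) x = p x := by
  rw [dist_eq_ind]
  simp only [jq, Fintype.sum_prod_type (α₁ := X1), Fintype.sum_prod_type (α₁ := X2), Fintype.sum_prod_type (α₁ := X3)]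
  have : ∀ x1 x2 x3, ∑ v, p (x1, x2, x3) * k x1 x2 v * ind ((x1, x2, x3) = x) =
      p (x1, x2, x3) * ind ((x1, x2, x3) = x) := by
    intro x1 x2 x3
    rw [← Finset.sum_mul, ← Finset.mul_sum, hk1, mul_one]
  simp_rw [this]
  have h := sum_mul_ind p x
  simp only [Fintype.sum_prod_type] at h
  exact h

lemma marg_jq (p : X1 × X2 × X3 → ℝ) {k : X1 → X2 → U1 × U2 → ℝ} (hk1 : ∀ a b, ∑ v, k a b v = 1) (a b c) :
    (∑ d : U1, ∑ e : U2, jq p k (a, b, c, d, e)) = p (a, b, c) := by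
  simp only [jq]
  rw [← Fintype.sum_prod_type' (f := fun d e => p (a, b, c) * k a b (d, e)), ← Finset.mul_sum, hk1, mul_one]

lemma H_jq (p : X1 × X2 × X3 → ℝ) {k : X1 → X2 → U1 × U2 → ℝ} (hk1 : ∀ a b, ∑ v, k a b v = 1)
    {α : Type*} [Fintype α] (f : X1 × X2 × X3 → α) :
    H (jq p k) (fun v => f (v.1, v.2.1, v.2.2.1)) = H p f := by
  rw [← H_map (jq p k) (fun v => (v.1, v.2.1, v.2.2.1)) f]
  congr 1
  funext x
  exact dist_jq_123 p hk1 x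

lemma markov_jq {p : X1 × X2 × X3 → ℝ} (hp : IsPMF p) {k : X1 → X2 → U1 × U2 → ℝ}
    (hk0 : ∀ a b v, 0 ≤ k a b v) (hk1 : ∀ a b, ∑ v, k a b v = 1) :
    IT.condMutInfo (jq p k) (fun v => (v.2.2.2.1, v.2.2.2.2)) (fun v => v.2.2.1)
          (fun v => (v.1, v.2.1)) = 0 := by
  rw [condMutInfo_eq_zero_iff _ _ _ (isPMF_jq hp hk0 hk1)]
  rintro u c ⟨a, b⟩
  have e1 : IT.dist (jq p k) (fun v => ((v.2.2.2.1, v.2.2.2.2), v.2.2.1, v.1, v.2.1)) (u, c, a, b) = p (a, b, c) * k a b u := by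
    rw [dist_eq_ind]
    refine Eq.trans ?_ (sum_mul_ind (jq p k) (a, b, c, u))
    refine Finset.sum_congr rfl fun v _ => ?_
    congr 2
    simp only [Prod.ext_iff, eq_iff_iff]
    tauto
  have e2 := dist_jq_12 p hk1 a b
  have e3 : IT.dist (jq p k) (fun v => ((v.2.2.2.1, v.2.2.2.2), v.1, v.2.1)) (u, a, b) = (∑ c, p (a, b, c)) * k a b u := by
    refine (dist_jq_12u p k id a b u).trans ?_
    congr 1
    exact sum_mul_ind (k a b) u
  have e4 : IT.dist (jq p k) (fun v => (v.2.2.1, v.1, v.2.1)) (c, a, b) = p (a, b, c) := by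
    rw [← dist_jq_123 p hk1 (a, b, c), dist_eq_ind, dist_eq_ind]
    refine Finset.sum_congr rfl fun v _ => ?_
    congr 2
    simp only [Prod.ext_iff, eq_iff_iff]
    tauto
  rw [e1, e2, e3, e4]
  ring

/-- conditional entropies used in the kernel form -/
def F1 (p : X1 × X2 × X3 → ℝ) (k : X1 → X2 → U1 × U2 → ℝ) : ℝ :=
  condH (jq p k) (fun v => v.2.1) (fun v => (v.1, v.2.2.2.1))
def F2 (p : X1 × X2 × X3 → ℝ) (k : X1 → X2 → U1 × U2 → ℝ) : ℝ :=
  condH (jq p k) (fun v => v.2.1) (fun v => (v.1, v.2.2.1, v.2.2.2.1))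
def F3 (p : X1 × X2 × X3 → ℝ) (k : X1 → X2 → U1 × U2 → ℝ) : ℝ :=
  condH (jq p k) (fun v => v.2.1) (fun v => (v.1, v.2.2.1, v.2.2.2.1, v.2.2.2.2))

def RegKk (p : X1 × X2 × X3 → ℝ) (d2 : X2 → Xh2 → ℝ) (R1 R2 D12 D32 : ℝ)
    (g32 : X1 → X3 → U1 → U2 → Xh2) (g12 : X1 → U1 → Xh2) (k : X1 → X2 → U1 × U2 → ℝ) : Prop :=
  (∀ a b v, 0 ≤ k a b v) ∧ (∀ a b, ∑ v, k a b v = 1) ∧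
    IT.expect (jq p k) (fun v => d2 v.2.1 (g32 v.1 v.2.2.1 v.2.2.2.1 v.2.2.2.2)) ≤ D32 ∧
    IT.expect (jq p k) (fun v => d2 v.2.1 (g12 v.1 v.2.2.2.1)) ≤ D12 ∧
    condH p (fun v => v.1) (fun v => v.2.1) ≤ R1 ∧
    condH p (fun v => v.2.1) (fun v => v.1) - F1 p k + F2 p k - F3 p k ≤ R2 ∧
    condH p (fun v => v.1) (fun v => v.2.2) + condH p (fun v => v.2.1) (fun v => (v.1, v.2.2)) - F3 p k ≤ R1 + R2

lemma jq_forms {p : X1 × X2 × X3 → ℝ} (hp : IsPMF p) {k : X1 → X2 → U1 × U2 → ℝ}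
    (hk0 : ∀ a b v, 0 ≤ k a b v) (hk1 : ∀ a b, ∑ v, k a b v = 1) :
    condH (jq p k) (fun v => v.1) (fun v => v.2.1) = condH p (fun v => v.1) (fun v => v.2.1) ∧
    IT.condMutInfo (jq p k) (fun v => v.2.2.2.1) (fun v => v.2.1) (fun v => v.1) +
            IT.condMutInfo (jq p k) (fun v => v.2.2.2.2) (fun v => v.2.1)
              (fun v => (v.2.2.2.1, v.1, v.2.2.1)) = condH p (fun v => v.2.1) (fun v => v.1) - F1 p k + F2 p k - F3 p k ∧
    IT.condH (jq p k) (fun v => v.1) (fun v => v.2.2.1) +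
            IT.condMutInfo (jq p k) (fun v => (v.2.2.2.1, v.2.2.2.2)) (fun v => v.2.1)
              (fun v => (v.1, v.2.2.1)) = condH p (fun v => v.1) (fun v => v.2.2) + condH p (fun v => v.2.1) (fun v => (v.1, v.2.2)) - F3 p k ∧
    condH p (fun v => v.2.1) (fun v => (v.1, v.2.2)) - F3 p k ≤ condH p (fun v => v.2.1) (fun v => v.1) - F1 p k + F2 p k - F3 p k := by
  have hq := isPMF_jq hp hk0 hk1
  have hM := markov_jq hp hk0 hk1
  obtain ⟨-, -, -, -, -, -, f7, -⟩ := ent_facts hq hM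
  have a1 : H (jq p k) (fun v => (v.1, v.2.1)) = H p (fun v => (v.1, v.2.1)) := H_jq p hk1 (fun v => (v.1, v.2.1))
  have a2 : H (jq p k) (fun v => v.2.1) = H p (fun v => v.2.1) := H_jq p hk1 (fun v => v.2.1)
  have a3 : H (jq p k) (fun v => (v.1, v.2.2.1)) = H p (fun v => (v.1, v.2.2)) := H_jq p hk1 (fun v => (v.1, v.2.2))
  have a4 : H (jq p k) (fun v => v.2.2.1) = H p (fun v => v.2.2) := H_jq p hk1 (fun v => v.2.2)
  have a5 : H (jq p k) (fun v => v.1) = H p (fun v => v.1) := H_jq p hk1 (fun v => v.1)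
  have a6 : H (jq p k) (fun v => (v.2.1, v.1)) = H p (fun v => (v.2.1, v.1)) := H_jq p hk1 (fun v => (v.2.1, v.1))
  have a7 : H (jq p k) (fun v => (v.2.1, v.1, v.2.2.1)) = H p (fun v => (v.2.1, v.1, v.2.2)) := H_jq p hk1 (fun v => (v.2.1, v.1, v.2.2))
  have e1 := H_congr hq.1 (fun v => (v.2.2.2.1, v.1)) (fun v => (v.1, v.2.2.2.1)) (by simp [Prod.ext_iff]; tauto)
  have e2 := H_congr hq.1 (fun v => (v.2.2.2.1, v.2.1, v.1)) (fun v => (v.2.1, v.1, v.2.2.2.1)) (by simp [Prod.ext_iff]; tauto)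
  have e3 := H_congr hq.1 (fun v => (v.2.2.2.2, v.2.2.2.1, v.1, v.2.2.1)) (fun v => (v.1, v.2.2.1, v.2.2.2.1, v.2.2.2.2)) (by simp [Prod.ext_iff]; tauto)
  have e4 := H_congr hq.1 (fun v => (v.2.1, v.2.2.2.1, v.1, v.2.2.1)) (fun v => (v.2.1, v.1, v.2.2.1, v.2.2.2.1)) (by simp [Prod.ext_iff]; tauto)
  have e5 := H_congr hq.1 (fun v => (v.2.2.2.2, v.2.1, v.2.2.2.1, v.1, v.2.2.1)) (fun v => (v.2.1, v.1, v.2.2.1, v.2.2.2.1, v.2.2.2.2)) (by simp [Prod.ext_iff]; tauto)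
  have e6 := H_congr hq.1 (fun v => (v.2.2.2.1, v.1, v.2.2.1)) (fun v => (v.1, v.2.2.1, v.2.2.2.1)) (by simp [Prod.ext_iff]; tauto)
  have e7 := H_congr hq.1 (fun v => ((v.2.2.2.1, v.2.2.2.2), v.1, v.2.2.1)) (fun v => (v.1, v.2.2.1, v.2.2.2.1, v.2.2.2.2)) (by simp [Prod.ext_iff]; tauto)
  have e8 := H_congr hq.1 (fun v => ((v.2.2.2.1, v.2.2.2.2), v.2.1, v.1, v.2.2.1)) (fun v => (v.2.1, v.1, v.2.2.1, v.2.2.2.1, v.2.2.2.2)) (by simp [Prod.ext_iff]; tauto)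
  simp only [condMutInfo_def, condH, F1, F2, F3] at *
  refine ⟨?_, ?_, ?_, ?_⟩ <;> linarith

lemma regU_of_regK {p : X1 × X2 × X3 → ℝ} (hp : IsPMF p) {d2 : X2 → Xh2 → ℝ} {R1 R2 D12 D32 : ℝ}
    {g32 : X1 → X3 → U1 → U2 → Xh2} {g12 : X1 → U1 → Xh2} {k : X1 → X2 → U1 × U2 → ℝ}
    (h : RegKk p d2 R1 R2 D12 D32 g32 g12 k) : RegU p d2 R1 R2 D12 D32 U1 U2 := by
  obtain ⟨hk0, hk1, h1, h2, h3, h4, h5⟩ := h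
  obtain ⟨f1, f2, f3, -⟩ := jq_forms hp hk0 hk1
  refine ⟨jq p k, isPMF_jq hp hk0 hk1, marg_jq p hk1, markov_jq hp hk0 hk1, g32, g12, h1, h2, ?_, ?_, ?_⟩
  · rw [f1]; exact h3
  · rw [f2]; exact h4
  · rw [f3]; exact h5

lemma regK_of_regU {p : X1 × X2 × X3 → ℝ} (hp : IsPMF p) {d2 : X2 → Xh2 → ℝ} {R1 R2 D12 D32 : ℝ}
    (h : RegU p d2 R1 R2 D12 D32 U1 U2) :
    ∃ (g32 : X1 → X3 → U1 → U2 → Xh2) (g12 : X1 → U1 → Xh2) (k : X1 → X2 → U1 × U2 → ℝ),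
      RegKk p d2 R1 R2 D12 D32 g32 g12 k := by
  obtain ⟨q, hq, hm, hM, g32, g12, h1, h2, h3, h4, h5⟩ := h
  obtain ⟨k, hk0, hk1, rfl⟩ := exists_kernel hq hm hM
  obtain ⟨f1, f2, f3, -⟩ := jq_forms hp hk0 hk1
  refine ⟨g32, g12, k, hk0, hk1, h1, h2, ?_, ?_, ?_⟩
  · rw [← f1]; exact h3
  · rw [← f2]; exact h4
  · rw [← f3]; exact h5

/-- relabelling of the auxiliary variables -/
lemma renameAux {p : X1 × X2 × X3 → ℝ} (hp : IsPMF p) {d2 : X2 → Xh2 → ℝ} {R1 R2 D12 D32 : ℝ}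
    {g32 : X1 → X3 → U1 → U2 → Xh2} {g12 : X1 → U1 → Xh2} {k : X1 → X2 → U1 × U2 → ℝ}
    (h : RegKk p d2 R1 R2 D12 D32 g32 g12 k)
    (φ : X1 → U1 → V1) (ψ : X1 → U1 → U2 → V2) (σ : X1 → V1 → U1) (ρ : X1 → U1 → V2 → U2)
    (hσ : ∀ a b u, k a b u ≠ 0 → σ a (φ a u.1) = u.1 ∧ ρ a u.1 (ψ a u.1 u.2) = u.2) :
    RegU p d2 R1 R2 D12 D32 V1 V2 := by
  obtain ⟨q, hqd, hq, hm, hM, h1, h2, h3, h4, h5, hinv⟩ : ∃ q, q = jq p k ∧ IsPMF q ∧ 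
      (∀ a b c, (∑ d : U1, ∑ e : U2, q (a, b, c, d, e)) = p (a, b, c)) ∧
      IT.condMutInfo q (fun v => (v.2.2.2.1, v.2.2.2.2)) (fun v => v.2.2.1)
          (fun v => (v.1, v.2.1)) = 0 ∧ 
          IT.expect q (fun v => d2 v.2.1 (g32 v.1 v.2.2.1 v.2.2.2.1 v.2.2.2.2)) ≤ D32 ∧
          IT.expect q (fun v => d2 v.2.1 (g12 v.1 v.2.2.2.1)) ≤ D12 ∧
          IT.condH q (fun v => v.1) (fun v => v.2.1) ≤ R1 ∧
          IT.condMutInfo q (fun v => v.2.2.2.1) (fun v => v.2.1) (fun v => v.1) +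
            IT.condMutInfo q (fun v => v.2.2.2.2) (fun v => v.2.1)
              (fun v => (v.2.2.2.1, v.1, v.2.2.1)) ≤ R2 ∧
          IT.condH q (fun v => v.1) (fun v => v.2.2.1) +
            IT.condMutInfo q (fun v => (v.2.2.2.1, v.2.2.2.2)) (fun v => v.2.1)
              (fun v => (v.1, v.2.2.1)) ≤ R1 + R2 ∧
      (∀ v, q v ≠ 0 → σ v.1 (φ v.1 v.2.2.2.1) = v.2.2.2.1 ∧ ρ v.1 v.2.2.2.1 (ψ v.1 v.2.2.2.1 v.2.2.2.2) = v.2.2.2.2) := by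
    obtain ⟨hk0, hk1, h1, h2, h3, h4, h5⟩ := h
    obtain ⟨f1, f2, f3, -⟩ := jq_forms hp hk0 hk1
    refine ⟨jq p k, rfl, isPMF_jq hp hk0 hk1, marg_jq p hk1, markov_jq hp hk0 hk1, h1, h2, ?_, ?_, ?_, ?_⟩
    · rw [f1]; exact h3
    · rw [f2]; exact h4
    · rw [f3]; exact h5
    · intro v hv
      exact hσ v.1 v.2.1 v.2.2.2 (right_ne_zero_of_mul hv)
  clear hqd h hσ
  obtain ⟨T, hT⟩ : ∃ T : X1 × X2 × X3 × U1 × U2 → X1 × X2 × X3 × V1 × V2,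
    T = fun v => (v.1, v.2.1, v.2.2.1, φ v.1 v.2.2.2.1, ψ v.1 v.2.2.2.1 v.2.2.2.2) := ⟨_, rfl⟩
  have i1 : ∀ v v', q v ≠ 0 → q v' ≠ 0 → v.1 = v'.1 → (φ v.1 v.2.2.2.1 = φ v'.1 v'.2.2.2.1 ↔ v.2.2.2.1 = v'.2.2.2.1) := by
    intro v v' hv hv' ha
    constructor
    · intro e
      rw [← (hinv v hv).1, ← (hinv v' hv').1, ← ha]
      rw [← ha] at e
      rw [e]
    · intro e
      rw [ha, e]
  have i2 : ∀ v v', q v ≠ 0 → q v' ≠ 0 → v.1 = v'.1 → v.2.2.2.1 = v'.2.2.2.1 →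
      (ψ v.1 v.2.2.2.1 v.2.2.2.2 = ψ v'.1 v'.2.2.2.1 v'.2.2.2.2 ↔ v.2.2.2.2 = v'.2.2.2.2) := by
    intro v v' hv hv' ha hu
    constructor
    · intro e
      rw [← (hinv v hv).2, ← (hinv v' hv').2, ← ha, ← hu]
      rw [← ha, ← hu] at e
      rw [e]
    · intro e
      rw [ha, hu, e]
  refine ⟨IT.dist q T, isPMF_dist hq T, ?_, ?_, fun a c j l => g32 a c (σ a j) (ρ a (σ a j) l),
    fun a j => g12 a (σ a j), ?_, ?_, ?_, ?_, ?_⟩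
  · intro a b c
    rw [marg_dist, ← hm]
    have := marg_dist (w := q) (fun v => v) a b c
    rw [hT, ← this]
    refine Finset.sum_congr rfl fun d _ => Finset.sum_congr rfl fun e _ => ?_
    rw [dist_eq_ind]
    exact sum_mul_ind q (a, b, c, d, e)
  · rw [← hM]
    rw [condMutInfo_map]
    simp only [condMutInfo_def, hT]
    have e1 := H_congr hq.1 (fun v => ((φ v.1 v.2.2.2.1, ψ v.1 v.2.2.2.1 v.2.2.2.2), v.1, v.2.1)) (fun v => ((v.2.2.2.1, v.2.2.2.2), v.1, v.2.1)) (by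
      intro v v' hv hv'
      have := i1 v v' hv hv'
      have := i2 v v' hv hv'
      simp only [Prod.mk.injEq]
      tauto)
    have e2 := H_congr hq.1 (fun v => ((φ v.1 v.2.2.2.1, ψ v.1 v.2.2.2.1 v.2.2.2.2), v.2.2.1, v.1, v.2.1)) (fun v => ((v.2.2.2.1, v.2.2.2.2), v.2.2.1, v.1, v.2.1)) (by
      intro v v' hv hv'
      have := i1 v v' hv hv'
      have := i2 v v' hv hv'
      simp only [Prod.mk.injEq]
      tauto)
    rw [e1, e2]
  · rw [expect_map]
    refine le_trans (le_of_eq ?_) h1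
    unfold expect
    refine Finset.sum_congr rfl fun v _ => ?_
    by_cases hv : q v = 0
    · rw [hv, zero_mul, zero_mul]
    · simp only [hT]
      rw [(hinv v hv).1, (hinv v hv).2]
  · rw [expect_map]
    refine le_trans (le_of_eq ?_) h2
    unfold expect
    refine Finset.sum_congr rfl fun v _ => ?_
    by_cases hv : q v = 0
    · rw [hv, zero_mul, zero_mul]
    · simp only [hT]
      rw [(hinv v hv).1]
  · rw [condH_map]
    simp only [hT]
    exact h3
  · rw [condMutInfo_map, condMutInfo_map]
    refine le_trans (le_of_eq ?_) h4
    simp only [condMutInfo_def, hT]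
    have e1 := H_congr hq.1 (fun v => (φ v.1 v.2.2.2.1, v.1)) (fun v => (v.2.2.2.1, v.1)) (by
      intro v v' hv hv'
      have := i1 v v' hv hv'
      simp only [Prod.mk.injEq]
      tauto)
    have e2 := H_congr hq.1 (fun v => (φ v.1 v.2.2.2.1, v.2.1, v.1)) (fun v => (v.2.2.2.1, v.2.1, v.1)) (by
      intro v v' hv hv'
      have := i1 v v' hv hv'
      simp only [Prod.mk.injEq]
      tauto)
    have e3 := H_congr hq.1 (fun v => (ψ v.1 v.2.2.2.1 v.2.2.2.2, φ v.1 v.2.2.2.1, v.1, v.2.2.1)) (fun v => (v.2.2.2.2, v.2.2.2.1, v.1, v.2.2.1)) (by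
      intro v v' hv hv'
      have := i1 v v' hv hv'
      have := i2 v v' hv hv'
      simp only [Prod.mk.injEq]
      tauto)
    have e4 := H_congr hq.1 (fun v => (v.2.1, φ v.1 v.2.2.2.1, v.1, v.2.2.1)) (fun v => (v.2.1, v.2.2.2.1, v.1, v.2.2.1)) (by
      intro v v' hv hv'
      have := i1 v v' hv hv'
      simp only [Prod.mk.injEq]
      tauto)
    have e5 := H_congr hq.1 (fun v => (ψ v.1 v.2.2.2.1 v.2.2.2.2, v.2.1, φ v.1 v.2.2.2.1, v.1, v.2.2.1)) (fun v => (v.2.2.2.2, v.2.1, v.2.2.2.1, v.1, v.2.2.1)) (by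
      intro v v' hv hv'
      have := i1 v v' hv hv'
      have := i2 v v' hv hv'
      simp only [Prod.mk.injEq]
      tauto)
    have e6 := H_congr hq.1 (fun v => (φ v.1 v.2.2.2.1, v.1, v.2.2.1)) (fun v => (v.2.2.2.1, v.1, v.2.2.1)) (by
      intro v v' hv hv'
      have := i1 v v' hv hv'
      simp only [Prod.mk.injEq]
      tauto)
    rw [e1, e2, e3, e4, e5, e6]
  · rw [condH_map, condMutInfo_map]
    refine le_trans (le_of_eq ?_) h5
    simp only [condMutInfo_def, hT]
    have e1 := H_congr hq.1 (fun v => ((φ v.1 v.2.2.2.1, ψ v.1 v.2.2.2.1 v.2.2.2.2), v.1, v.2.2.1)) (fun v => ((v.2.2.2.1, v.2.2.2.2), v.1, v.2.2.1)) (by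
      intro v v' hv hv'
      have := i1 v v' hv hv'
      have := i2 v v' hv hv'
      simp only [Prod.mk.injEq]
      tauto)
    have e2 := H_congr hq.1 (fun v => ((φ v.1 v.2.2.2.1, ψ v.1 v.2.2.2.1 v.2.2.2.2), v.2.1, v.1, v.2.2.1)) (fun v => ((v.2.2.2.1, v.2.2.2.2), v.2.1, v.1, v.2.2.1)) (by
      intro v v' hv hv'
      have := i1 v v' hv hv'
      have := i2 v v' hv hv'
      simp only [Prod.mk.injEq]
      tauto)
    rw [e1, e2]

end card1
end TE

namespace TE

section lpsec

lemma lp_step {Y E : Type*} [Fintype Y] [Fintype E] (a : Y → E → ℝ) (c : Y → ℝ) (w : E → ℝ)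
    (l0 : Y → ℝ) (h0 : ∀ y, 0 ≤ l0 y) (hpos : ∀ y, l0 y ≠ 0 → 0 < ∑ e, w e * a y e)
    (S : Finset Y) (hS : ∀ y, y ∈ S ↔ l0 y ≠ 0) (hcard : Fintype.card E < S.card) :
    ∃ l : Y → ℝ, (∀ y, 0 ≤ l y) ∧ (∀ e, ∑ y, l y * a y e = ∑ y, l0 y * a y e) ∧
      ∑ y, l y * c y ≤ ∑ y, l0 y * c y ∧ (∀ y, l y ≠ 0 → l0 y ≠ 0) ∧ ∃ y ∈ S, l y = 0 := by
  classical
  have hdep : ¬ LinearIndependent ℝ (fun y : S => a y) := by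
    intro h
    have := h.fintype_card_le_finrank
    simp at this
    omega
  rw [Fintype.not_linearIndependent_iff] at hdep
  obtain ⟨g, hg, i, hi⟩ := hdep
  obtain ⟨μ, hμa, hμS, hμ0, hμc⟩ : ∃ μ : Y → ℝ, (∀ e, ∑ y, μ y * a y e = 0) ∧ (∀ y, y ∉ S → μ y = 0) ∧
      (∃ y, μ y ≠ 0) ∧ ∑ y, μ y * c y ≤ 0 := by
    obtain ⟨μ, hμa, hμS, hμ0⟩ : ∃ μ : Y → ℝ, (∀ e, ∑ y, μ y * a y e = 0) ∧ (∀ y, y ∉ S → μ y = 0) ∧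
        (∃ y, μ y ≠ 0) := by
      refine ⟨fun y => if h : y ∈ S then g ⟨y, h⟩ else 0, ?_, ?_, i, ?_⟩
      · intro e
        have h1 := congrFun hg e
        simp only [Finset.sum_apply, Pi.smul_apply, smul_eq_mul, Pi.zero_apply] at h1
        refine Eq.trans ?_ h1
        rw [← Finset.sum_subset (Finset.subset_univ S), ← Finset.sum_coe_sort S]
        · refine Finset.sum_congr rfl fun y _ => ?_
          simp
        · intro y _ hy
          simp [hy]
      · intro y hy
        simp [hy]
      · simpa using hi
    rcases le_total (∑ y, μ y * c y) 0 with h | h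
    · exact ⟨μ, hμa, hμS, hμ0, h⟩
    · refine ⟨fun y => - μ y, ?_, ?_, ?_, ?_⟩
      · intro e
        simp [hμa e]
      · intro y hy
        simp [hμS y hy]
      · obtain ⟨y, hy⟩ := hμ0
        exact ⟨y, by simpa using hy⟩
      · simpa using h
  have hneg : ∃ y, μ y < 0 := by
    by_contra hcon
    push Not at hcon
    have hsum : ∑ y, μ y * ∑ e, w e * a y e = 0 := by
      simp_rw [Finset.mul_sum]
      rw [Finset.sum_comm]
      refine Finset.sum_eq_zero fun e _ => ?_
      have : ∀ y, μ y * (w e * a y e) = w e * (μ y * a y e) := fun y => by ring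
      simp_rw [this]
      rw [← Finset.mul_sum, hμa, mul_zero]
    have hnn : ∀ y ∈ Finset.univ, 0 ≤ μ y * ∑ e, w e * a y e := by
      intro y _
      by_cases hy : y ∈ S
      · exact mul_nonneg (hcon y) (hpos y ((hS y).1 hy)).le
      · rw [hμS y hy, zero_mul]
    rw [Finset.sum_eq_zero_iff_of_nonneg hnn] at hsum
    obtain ⟨y, hy⟩ := hμ0
    have hyS : y ∈ S := by
      by_contra h
      exact hy (hμS y h)
    rcases mul_eq_zero.1 (hsum y (Finset.mem_univ y)) with h | h
    · exact hy h
    · exact (hpos y ((hS y).1 hyS)).ne' h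
  obtain ⟨y1, hy1⟩ := hneg
  obtain ⟨y0, hy0, hmin⟩ := Finset.exists_min_image (Finset.univ.filter fun y => μ y < 0) (fun y => l0 y / (- μ y))
    ⟨y1, by simp [hy1]⟩
  simp only [Finset.mem_filter, Finset.mem_univ, true_and] at hy0 hmin
  have ht0 : 0 ≤ l0 y0 / (-μ y0) := div_nonneg (h0 y0) (by linarith)
  refine ⟨fun y => l0 y + l0 y0 / (-μ y0) * μ y, ?_, ?_, ?_, ?_, y0, ?_, ?_⟩
  · intro y
    by_cases hy : μ y < 0
    · have := hmin y hy
      have h2 : 0 < - μ y := by linarith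
      rw [le_div_iff₀ h2] at this
      linarith
    · have := mul_nonneg ht0 (not_lt.1 hy)
      linarith [h0 y]
  · intro e
    simp_rw [add_mul, mul_assoc]
    rw [Finset.sum_add_distrib, ← Finset.mul_sum, hμa, mul_zero, add_zero]
  · simp_rw [add_mul, mul_assoc]
    rw [Finset.sum_add_distrib, ← Finset.mul_sum]
    have := mul_nonpos_of_nonneg_of_nonpos ht0 hμc
    linarith
  · intro y hy h
    apply hy
    have : y ∉ S := fun h' => (hS y).1 h' h
    simp [h, hμS y this]
  · by_contra h
    rw [hμS y0 h] at hy0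
    exact lt_irrefl _ hy0
  · have : μ y0 ≠ 0 := hy0.ne
    field_simp
    ring

lemma lp {Y E : Type*} [Fintype Y] [Fintype E] (a : Y → E → ℝ) (c : Y → ℝ) (w : E → ℝ) (N : ℕ) :
    ∀ (l0 : Y → ℝ) (_ : ∀ y, 0 ≤ l0 y) (_ : ∀ y, l0 y ≠ 0 → 0 < ∑ e, w e * a y e)
    (S : Finset Y) (_ : ∀ y, y ∈ S ↔ l0 y ≠ 0) (_ : S.card ≤ N),
    ∃ (l : Y → ℝ) (S : Finset Y), (∀ y, 0 ≤ l y) ∧ (∀ e, ∑ y, l y * a y e = ∑ y, l0 y * a y e) ∧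
      ∑ y, l y * c y ≤ ∑ y, l0 y * c y ∧ (∀ y, y ∈ S ↔ l y ≠ 0) ∧ S.card ≤ Fintype.card E := by
  classical
  induction N with
  | zero =>
    intro l0 h0 _ S hS hN
    exact ⟨l0, S, h0, fun _ => rfl, le_rfl, hS, by omega⟩
  | succ N ih =>
    intro l0 h0 hpos S hS hN
    by_cases hc : S.card ≤ Fintype.card E
    · exact ⟨l0, S, h0, fun _ => rfl, le_rfl, hS, hc⟩
    obtain ⟨l, h1, h2, h3, h4, y, hyS, hy⟩ := lp_step a c w l0 h0 hpos S hS (by omega)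
    obtain ⟨l', S', g1, g2, g3, g4, g5⟩ := ih l h1 (fun y hy => hpos y (h4 y hy)) (Finset.univ.filter fun y => l y ≠ 0)
      (by simp) (by
        have : (Finset.univ.filter fun y => l y ≠ 0) ⊂ S := by
          rw [Finset.ssubset_iff_of_subset]
          · exact ⟨y, hyS, by simp [hy]⟩
          · intro z hz
            rw [hS]
            exact h4 z (by simpa using hz)
        have := Finset.card_lt_card this
        omega)
    exact ⟨l', S', g1, fun e => (g2 e).trans (h2 e), g3.trans h3, g4, g5⟩

lemma reduce {T Y E Ω : Type*} [Fintype T] [Fintype Y] [Fintype E] [Fintype Ω] (kk : T → ℝ) (hk : ∀ t, 0 ≤ kk t)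
    (π : T → Y) (C : T → E) (q : Ω → ℝ) (πq : Ω → Y) {m : ℕ} (f : Fin m → Ω → ℝ) (f0 : Ω → ℝ)
    (hq : ∀ v, q v ≠ 0 → ∃ t, kk t ≠ 0 ∧ π t = πq v) :
    ∃ (l : Y → ℝ) (S : Finset Y), (∀ y, 0 ≤ l y) ∧
      (∀ e, ∑ t, kk t * l (π t) * ind (C t = e) = ∑ t, kk t * ind (C t = e)) ∧
      (∀ i, ∑ v, q v * l (πq v) * f i v = ∑ v, q v * f i v) ∧
      ∑ v, q v * l (πq v) * f0 v ≤ ∑ v, q v * f0 v ∧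
      (∀ y, y ∈ S ↔ l y ≠ 0) ∧ S.card ≤ Fintype.card E + m := by
  classical
  have hA : ∀ (l : Y → ℝ) (e : E), ∑ y, l y * ∑ t, kk t * ind (C t = e) * ind (y = π t) = ∑ t, kk t * l (π t) * ind (C t = e) := by
    intro l e
    simp_rw [Finset.mul_sum]
    rw [Finset.sum_comm]
    refine Finset.sum_congr rfl fun t _ => ?_
    have := sum_mul_ind (fun y => l y * (kk t * ind (C t = e))) (π t)
    simp_rw [mul_assoc] at this ⊢
    rw [this]
    ring
  have hB : ∀ (l : Y → ℝ) (g : Ω → ℝ), ∑ y, l y * ∑ v, q v * g v * ind (y = πq v) = ∑ v, q v * l (πq v) * g v := by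
    intro l g
    simp_rw [Finset.mul_sum]
    rw [Finset.sum_comm]
    refine Finset.sum_congr rfl fun t _ => ?_
    have := sum_mul_ind (fun y => l y * (q t * g t)) (πq t)
    simp_rw [mul_assoc] at this ⊢
    rw [this]
    ring
  obtain ⟨tot, htot⟩ : ∃ tot : Y → ℝ, tot = fun y => ∑ t, kk t * ind (y = π t) := ⟨_, rfl⟩
  have htot0 : ∀ y, 0 ≤ tot y := by
    intro y
    rw [htot]
    exact Finset.sum_nonneg fun t _ => mul_nonneg (hk t) (ind_nonneg _)
  have htpos : ∀ t, kk t ≠ 0 → tot (π t) ≠ 0 := by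
    intro t ht h
    simp only [htot] at h
    rw [Finset.sum_eq_zero_iff_of_nonneg (fun t _ => mul_nonneg (hk t) (ind_nonneg _))] at h
    have := h t (Finset.mem_univ t)
    rw [ind_true rfl, mul_one] at this
    exact ht this
  obtain ⟨l0, hl0⟩ : ∃ l0 : Y → ℝ, l0 = fun y => if tot y = 0 then 0 else 1 := ⟨_, rfl⟩
  obtain ⟨l, S, h1, h2, h3, h4, h5⟩ := lp (E := E ⊕ Fin m)
    (fun y e => Sum.elim (fun e => ∑ t, kk t * ind (C t = e) * ind (y = π t)) (fun i => ∑ v, q v * f i v * ind (y = πq v)) e)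
    (fun y => ∑ v, q v * f0 v * ind (y = πq v)) (Sum.elim (fun _ => 1) (fun _ => 0)) _ l0
    (by intro y; rw [hl0]; dsimp only; split_ifs <;> norm_num)
    (by
      intro y hy
      have hty : tot y ≠ 0 := by
        intro h
        simp [hl0, h] at hy
      simp only [Fintype.sum_sum_type, Sum.elim_inl, Sum.elim_inr, one_mul, zero_mul, Finset.sum_const_zero, add_zero]
      rw [Finset.sum_comm]
      have : ∀ t, ∑ e, kk t * ind (C t = e) * ind (y = π t) = kk t * ind (y = π t) := by
        intro t
        have := sum_mul_ind (fun _ => kk t * ind (y = π t)) (C t)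
        rw [← this]
        refine Finset.sum_congr rfl fun e _ => ?_
        rw [show (C t = e) = (e = C t) from propext eq_comm]
        ring
      simp_rw [this]
      have h := htot0 y
      rw [htot] at h hty
      exact lt_of_le_of_ne h (Ne.symm hty))
    (Finset.univ.filter fun y => l0 y ≠ 0) (by simp) le_rfl
  refine ⟨l, S, h1, ?_, ?_, ?_, h4, by simpa using h5⟩
  · intro e
    have := h2 (Sum.inl e)
    simp only [Sum.elim_inl] at this
    rw [hA, hA] at this
    rw [this]
    refine Finset.sum_congr rfl fun t _ => ?_
    by_cases ht : kk t = 0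
    · simp [ht]
    · rw [hl0]
      simp [htpos t ht]
  · intro i
    have := h2 (Sum.inr i)
    simp only [Sum.elim_inr] at this
    rw [hB, hB] at this
    rw [this]
    refine Finset.sum_congr rfl fun v _ => ?_
    by_cases hv : q v = 0
    · simp [hv]
    · obtain ⟨t, ht, e⟩ := hq v hv
      rw [hl0]
      simp [← e, htpos t ht]
  · rw [hB, hB] at h3
    refine h3.trans (le_of_eq ?_)
    refine Finset.sum_congr rfl fun v _ => ?_
    by_cases hv : q v = 0
    · simp [hv]
    · obtain ⟨t, ht, e⟩ := hq v hv
      rw [hl0]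
      simp [← e, htpos t ht]

/-- pointwise conditional information -/
def hp' {Ω α β : Type*} [Fintype Ω] [Fintype α] [Fintype β] (q : Ω → ℝ) (Z : Ω → α) (Y : Ω → β) (ω : Ω) : ℝ :=
  Real.logb 2 (IT.dist q Y (Y ω)) - Real.logb 2 (IT.dist q (fun ω => (Z ω, Y ω)) (Z ω, Y ω))

lemma dist_rew {Ω β : Type*} [Fintype Ω] [Fintype β] (q : Ω → ℝ) (Y : Ω → β) (l : Ω → ℝ) (ω : Ω)
    (hl : ∀ ω', Y ω' = Y ω → l ω' = l ω) :
    IT.dist (fun ω => q ω * l ω) Y (Y ω) = l ω * IT.dist q Y (Y ω) := by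
  rw [dist_eq_ind, dist_eq_ind, Finset.mul_sum]
  refine Finset.sum_congr rfl fun ω' _ => ?_
  by_cases h : Y ω' = Y ω
  · rw [hl ω' h]; ring
  · rw [ind_false h]; ring

lemma condH_rew {Ω α β : Type*} [Fintype Ω] [Fintype α] [Fintype β] {q : Ω → ℝ} (hq : ∀ ω, 0 ≤ q ω)
    (Z : Ω → α) (Y : Ω → β) (l : Ω → ℝ) (hl : ∀ ω ω', Y ω' = Y ω → l ω' = l ω) :
    condH (fun ω => q ω * l ω) Z Y = ∑ ω, q ω * l ω * hp' q Z Y ω := by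
  unfold condH
  rw [H_eq, H_eq, neg_sub_neg, ← Finset.sum_sub_distrib]
  refine Finset.sum_congr rfl fun ω _ => ?_
  rw [dist_rew q Y l ω (hl ω), dist_rew q (fun ω => (Z ω, Y ω)) l ω (fun ω' h => hl ω ω' (congrArg Prod.snd h))]
  by_cases hq0 : q ω = 0
  · simp [hq0]
  by_cases hl0 : l ω = 0
  · simp [hl0]
  have hpos : 0 < q ω := lt_of_le_of_ne (hq ω) (Ne.symm hq0)
  have h1 := hpos.trans_le (le_dist hq Y ω)
  have h2 := hpos.trans_le (le_dist hq (fun ω => (Z ω, Y ω)) ω)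
  rw [Real.logb_mul hl0 h1.ne', Real.logb_mul hl0 h2.ne']
  unfold hp'
  ring

lemma condH_hp {Ω α β : Type*} [Fintype Ω] [Fintype α] [Fintype β] {q : Ω → ℝ} (hq : ∀ ω, 0 ≤ q ω)
    (Z : Ω → α) (Y : Ω → β) : condH q Z Y = ∑ ω, q ω * hp' q Z Y ω := by
  have := condH_rew hq Z Y (fun _ => 1) (fun _ _ _ => rfl)
  simpa using this

lemma exists_label {U : Type*} [Nonempty U] (S : Finset U) {N : ℕ} (hN : 0 < N) (h : S.card ≤ N) :
    ∃ (φ : U → Fin N) (σ : Fin N → U), ∀ u ∈ S, σ (φ u) = u := by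
  classical
  obtain ⟨e⟩ : Nonempty (S ↪ Fin N) := Function.Embedding.nonempty_of_card_le (by simpa using h)
  obtain ⟨φ, hφ⟩ : ∃ φ : U → Fin N, φ = fun u => if h : u ∈ S then e ⟨u, h⟩ else ⟨0, hN⟩ := ⟨_, rfl⟩
  have hinj : Set.InjOn φ S := by
    intro u hu v hv huv
    have hu' : u ∈ S := hu
    have hv' : v ∈ S := hv
    simp only [hφ, hu', hv', dif_pos] at huv
    have := e.injective huv
    simpa using this
  exact ⟨φ, Function.invFunOn φ S, fun u hu => hinj.leftInvOn_invFunOn hu⟩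

end lpsec
end TE

namespace TE

section card2
variable {X1 X2 X3 Xh2 : Type} [Fintype X1] [Fintype X2] [Fintype X3] [Fintype Xh2]
variable {U1 U2 : Type} [Fintype U1] [Fintype U2]

lemma sum_fib1 (G : X1 × X2 × U1 × U2 → ℝ) (a b) :
    ∑ t, G t * ind ((t.1, t.2.1) = (a, b)) = ∑ u, G (a, b, u) := by
  simp only [Fintype.sum_prod_type (α₁ := X1), Fintype.sum_prod_type (α₁ := X2), Prod.mk.injEq, ind_and]
  have : ∀ x y, ∑ u, G (x, y, u) * (ind (x = a) * ind (y = b)) = (∑ u, G (x, y, u)) * ind (y = b) * ind (x = a) := by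
    intro x y
    rw [mul_assoc, Finset.sum_mul]
    refine Finset.sum_congr rfl fun u _ => ?_
    ring
  simp_rw [this, ← Finset.sum_mul]
  rw [sum_mul_ind (fun x => ∑ y, (∑ u, G (x, y, u)) * ind (y = b)) a]
  exact sum_mul_ind (fun y => ∑ u, G (a, y, u)) b

lemma sum_fib2 (G : X1 × X2 × U1 × U2 → ℝ) (a b c) :
    ∑ t, G t * ind ((t.1, t.2.1, t.2.2.1) = (a, b, c)) = ∑ u, G (a, b, c, u) := by
  have := sum_fib1 (fun t => G t * ind (t.2.2.1 = c)) a b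
  have h2 : ∀ t : X1 × X2 × U1 × U2, G t * ind ((t.1, t.2.1, t.2.2.1) = (a, b, c)) = G t * ind (t.2.2.1 = c) * ind ((t.1, t.2.1) = (a, b)) := by
    intro t
    rw [mul_assoc, ← ind_and]
    congr 2
    simp only [Prod.mk.injEq, eq_iff_iff]
    tauto
  simp_rw [h2]
  rw [this]
  simp only [Fintype.sum_prod_type, ← Finset.sum_mul]
  exact sum_mul_ind (fun u1 => ∑ u2, G (a, b, u1, u2)) c

lemma jq_rew (p : X1 × X2 × X3 → ℝ) (k : X1 → X2 → U1 × U2 → ℝ) (l : X1 → U1 × U2 → ℝ) :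
    jq p (fun a b u => k a b u * l a u) = fun v => jq p k v * l v.1 v.2.2.2 := by
  funext v
  simp only [jq]
  ring

lemma jq_ne {p : X1 × X2 × X3 → ℝ} {k : X1 → X2 → U1 × U2 → ℝ} (v) (h : jq p k v ≠ 0) : k v.1 v.2.1 v.2.2.2 ≠ 0 :=
  right_ne_zero_of_mul h

set_option maxHeartbeats 1000000 in
lemma step1_core {p : X1 × X2 × X3 → ℝ} (hp : IsPMF p) 
    {k : X1 → X2 → U1 × U2 → ℝ} (hk0 : ∀ a b v, 0 ≤ k a b v) (hk1 : ∀ a b, ∑ v, k a b v = 1) (e32 e12 : X1 × X2 × X3 × U1 × U2 → ℝ)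
    (b : Bool) : 
    ∃ (k' : X1 → X2 → U1 × U2 → ℝ) (S : Finset (X1 × U1)),
      (∀ a b v, 0 ≤ k' a b v) ∧ (∀ a b, ∑ v, k' a b v = 1) ∧
      expect (jq p k') e32 = expect (jq p k) e32 ∧ expect (jq p k') e12 = expect (jq p k) e12 ∧
      - F1 p k' + F2 p k' - F3 p k' ≤ - F1 p k + F2 p k - F3 p k ∧
      (b = true → F3 p k' = F3 p k) ∧
      (∀ a b u, k' a b u ≠ 0 → (a, u.1) ∈ S) ∧
      S.card ≤ Fintype.card X1 * Fintype.card X2 + (if b then 3 else 2) := by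
  classical
  have hq := isPMF_jq hp hk0 hk1
  obtain ⟨h1, hh1⟩ : ∃ h, h = hp' (jq p k) (fun v => v.2.1) (fun v => (v.1, v.2.2.2.1)) := ⟨_, rfl⟩
  obtain ⟨h2, hh2⟩ : ∃ h, h = hp' (jq p k) (fun v => v.2.1) (fun v => (v.1, v.2.2.1, v.2.2.2.1)) := ⟨_, rfl⟩
  obtain ⟨h3, hh3⟩ : ∃ h, h = hp' (jq p k) (fun v => v.2.1) (fun v => (v.1, v.2.2.1, v.2.2.2.1, v.2.2.2.2)) := ⟨_, rfl⟩
  have key : ∃ (l : X1 × U1 → ℝ) (S : Finset (X1 × U1)), (∀ y, 0 ≤ l y) ∧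
      (∀ e, ∑ t : X1 × X2 × U1 × U2, k t.1 t.2.1 t.2.2 * l (t.1, t.2.2.1) * ind ((t.1, t.2.1) = e) =
          ∑ t : X1 × X2 × U1 × U2, k t.1 t.2.1 t.2.2 * ind ((t.1, t.2.1) = e)) ∧
      (∑ v, jq p k v * l (v.1, v.2.2.2.1) * e32 v = ∑ v, jq p k v * e32 v) ∧
      (∑ v, jq p k v * l (v.1, v.2.2.2.1) * e12 v = ∑ v, jq p k v * e12 v) ∧
      (b = true → ∑ v, jq p k v * l (v.1, v.2.2.2.1) * h3 v = ∑ v, jq p k v * h3 v) ∧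
      ∑ v, jq p k v * l (v.1, v.2.2.2.1) * (- h1 v + h2 v - h3 v) ≤ ∑ v, jq p k v * (- h1 v + h2 v - h3 v) ∧
      (∀ y, y ∈ S ↔ l y ≠ 0) ∧ S.card ≤ Fintype.card X1 * Fintype.card X2 + (if b then 3 else 2) := by
    cases b with
    | true =>
      obtain ⟨l, S, g1, g2, g3, g4, g5, g6⟩ := reduce (T := X1 × X2 × U1 × U2) (Y := X1 × U1) (E := X1 × X2)
        (fun t => k t.1 t.2.1 t.2.2) (fun t => hk0 _ _ _) (fun t => (t.1, t.2.2.1)) (fun t => (t.1, t.2.1))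
        (jq p k) (fun v => (v.1, v.2.2.2.1)) ![e32, e12, h3] (fun v => - h1 v + h2 v - h3 v)
        (fun v hv => ⟨(v.1, v.2.1, v.2.2.2), jq_ne v hv, rfl⟩)
      refine ⟨l, S, g1, g2, g3 0, g3 1, fun _ => g3 2, g4, g5, ?_⟩
      simpa using g6
    | false =>
      obtain ⟨l, S, g1, g2, g3, g4, g5, g6⟩ := reduce (T := X1 × X2 × U1 × U2) (Y := X1 × U1) (E := X1 × X2)
        (fun t => k t.1 t.2.1 t.2.2) (fun t => hk0 _ _ _) (fun t => (t.1, t.2.2.1)) (fun t => (t.1, t.2.1))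
        (jq p k) (fun v => (v.1, v.2.2.2.1)) ![e32, e12] (fun v => - h1 v + h2 v - h3 v)
        (fun v hv => ⟨(v.1, v.2.1, v.2.2.2), jq_ne v hv, rfl⟩)
      refine ⟨l, S, g1, g2, g3 0, g3 1, fun h => by simp at h, g4, g5, ?_⟩
      simpa using g6
  obtain ⟨l, S, l0, lc, l32, l12, l3, lA, hS, hcard⟩ := key
  obtain ⟨k', hk'⟩ : ∃ k' : X1 → X2 → U1 × U2 → ℝ, k' = fun a b u => k a b u * l (a, u.1) := ⟨_, rfl⟩
  have hjq : jq p k' = fun v => jq p k v * l (v.1, v.2.2.2.1) := by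
    rw [hk']
    exact jq_rew p k (fun a u => l (a, u.1))
  have r1 : F1 p k' = ∑ v, jq p k v * l (v.1, v.2.2.2.1) * h1 v := by
    unfold F1
    rw [hjq, hh1]
    refine condH_rew hq.1 _ _ (fun v => l (v.1, v.2.2.2.1)) ?_
    intro ω ω' h
    simp only [Prod.mk.injEq] at h
    simp only [h]
  have r2 : F2 p k' = ∑ v, jq p k v * l (v.1, v.2.2.2.1) * h2 v := by
    unfold F2
    rw [hjq, hh2]
    refine condH_rew hq.1 _ _ (fun v => l (v.1, v.2.2.2.1)) ?_
    intro ω ω' h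
    simp only [Prod.mk.injEq] at h
    simp only [h]
  have r3 : F3 p k' = ∑ v, jq p k v * l (v.1, v.2.2.2.1) * h3 v := by
    unfold F3
    rw [hjq, hh3]
    refine condH_rew hq.1 _ _ (fun v => l (v.1, v.2.2.2.1)) ?_
    intro ω ω' h
    simp only [Prod.mk.injEq] at h
    simp only [h]
  have s1 : F1 p k = ∑ v, jq p k v * h1 v := by rw [hh1]; exact condH_hp hq.1 _ _
  have s2 : F2 p k = ∑ v, jq p k v * h2 v := by rw [hh2]; exact condH_hp hq.1 _ _
  have s3 : F3 p k = ∑ v, jq p k v * h3 v := by rw [hh3]; exact condH_hp hq.1 _ _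
  refine ⟨k', S, ?_, ?_, ?_, ?_, ?_, ?_, ?_, hcard⟩
  · intro a b v
    rw [hk']
    exact mul_nonneg (hk0 _ _ _) (l0 _)
  · intro a b
    have := lc (a, b)
    rw [sum_fib1 (fun t => k t.1 t.2.1 t.2.2 * l (t.1, t.2.2.1)), sum_fib1 (fun t => k t.1 t.2.1 t.2.2)] at this
    rw [hk']
    exact this.trans (hk1 a b)
  · unfold expect
    rw [hjq]
    exact l32
  · unfold expect
    rw [hjq]
    exact l12
  · rw [r1, r2, r3, s1, s2, s3]
    simp only [mul_sub, mul_add, mul_neg, Finset.sum_sub_distrib, Finset.sum_add_distrib, Finset.sum_neg_distrib] at lA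
    exact lA
  · intro h
    rw [r3, s3]
    exact l3 h
  · intro a b u hu
    rw [hS]
    rw [hk'] at hu
    exact right_ne_zero_of_mul hu

set_option maxHeartbeats 1000000 in
lemma step1 [Nonempty X1] [Nonempty X2] {p : X1 × X2 × X3 → ℝ} (hp : IsPMF p) {d2 : X2 → Xh2 → ℝ} {R1 R2 D12 D32 : ℝ}
    (h : RegU p d2 R1 R2 D12 D32 U1 U2) :
    RegU p d2 R1 R2 D12 D32 (Fin (Fintype.card X1 * Fintype.card X2 + 2)) U2 := by
  classical
  obtain ⟨g32, g12, k, hk0, hk1, e32, e12, hR1, hR2, hR12⟩ := regK_of_regU hp h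
  obtain ⟨b, hb⟩ : ∃ b : Bool, b = decide (1 < Fintype.card X1) := ⟨_, rfl⟩
  obtain ⟨k', S, hk0', hk1', g1, g2, g3, g4, g5, g6⟩ := step1_core hp hk0 hk1 
    (fun v => d2 v.2.1 (g32 v.1 v.2.2.1 v.2.2.2.1 v.2.2.2.2)) (fun v => d2 v.2.1 (g12 v.1 v.2.2.2.1)) b
  obtain ⟨-, -, -, fC⟩ := jq_forms hp hk0' hk1'
  have hex : ∀ a : X1, ∃ u : U1, (a, u) ∈ S := by
    intro a
    have h := hk1' a (Classical.arbitrary X2)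
    have : ∃ v, k' a (Classical.arbitrary X2) v ≠ 0 := by
      by_contra hc
      push Not at hc
      simp [hc] at h
    obtain ⟨v, hv⟩ := this
    exact ⟨v.1, g5 a _ v hv⟩
  haveI : Nonempty U1 := ⟨(hex (Classical.arbitrary X1)).choose⟩
  have hfib : ∀ a : X1, (Finset.univ.filter fun u : U1 => (a, u) ∈ S).card ≤ Fintype.card X1 * Fintype.card X2 + 2 := by
    intro a
    have hle : (Finset.univ.filter fun u : U1 => (a, u) ∈ S).card = (S.filter fun y => y.1 = a).card := by
      refine Finset.card_bij (fun u _ => (a, u)) ?_ ?_ ?_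
      · intro u hu
        simpa using hu
      · intro u _ v _ huv
        simpa using huv
      · rintro ⟨x, u⟩ hu
        simp only [Finset.mem_filter] at hu
        obtain ⟨hu, rfl⟩ := hu
        exact ⟨u, by simpa using hu, rfl⟩
    rw [hle]
    by_cases hc : 1 < Fintype.card X1
    · haveI := Fintype.one_lt_card_iff_nontrivial.1 hc
      obtain ⟨a', ha'⟩ := exists_ne a
      obtain ⟨u', hu'⟩ := hex a'
      have hss : (S.filter fun y => y.1 = a) ⊂ S := by
        rw [Finset.ssubset_iff_of_subset (Finset.filter_subset _ _)]
        exact ⟨(a', u'), hu', by simp [ha']⟩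
      have := Finset.card_lt_card hss
      simp only [hb, hc, decide_true, if_true] at g6
      omega
    · simp only [hb, hc, decide_false, Bool.false_eq_true, if_false] at g6
      exact (Finset.card_filter_le _ _).trans g6
  choose φ σ hφσ using fun a => exists_label _ (by omega : 0 < Fintype.card X1 * Fintype.card X2 + 2) (hfib a)
  have hreg : RegKk p d2 R1 R2 D12 D32 g32 g12 k' := by
    refine ⟨hk0', hk1', g1.trans_le e32, g2.trans_le e12, hR1, by linarith, ?_⟩
    by_cases hc : 1 < Fintype.card X1
    · rw [g4 (by simp [hb, hc])]
      exact hR12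
    · haveI : Subsingleton X1 := Fintype.card_le_one_iff_subsingleton.1 (by omega)
      have z1 : condH p (fun v => v.1) (fun v => v.2.2) = 0 := by
        unfold condH
        rw [H_congr hp.1 (fun v => (v.1, v.2.2)) (fun v => v.2.2) (by
          intro v v' _ _
          simp only [Prod.mk.injEq, Subsingleton.elim v.1 v'.1, true_and]), sub_self]
      have z2 : condH p (fun v => v.1) (fun v => v.2.1) = 0 := by
        unfold condH
        rw [H_congr hp.1 (fun v => (v.1, v.2.1)) (fun v => v.2.1) (by
          intro v v' _ _
          simp only [Prod.mk.injEq, Subsingleton.elim v.1 v'.1, true_and]), sub_self]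
      linarith
  exact renameAux hp hreg φ (fun _ _ u => u) σ (fun _ _ u => u) (fun a b u hu => ⟨hφσ a u.1 (by simpa using g5 a b u hu), rfl⟩)

set_option maxHeartbeats 1000000 in
lemma step2 [Nonempty X1] [Nonempty X2] {p : X1 × X2 × X3 → ℝ} (hp : IsPMF p) {d2 : X2 → Xh2 → ℝ} {R1 R2 D12 D32 : ℝ}
    (h : RegU p d2 R1 R2 D12 D32 U1 U2) :
    RegU p d2 R1 R2 D12 D32 U1 (Fin (Fintype.card X1 * Fintype.card X2 * Fintype.card U1 + 1)) := by
  classical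
  obtain ⟨g32, g12, k, hk0, hk1, e32, e12, hR1, hR2, hR12⟩ := regK_of_regU hp h
  have hq := isPMF_jq hp hk0 hk1
  obtain ⟨h3, hh3⟩ : ∃ h, h = hp' (jq p k) (fun v => v.2.1) (fun v => (v.1, v.2.2.1, v.2.2.2.1, v.2.2.2.2)) := ⟨_, rfl⟩
  obtain ⟨l, S, l0, lc, l32, lA, hS, hcard⟩ := reduce (T := X1 × X2 × U1 × U2) (Y := X1 × U1 × U2) (E := X1 × X2 × U1)
        (fun t => k t.1 t.2.1 t.2.2) (fun t => hk0 _ _ _) (fun t => (t.1, t.2.2)) (fun t => (t.1, t.2.1, t.2.2.1))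
        (jq p k) (fun v => (v.1, v.2.2.2)) ![(fun v => d2 v.2.1 (g32 v.1 v.2.2.1 v.2.2.2.1 v.2.2.2.2))] (fun v => - h3 v)
        (fun v hv => ⟨(v.1, v.2.1, v.2.2.2), jq_ne v hv, rfl⟩)
  have l32 := l32 0
  simp only [Matrix.cons_val_zero] at l32
  obtain ⟨k', hk'⟩ : ∃ k' : X1 → X2 → U1 × U2 → ℝ, k' = fun a b u => k a b u * l (a, u) := ⟨_, rfl⟩
  have hjq : jq p k' = fun v => jq p k v * l (v.1, v.2.2.2) := by
    rw [hk']
    exact jq_rew p k (fun a u => l (a, u))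
  have hk0' : ∀ a b v, 0 ≤ k' a b v := by
    intro a b v
    rw [hk']
    exact mul_nonneg (hk0 _ _ _) (l0 _)
  have hm : ∀ a b u1, ∑ u2, k' a b (u1, u2) = ∑ u2, k a b (u1, u2) := by
    intro a b u1
    have := lc (a, b, u1)
    rw [sum_fib2 (fun t => k t.1 t.2.1 t.2.2 * l (t.1, t.2.2)), sum_fib2 (fun t => k t.1 t.2.1 t.2.2)] at this
    rw [hk']
    exact this
  have hk1' : ∀ a b, ∑ v, k' a b v = 1 := by
    intro a b
    rw [← hk1 a b, Fintype.sum_prod_type, Fintype.sum_prod_type]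
    simp_rw [hm]
  have hmd : IT.dist (jq p k') (fun v => (v.1, v.2.1, v.2.2.1, v.2.2.2.1)) = IT.dist (jq p k) (fun v => (v.1, v.2.1, v.2.2.1, v.2.2.2.1)) := by
    have gen : ∀ kk : X1 → X2 → U1 × U2 → ℝ, ∀ a b c u1, IT.dist (jq p kk) (fun v => (v.1, v.2.1, v.2.2.1, v.2.2.2.1)) (a, b, c, u1) =
        p (a, b, c) * ∑ u2, kk a b (u1, u2) := by
      intro kk a b c u1
      have e : ∀ v : X1 × X2 × X3 × U1 × U2, ind ((v.1, v.2.1, v.2.2.1, v.2.2.2.1) = (a, b, c, u1)) = ∑ u2, ind (v = (a, b, c, u1, u2)) := by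
        intro v
        have := sum_mul_ind (fun _ : U2 => ind ((v.1, v.2.1, v.2.2.1, v.2.2.2.1) = (a, b, c, u1))) v.2.2.2.2
        rw [← this]
        refine Finset.sum_congr rfl fun u2 _ => ?_
        rw [← ind_and]
        congr 1
        simp only [Prod.ext_iff, eq_iff_iff]
        constructor
        · rintro ⟨⟨h1, h2, h3, h4⟩, h5⟩
          exact ⟨h1, h2, h3, h4, h5.symm⟩
        · rintro ⟨h1, h2, h3, h4, h5⟩
          exact ⟨⟨h1, h2, h3, h4⟩, h5.symm⟩
      rw [dist_eq_ind]
      simp_rw [e, Finset.mul_sum]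
      rw [Finset.sum_comm]
      refine Finset.sum_congr rfl fun u2 _ => ?_
      exact sum_mul_ind (jq p kk) (a, b, c, u1, u2)
    funext x
    obtain ⟨a, b, c, u1⟩ := x
    rw [gen, gen, hm]
  have hH : ∀ {α : Type} [Fintype α] (f : X1 × X2 × X3 × U1 → α), H (jq p k') (fun v => f (v.1, v.2.1, v.2.2.1, v.2.2.2.1)) = H (jq p k) (fun v => f (v.1, v.2.1, v.2.2.1, v.2.2.2.1)) := by
    intro α _ f
    rw [← H_map (jq p k') (fun v => (v.1, v.2.1, v.2.2.1, v.2.2.2.1)) f, ← H_map (jq p k) (fun v => (v.1, v.2.1, v.2.2.1, v.2.2.2.1)) f, hmd]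
  have r1 : F1 p k' = F1 p k := by
    unfold F1 condH
    congr 1
    · exact hH (fun x => (x.2.1, x.1, x.2.2.2))
    · exact hH (fun x => (x.1, x.2.2.2))
  have r2 : F2 p k' = F2 p k := by
    unfold F2 condH
    congr 1
    · exact hH (fun x => (x.2.1, x.1, x.2.2.1, x.2.2.2))
    · exact hH (fun x => (x.1, x.2.2.1, x.2.2.2))
  have r3 : F3 p k' = ∑ v, jq p k v * l (v.1, v.2.2.2) * h3 v := by
    unfold F3
    rw [hjq, hh3]
    refine condH_rew hq.1 _ _ (fun v => l (v.1, v.2.2.2)) ?_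
    intro ω ω' h
    simp only [Prod.mk.injEq] at h
    have : ω'.2.2.2 = ω.2.2.2 := Prod.ext h.2.2.1 h.2.2.2
    simp only [h.1, this]
  have s3 : F3 p k = ∑ v, jq p k v * h3 v := by rw [hh3]; exact condH_hp hq.1 _ _
  have r3' : F3 p k ≤ F3 p k' := by
    rw [r3, s3]
    simp only [mul_neg, Finset.sum_neg_distrib] at lA
    linarith
  have d12 : expect (jq p k') (fun v => d2 v.2.1 (g12 v.1 v.2.2.2.1)) = expect (jq p k) (fun v => d2 v.2.1 (g12 v.1 v.2.2.2.1)) := by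
    have a1 := expect_map (jq p k') (fun v => (v.1, v.2.1, v.2.2.1, v.2.2.2.1)) (fun x => d2 x.2.1 (g12 x.1 x.2.2.2))
    have a2 := expect_map (jq p k) (fun v => (v.1, v.2.1, v.2.2.1, v.2.2.2.1)) (fun x => d2 x.2.1 (g12 x.1 x.2.2.2))
    rw [hmd] at a1
    exact a1.symm.trans a2
  have d32 : expect (jq p k') (fun v => d2 v.2.1 (g32 v.1 v.2.2.1 v.2.2.2.1 v.2.2.2.2)) = expect (jq p k) (fun v => d2 v.2.1 (g32 v.1 v.2.2.1 v.2.2.2.1 v.2.2.2.2)) := by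
    unfold expect
    rw [hjq]
    exact l32
  have hreg : RegKk p d2 R1 R2 D12 D32 g32 g12 k' := by
    refine ⟨hk0', hk1', d32.trans_le e32, d12.trans_le e12, hR1, by linarith, by linarith⟩
  have hne : Nonempty (U1 × U2) := by
    by_contra hemp
    rw [not_nonempty_iff] at hemp
    have h := hk1 (Classical.arbitrary X1) (Classical.arbitrary X2)
    simp at h
  haveI : Nonempty U2 := ⟨hne.some.2⟩
  have hfib : ∀ (a : X1) (u1 : U1), (Finset.univ.filter fun u : U2 => (a, u1, u) ∈ S).card ≤ Fintype.card X1 * Fintype.card X2 * Fintype.card U1 + 1 := by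
    intro a u1
    have : (Finset.univ.filter fun u : U2 => (a, u1, u) ∈ S).card ≤ S.card := by
      refine Finset.card_le_card_of_injOn (fun u => (a, u1, u)) ?_ ?_
      · intro u hu
        simpa using hu
      · intro u _ v _ huv
        simpa using huv
    refine this.trans ?_
    simpa [mul_assoc] using hcard
  choose φ σ hφσ using fun a u1 => exists_label _ (by omega : 0 < Fintype.card X1 * Fintype.card X2 * Fintype.card U1 + 1) (hfib a u1)
  refine renameAux hp hreg (fun _ u => u) φ (fun _ u => u) σ (fun a b u hu => ⟨rfl, hφσ a u.1 u.2 ?_⟩)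
  rw [hk'] at hu
  have := (hS (a, u)).2 (right_ne_zero_of_mul hu)
  simpa using this

end card2
end TE

namespace TE

section compact
variable {X1 X2 X3 Xh2 : Type} [Fintype X1] [Fintype X2] [Fintype X3] [Fintype Xh2]
variable {U1 U2 : Type} [Fintype U1] [Fintype U2]

lemma cont_mul_logb : Continuous (fun x : ℝ => x * Real.logb 2 x) := by
  unfold Real.logb
  have : (fun x : ℝ => x * (Real.log x / Real.log 2)) = fun x => x * Real.log x / Real.log 2 := by
    funext x; ring
  rw [this]
  exact Real.continuous_mul_log.div_const _

lemma cont_H_jq (p : X1 × X2 × X3 → ℝ) {α : Type*} [Fintype α] (X : X1 × X2 × X3 × U1 × U2 → α) :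
    Continuous (fun k : X1 → X2 → U1 × U2 → ℝ => H (jq p k) X) := by
  unfold H
  refine Continuous.neg (continuous_finset_sum _ fun a _ => ?_)
  refine cont_mul_logb.comp ?_
  simp only [dist_eq_ind, jq]
  fun_prop

lemma cont_condH_jq (p : X1 × X2 × X3 → ℝ) {α β : Type*} [Fintype α] [Fintype β] (X : X1 × X2 × X3 × U1 × U2 → α) (Y : X1 × X2 × X3 × U1 × U2 → β) :
    Continuous (fun k : X1 → X2 → U1 × U2 → ℝ => condH (jq p k) X Y) :=
  (cont_H_jq p _).sub (cont_H_jq p _)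

lemma cont_expect_jq (p : X1 × X2 × X3 → ℝ) (f : X1 × X2 × X3 × U1 × U2 → ℝ) :
    Continuous (fun k : X1 → X2 → U1 × U2 → ℝ => expect (jq p k) f) := by
  unfold expect
  simp only [jq]
  fun_prop

lemma isClosed_regK (p : X1 × X2 × X3 → ℝ) (d2 : X2 → Xh2 → ℝ) (R1 R2 D12 D32 : ℝ)
    (g32 : X1 → X3 → U1 → U2 → Xh2) (g12 : X1 → U1 → Xh2) :
    IsClosed {k : X1 → X2 → U1 × U2 → ℝ | RegKk p d2 R1 R2 D12 D32 g32 g12 k} := by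
  have c1 : Continuous (fun k : X1 → X2 → U1 × U2 → ℝ => F1 p k) := cont_condH_jq p _ _
  have c2 : Continuous (fun k : X1 → X2 → U1 × U2 → ℝ => F2 p k) := cont_condH_jq p _ _
  have c3 : Continuous (fun k : X1 → X2 → U1 × U2 → ℝ => F3 p k) := cont_condH_jq p _ _
  unfold RegKk
  simp only [Set.setOf_and, Set.setOf_forall]
  refine IsClosed.inter ?_ (IsClosed.inter ?_ (IsClosed.inter ?_ (IsClosed.inter ?_ (IsClosed.inter ?_ (IsClosed.inter ?_ ?_)))))
  · refine isClosed_iInter fun a => isClosed_iInter fun b => isClosed_iInter fun v => isClosed_le ?_ ?_ <;> fun_prop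
  · refine isClosed_iInter fun a => isClosed_iInter fun b => isClosed_eq ?_ ?_ <;> fun_prop
  · exact isClosed_le (cont_expect_jq p _) continuous_const
  · exact isClosed_le (cont_expect_jq p _) continuous_const
  · exact isClosed_const
  · exact isClosed_le (by fun_prop) continuous_const
  · exact isClosed_le (by fun_prop) continuous_const

lemma isCompact_regK (p : X1 × X2 × X3 → ℝ) (d2 : X2 → Xh2 → ℝ) (R1 R2 D12 D32 : ℝ)
    (g32 : X1 → X3 → U1 → U2 → Xh2) (g12 : X1 → U1 → Xh2) :
    IsCompact {k : X1 → X2 → U1 × U2 → ℝ | RegKk p d2 R1 R2 D12 D32 g32 g12 k} := by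
  refine IsCompact.of_isClosed_subset (s := Set.Icc (fun _ _ _ => 0) (fun _ _ _ => 1)) isCompact_Icc
    (isClosed_regK p d2 R1 R2 D12 D32 g32 g12) ?_
  intro k hk
  refine ⟨fun a b u => hk.1 a b u, fun a b u => ?_⟩
  show k a b u ≤ 1
  rw [← hk.2.1 a b]
  exact Finset.single_le_sum (f := fun v => k a b v) (fun v _ => hk.1 a b v) (Finset.mem_univ u)

lemma regK_mono {p : X1 × X2 × X3 → ℝ} {d2 : X2 → Xh2 → ℝ} {R1 R2 D12 D32 δ δ' : ℝ} (h : δ ≤ δ')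
    {g32 : X1 → X3 → U1 → U2 → Xh2} {g12 : X1 → U1 → Xh2} {k : X1 → X2 → U1 × U2 → ℝ}
    (hk : RegKk p d2 (R1 + δ) (R2 + δ) (D12 + δ) (D32 + δ) g32 g12 k) :
    RegKk p d2 (R1 + δ') (R2 + δ') (D12 + δ') (D32 + δ') g32 g12 k := by
  obtain ⟨h0, h1, h2, h3, h4, h5, h6⟩ := hk
  exact ⟨h0, h1, by linarith, by linarith, by linarith, by linarith, by linarith⟩

lemma regU_limit {p : X1 × X2 × X3 → ℝ} (hp : IsPMF p) {d2 : X2 → Xh2 → ℝ} {R1 R2 D12 D32 : ℝ}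
    (h : ∀ δ > 0, RegU p d2 (R1 + δ) (R2 + δ) (D12 + δ) (D32 + δ) U1 U2) :
    RegU p d2 R1 R2 D12 D32 U1 U2 := by
  classical
  have hδ : ∀ m : ℕ, (0 : ℝ) < 1 / (m + 1) := fun m => by positivity
  have hanti : ∀ {m m' : ℕ}, m ≤ m' → (1 : ℝ) / (m' + 1) ≤ 1 / (m + 1) := by
    intro m m' hm
    have : (m : ℝ) ≤ m' := by exact_mod_cast hm
    exact one_div_le_one_div_of_le (by positivity) (by linarith)
  have hm : ∀ m : ℕ, ∃ (g : (X1 → X3 → U1 → U2 → Xh2) × (X1 → U1 → Xh2)), ∃ k : X1 → X2 → U1 × U2 → ℝ,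
      RegKk p d2 (R1 + 1 / ((m : ℝ) + 1)) (R2 + 1 / ((m : ℝ) + 1)) (D12 + 1 / ((m : ℝ) + 1)) (D32 + 1 / ((m : ℝ) + 1)) g.1 g.2 k := by
    intro m
    obtain ⟨g32, g12, k, hk⟩ := regK_of_regU hp (h _ (hδ m))
    exact ⟨(g32, g12), k, hk⟩
  have hg : ∃ (g : (X1 → X3 → U1 → U2 → Xh2) × (X1 → U1 → Xh2)), ∀ m : ℕ, ∃ k : X1 → X2 → U1 × U2 → ℝ,
      RegKk p d2 (R1 + 1 / ((m : ℝ) + 1)) (R2 + 1 / ((m : ℝ) + 1)) (D12 + 1 / ((m : ℝ) + 1)) (D32 + 1 / ((m : ℝ) + 1)) g.1 g.2 k := by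
    by_contra hc
    push Not at hc
    choose M hM using hc
    obtain ⟨g, k, hk⟩ := hm (Finset.univ.sup M)
    exact hM g k (regK_mono (hanti (Finset.le_sup (Finset.mem_univ g))) hk)
  obtain ⟨g, hg⟩ := hg
  have := IsCompact.nonempty_iInter_of_sequence_nonempty_isCompact_isClosed
    (fun m : ℕ => {k : X1 → X2 → U1 × U2 → ℝ | RegKk p d2 (R1 + 1 / ((m : ℝ) + 1)) (R2 + 1 / ((m : ℝ) + 1)) (D12 + 1 / ((m : ℝ) + 1)) (D32 + 1 / ((m : ℝ) + 1)) g.1 g.2 k})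
    (fun m k hk => regK_mono (hanti (Nat.le_succ m)) hk)
    hg (isCompact_regK _ _ _ _ _ _ _ _) (fun m => isClosed_regK _ _ _ _ _ _ _ _)
  obtain ⟨k, hk⟩ := this
  simp only [Set.mem_iInter, Set.mem_setOf_eq] at hk
  refine regU_of_regK hp (g32 := g.1) (g12 := g.2) (k := k) ?_
  have hlim : ∀ {x y : ℝ} (c : ℝ), 0 ≤ c → (∀ m : ℕ, x ≤ y + c * (1 / ((m : ℝ) + 1))) → x ≤ y := by
    intro x y c hc hxy
    have ht : Filter.Tendsto (fun m : ℕ => y + c * (1 / ((m : ℝ) + 1))) Filter.atTop (nhds (y + c * 0)) :=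
      (tendsto_one_div_add_atTop_nhds_zero_nat.const_mul c).const_add y
    rw [mul_zero, add_zero] at ht
    exact ge_of_tendsto' ht hxy
  refine ⟨(hk 0).1, (hk 0).2.1, hlim 1 zero_le_one fun m => ?_, hlim 1 zero_le_one fun m => ?_, hlim 1 zero_le_one fun m => ?_,
    hlim 1 zero_le_one fun m => ?_, hlim 2 zero_le_two fun m => ?_⟩
  · rw [one_mul]; exact (hk m).2.2.1
  · rw [one_mul]; exact (hk m).2.2.2.1
  · rw [one_mul]; exact (hk m).2.2.2.2.1
  · rw [one_mul]; exact (hk m).2.2.2.2.2.1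
  · have := (hk m).2.2.2.2.2.2
    linarith

lemma tau_lim (c : ℝ) : Filter.Tendsto (fun ε => ε + tau c ε) (nhds 0) (nhds 0) := by
  have h : Continuous (fun ε : ℝ => ε * (-Real.logb 2 ε + c)) := by
    have := cont_mul_logb
    have e : (fun ε : ℝ => ε * (-Real.logb 2 ε + c)) = fun ε => -(ε * Real.logb 2 ε) + ε * c := by
      funext x; ring
    rw [e]
    fun_prop
  have h2 : ContinuousAt (fun ε : ℝ => -Real.logb 2 (1 - ε)) 0 := by
    unfold Real.logb
    refine ContinuousAt.neg (ContinuousAt.div_const (ContinuousAt.log (by fun_prop) (by norm_num)) _)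
  have h3 : ContinuousAt (fun ε : ℝ => ε + tau c ε) 0 := by
    unfold tau
    exact continuousAt_id.add (h2.add h.continuousAt)
  have := h3.tendsto
  simpa [tau] using this

lemma tau_small (c δ : ℝ) (hδ : 0 < δ) : ∃ ε, 0 < ε ∧ ε < 1 ∧ ε ≤ δ ∧ ε + tau c ε ≤ δ := by
  have h1 : ∀ᶠ ε in nhdsWithin (0 : ℝ) (Set.Ioi 0), ε + tau c ε < δ :=
    ((tau_lim c).mono_left nhdsWithin_le_nhds).eventually (gt_mem_nhds hδ)
  have h2 : ∀ᶠ ε in nhdsWithin (0 : ℝ) (Set.Ioi 0), ε < δ :=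
    (nhdsWithin_le_nhds : nhdsWithin (0 : ℝ) (Set.Ioi 0) ≤ nhds 0) (gt_mem_nhds hδ)
  have h3 : ∀ᶠ ε in nhdsWithin (0 : ℝ) (Set.Ioi 0), ε < 1 :=
    (nhdsWithin_le_nhds : nhdsWithin (0 : ℝ) (Set.Ioi 0) ≤ nhds 0) (gt_mem_nhds one_pos)
  have h4 : ∀ᶠ ε in nhdsWithin (0 : ℝ) (Set.Ioi 0), 0 < ε := self_mem_nhdsWithin
  obtain ⟨ε, a1, a2, a3, a4⟩ := (h1.and (h2.and (h3.and h4))).exists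
  exact ⟨ε, a4, a3, a2.le, a1.le⟩

lemma regU_mono {p : X1 × X2 × X3 → ℝ} {d2 : X2 → Xh2 → ℝ} {R1 R2 D12 D32 R1' R2' D12' D32' : ℝ}
    (h : RegU p d2 R1 R2 D12 D32 U1 U2) (h1 : R1 ≤ R1') (h2 : R2 ≤ R2') (h3 : D12 ≤ D12') (h4 : D32 ≤ D32') :
    RegU p d2 R1' R2' D12' D32' U1 U2 := by
  obtain ⟨q, a1, a2, a3, g, g', b1, b2, b3, b4, b5⟩ := h
  exact ⟨q, a1, a2, a3, g, g', by linarith, by linarith, by linarith, by linarith, by linarith⟩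

theorem reg_of_ach [Nonempty X1] [Nonempty X2]
    (p : X1 × X2 × X3 → ℝ) (hp : IsPMF p) (d2 : X2 → Xh2 → ℝ)
    (R1 R2 D12 D32 : ℝ) (h : Ach p d2 R1 R2 D12 D32) : Reg p d2 R1 R2 D12 D32 := by
  have key : ∀ δ > 0, RegU p d2 (R1 + δ) (R2 + δ) (D12 + δ) (D32 + δ) (Fin (Fintype.card X1 * Fintype.card X2 + 2))
      (Fin (Fintype.card X1 * Fintype.card X2 * Fintype.card (Fin (Fintype.card X1 * Fintype.card X2 + 2)) + 1)) := by
    intro δ hδ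
    obtain ⟨ε, hε, hε1, hεδ, ht⟩ := tau_small (Real.logb 2 (Fintype.card X1)) δ hδ
    obtain ⟨n, K, hn, m1, m2, hm1, hm2, J1, J2, g12, g21, g31, g32, hc1, hc2, hr1, hr2, hd12, hl21, hl31, hd32⟩ := h ε hε
    have := conv_code p hp d2 R1 R2 D12 D32 ε hε hε1 hn m1 m2 hm1 hm2 J1 J2 g12 g21 g31 g32 hc1 hc2 hr1 hr2 hd12 hl21 hl31 hd32
    exact step2 hp (step1 hp (regU_mono this (by linarith) (by linarith) (by linarith) (by linarith)))
  have := regU_limit hp key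
  exact ⟨_, _, le_rfl, by rw [Fintype.card_fin], this⟩

end compact
end TE


/-- **Theorem 3** (two encoders and three decoders, lossless/lossy reconstruction with
side information).  Node 3 observes `X₃ⁿ` but sends no messages; nodes 1 and 2 interact
over `K` rounds.  Node 1 must reconstruct `X₂ⁿ` within distortion `D12`, node 2 must
reconstruct `X₁ⁿ` losslessly, and node 3 must reconstruct `X₁ⁿ` losslessly and `X₂ⁿ`
within distortion `D32`. -/
theorem two_encoders_three_decoders_side_information
    {X1 X2 X3 Xh2 : Type} [Fintype X1] [Fintype X2] [Fintype X3] [Fintype Xh2]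
    [Nonempty X1] [Nonempty X2] [Nonempty X3] [Nonempty Xh2]
    (p : X1 × X2 × X3 → ℝ) (hp : IsPMF p)
    (d2 : X2 → Xh2 → ℝ) (hd2 : ∀ x y, 0 ≤ d2 x y)
    (R1 R2 D12 D32 : ℝ) :
    (∀ ε > (0 : ℝ), ∃ (n K : ℕ), 0 < n ∧ ∃ m1 m2 : Fin K → ℕ,
      (∀ l, 0 < m1 l) ∧ (∀ l, 0 < m2 l) ∧
      ∃ (J1 : (l : Fin K) → (Fin n → X1 × X2 × X3) → Fin (m1 l))
        (J2 : (l : Fin K) → (Fin n → X1 × X2 × X3) → Fin (m2 l))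
        (g12 : (Fin n → X1) → ((l : Fin K) → Fin (m2 l)) → Fin n → Xh2)
        (g21 : (Fin n → X2) → ((l : Fin K) → Fin (m1 l)) → Fin n → X1)
        (g31 : (Fin n → X3) → ((l : Fin K) → Fin (m1 l)) → ((l : Fin K) → Fin (m2 l)) → Fin n → X1)
        (g32 : (Fin n → X3) → ((l : Fin K) → Fin (m1 l)) → ((l : Fin K) → Fin (m2 l)) → Fin n → Xh2),
        -- encoder causality
        (∀ l : Fin K, ∃ f : (Fin n → X1) →
            ((k : Fin K) → k.val < l.val → Fin (m2 k)) → Fin (m1 l),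
          ∀ ω, J1 l ω = f (fun t => (ω t).1) (fun k _ => J2 k ω)) ∧
        (∀ l : Fin K, ∃ f : (Fin n → X2) →
            ((k : Fin K) → k.val ≤ l.val → Fin (m1 k)) → Fin (m2 l),
          ∀ ω, J2 l ω = f (fun t => (ω t).2.1) (fun k _ => J1 k ω)) ∧
        -- rates
        (1 / (n : ℝ)) * ∑ l, Real.logb 2 (m1 l) ≤ R1 + ε ∧
        (1 / (n : ℝ)) * ∑ l, Real.logb 2 (m2 l) ≤ R2 + ε ∧
        -- node 1 reconstructs X₂ⁿ within distortion D12
        (1 / (n : ℝ)) * ∑ t : Fin n, IT.expect (iidW p n)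
            (fun ω => d2 (ω t).2.1
              (g12 (fun s => (ω s).1) (fun l => J2 l ω) t)) ≤ D12 + ε ∧
        -- node 2 reconstructs X₁ⁿ losslessly
        IT.pr (iidW p n)
          (fun ω => (fun t => g21 (fun s => (ω s).2.1) (fun l => J1 l ω) t) ≠
            fun t => (ω t).1) ≤ ε ∧
        -- node 3 reconstructs X₁ⁿ losslessly
        IT.pr (iidW p n)
          (fun ω => (fun t => g31 (fun s => (ω s).2.2) (fun l => J1 l ω) (fun l => J2 l ω) t) ≠
            fun t => (ω t).1) ≤ ε ∧
        -- node 3 reconstructs X₂ⁿ within distortion D32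
        (1 / (n : ℝ)) * ∑ t : Fin n, IT.expect (iidW p n)
            (fun ω => d2 (ω t).2.1
              (g32 (fun s => (ω s).2.2) (fun l => J1 l ω) (fun l => J2 l ω) t)) ≤ D32 + ε)
    ↔
    (∃ u1 u2 : ℕ, u1 ≤ Fintype.card X1 * Fintype.card X2 + 2 ∧
      u2 ≤ Fintype.card X1 * Fintype.card X2 * u1 + 1 ∧
      ∃ q : X1 × X2 × X3 × Fin u1 × Fin u2 → ℝ, IsPMF q ∧
        (∀ a b c, (∑ d : Fin u1, ∑ e : Fin u2, q (a, b, c, d, e)) = p (a, b, c)) ∧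
        -- Markov chain (U1,U2) -∘- (X1,X2) -∘- X3
        IT.condMutInfo q (fun v => (v.2.2.2.1, v.2.2.2.2)) (fun v => v.2.2.1)
          (fun v => (v.1, v.2.1)) = 0 ∧
        ∃ (g32 : X1 → X3 → Fin u1 → Fin u2 → Xh2) (g12 : X1 → Fin u1 → Xh2),
          IT.expect q (fun v => d2 v.2.1 (g32 v.1 v.2.2.1 v.2.2.2.1 v.2.2.2.2)) ≤ D32 ∧
          IT.expect q (fun v => d2 v.2.1 (g12 v.1 v.2.2.2.1)) ≤ D12 ∧
          IT.condH q (fun v => v.1) (fun v => v.2.1) ≤ R1 ∧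
          IT.condMutInfo q (fun v => v.2.2.2.1) (fun v => v.2.1) (fun v => v.1) +
            IT.condMutInfo q (fun v => v.2.2.2.2) (fun v => v.2.1)
              (fun v => (v.2.2.2.1, v.1, v.2.2.1)) ≤ R2 ∧
          IT.condH q (fun v => v.1) (fun v => v.2.2.1) +
            IT.condMutInfo q (fun v => (v.2.2.2.1, v.2.2.2.2)) (fun v => v.2.1)
              (fun v => (v.1, v.2.2.1)) ≤ R1 + R2) := by
  exact ⟨TE.reg_of_ach p hp d2 R1 R2 D12 D32, TE.ach_of_reg p hp d2 hd2 R1 R2 D12 D32⟩
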